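/- arXiv:2412.21041 — 3 statements merged into one kernel-verified Lean document; each statement's English description precedes it below -/
import Mathlib

section
/- There exist a measure-preserving bijection f̂ of T² whose lift F : ℝ² → ℝ² (satisfying F(x+m) = F(x)+m for all m ∈ ℤ²) extends to an entire holomorphic map ℂ² → ℂ², whose inverse likewise admits a lift extending to an entire holomorphic map, and a Borel probability measure ν on T² × ℙ(ℝ²) with marginal μ and absolutely continuous fibers, invariant under the projectivized derivative extension (f̂, df̂), such that (f̂, df̂) is weakly mixing with respect to ν. -/
noncomputable section
open MeasureTheory Filter Set

/-- The circle `ℝ/ℤ`. -/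
abbrev T1 : Type := AddCircle (1 : ℝ)
/-- The 2-torus `ℝ²/ℤ²`. -/
abbrev T2 : Type := T1 × T1

/-- Canonical projection `ℝ² → T²`. -/
def pro (x : ℝ × ℝ) : T2 := ((x.1 : T1), (x.2 : T1))

/-- `ℤ²`-equivariance of a map `ℝ² → ℝ²`. -/
def Zper (F : ℝ × ℝ → ℝ × ℝ) : Prop :=
  ∀ (x : ℝ × ℝ) (m : ℤ × ℤ),
    F (x.1 + (m.1 : ℝ), x.2 + (m.2 : ℝ)) = ((F x).1 + (m.1 : ℝ), (F x).2 + (m.2 : ℝ))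

/-- `Φ : ℂ² → ℂ²` is an entire holomorphic extension of `F : ℝ² → ℝ²`. -/
def IsEntireExtension (F : ℝ × ℝ → ℝ × ℝ) (Φ : ℂ × ℂ → ℂ × ℂ) : Prop :=
  Differentiable ℂ Φ ∧
  ∀ x : ℝ × ℝ, Φ ((x.1 : ℂ), (x.2 : ℂ)) = (((F x).1 : ℂ), ((F x).2 : ℂ))

/-- Weak mixing of a transformation w.r.t. a measure. -/
def WeakMixing {X : Type*} [MeasurableSpace X] (ν : Measure X) (T : X → X) : Prop :=
  ∃ s : ℕ → ℕ, StrictMono s ∧ ∀ A B : Set X, MeasurableSet A → MeasurableSet B →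
    Tendsto (fun n => ν (B ∩ (T^[s n]) ⁻¹' A)) atTop (nhds (ν A * ν B))

/-- The projectivization `ℙ(ℝ²)`. -/
abbrev PP := Projectivization ℝ (ℝ × ℝ)

instance : TopologicalSpace PP :=
  inferInstanceAs (TopologicalSpace (Quotient (projectivizationSetoid ℝ (ℝ × ℝ))))

instance : MeasurableSpace PP := borel PP

/-- The direction of angle `t` as a point of `ℙ(ℝ²)`. -/
def circDir (t : ℝ) : PP := Projectivization.mk ℝ (Real.cos t, Real.sin t) (by
  intro h
  have h1 : Real.cos t = 0 := congrArg Prod.fst h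
  have h2 : Real.sin t = 0 := congrArg Prod.snd h
  have h3 := Real.sin_sq_add_cos_sq t
  rw [h1, h2] at h3
  norm_num at h3)

/-- The pushforward to `ℙ(ℝ²)` of the Haar measure of the unit circle. -/
def circMeasure : Measure PP :=
  Measure.map circDir (volume.restrict (Set.Ico 0 (2 * Real.pi)))

/-- `ν` has marginal `μ` (the Haar measure of `T²`) and absolutely continuous fibers. -/
def MarginalMuAbsCtsFibers (ν : Measure (T2 × PP)) : Prop :=
  ν.map Prod.fst = (volume : Measure T2) ∧
  ∃ c : T2 → Measure PP, (∀ x, IsProbabilityMeasure (c x)) ∧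
    (∀ (A : Set T2) (B : Set PP), MeasurableSet A → MeasurableSet B →
      ν (A ×ˢ B) = ∫⁻ x in A, c x B ∂(volume : Measure T2)) ∧
    (∀ᵐ x ∂(volume : Measure T2), c x ≪ circMeasure)

/-- `Df` is the projectivized derivative extension `(f, df)` of the diffeomorphism with
lift `F`. -/
def IsProjDerivExt (F : ℝ × ℝ → ℝ × ℝ) (f : T2 → T2) (Df : T2 × PP → T2 × PP) : Prop :=
  ∀ (a : ℝ × ℝ) (v : ℝ × ℝ) (hv : v ≠ 0) (hw : fderiv ℝ F a v ≠ 0),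
    Df (pro a, Projectivization.mk ℝ v hv)
      = (f (pro a), Projectivization.mk ℝ (fderiv ℝ F a v) hw)


set_option linter.all false
open scoped Topology

/-- tangent bundle -/
abbrev EE : Type := T2 × (ℝ × ℝ)

def cxL : ℝ × ℝ →L[ℝ] ℂ × ℂ := Complex.ofRealCLM.prodMap Complex.ofRealCLM
def rpL : ℂ × ℂ →L[ℝ] ℝ × ℝ := Complex.reCLM.prodMap Complex.reCLM

lemma cxL_apply (x : ℝ × ℝ) : cxL x = ((x.1 : ℂ), (x.2 : ℂ)) := rfl
lemma rpL_apply (x : ℂ × ℂ) : rpL x = (x.1.re, x.2.re) := rfl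
lemma rpL_cxL (x : ℝ × ℝ) : rpL (cxL x) = x := by simp [rpL_apply, cxL_apply]

def rl (Φ : ℂ × ℂ → ℂ × ℂ) (x : ℝ × ℝ) : ℝ × ℝ := rpL (Φ (cxL x))
def dr (Φ : ℂ × ℂ → ℂ × ℂ) (a : ℝ × ℝ) : ℝ × ℝ →L[ℝ] ℝ × ℝ :=
  rpL ∘L ((fderiv ℂ Φ (cxL a)).restrictScalars ℝ) ∘L cxL
lemma dr_apply (Φ : ℂ × ℂ → ℂ × ℂ) (a v : ℝ × ℝ) : dr Φ a v = rpL (fderiv ℂ Φ (cxL a) (cxL v)) := rfl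

def r1 (x : T1) : ℝ := (AddCircle.equivIco 1 0 x : ℝ)
lemma coe_r1 (x : T1) : ((r1 x : ℝ) : T1) = x := AddCircle.coe_equivIco
lemma r1_mem (x : T1) : r1 x ∈ Ico (0:ℝ) 1 := by
  have := (AddCircle.equivIco 1 0 x).2
  simpa [r1] using this
lemma r1_coe (a : ℝ) : r1 (a : T1) = Int.fract a := by
  have := AddCircle.coe_equivIco_mk_apply (1:ℝ) a
  simpa [r1] using this
lemma exists_r1 (a : ℝ) : ∃ m : ℤ, a = r1 (a : T1) + m := ⟨⌊a⌋, by rw [r1_coe]; exact (Int.fract_add_floor a).symm⟩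
lemma measurable_r1 : Measurable r1 :=
  measurable_subtype_coe.comp (AddCircle.measurableEquivIco 1 0).measurable
lemma continuousAt_r1 {x : T1} (hx : x ≠ 0) : ContinuousAt r1 x :=
  continuous_subtype_val.continuousAt.comp (AddCircle.continuousAt_equivIco 1 0 (by simpa using hx))

def rep (z : T2) : ℝ × ℝ := (r1 z.1, r1 z.2)
lemma pro_rep (z : T2) : pro (rep z) = z := by simp [pro, rep, coe_r1]
lemma exists_rep (a : ℝ × ℝ) : ∃ m : ℤ × ℤ, a = rep (pro a) + ((m.1 : ℝ), (m.2 : ℝ)) := by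
  obtain ⟨m, hm⟩ := exists_r1 a.1
  obtain ⟨k, hk⟩ := exists_r1 a.2
  exact ⟨(m, k), by ext <;> simp [rep, pro] <;> assumption⟩
lemma pro_add_int (a : ℝ × ℝ) (m : ℤ × ℤ) : pro (a + ((m.1 : ℝ), (m.2 : ℝ))) = pro a := by
  have h : ∀ k : ℤ, ((k : ℝ) : T1) = 0 := fun k => by
    rw [AddCircle.coe_eq_zero_iff]; exact ⟨k, by simp⟩
  ext <;> simp [pro, h]

/-- lifted tangent map -/
def TL (Φ : ℂ × ℂ → ℂ × ℂ) (p : (ℝ × ℝ) × (ℝ × ℝ)) : (ℝ × ℝ) × (ℝ × ℝ) := (rl Φ p.1, dr Φ p.1 p.2)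
def Pj (p : (ℝ × ℝ) × (ℝ × ℝ)) : EE := (pro p.1, p.2)
def tor (Φ : ℂ × ℂ → ℂ × ℂ) (z : T2) : T2 := pro (rl Φ (rep z))
def tang (Φ : ℂ × ℂ → ℂ × ℂ) (w : EE) : EE := Pj (TL Φ (rep w.1, w.2))

def icx (m : ℤ × ℤ) : ℂ × ℂ := ((m.1 : ℂ), (m.2 : ℂ))
lemma cxL_add_int (a : ℝ × ℝ) (m : ℤ × ℤ) : cxL (a + ((m.1 : ℝ), (m.2 : ℝ))) = cxL a + icx m := by
  rw [map_add]; simp [cxL_apply, icx]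

structure Reg (Φ : ℂ × ℂ → ℂ × ℂ) : Prop where
  diff : Differentiable ℂ Φ
  real : ∀ x : ℝ × ℝ, Φ (cxL x) = cxL (rl Φ x)
  per : ∀ z m, Φ (z + icx m) = Φ z + icx m

lemma Reg.fderiv_per {Φ} (h : Reg Φ) (z m) : fderiv ℂ Φ (z + icx m) = fderiv ℂ Φ z := by
  have h1 : (fun z => Φ (z + icx m)) = fun z => Φ z + icx m := funext fun z => h.per z m
  have h2 := congrArg (fun g => fderiv ℂ g z) h1
  simp only [fderiv_comp_add_right] at h2
  rw [h2, fderiv_add_const]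

lemma Reg.rl_per {Φ} (h : Reg Φ) (a : ℝ × ℝ) (m : ℤ × ℤ) :
    rl Φ (a + ((m.1 : ℝ), (m.2 : ℝ))) = rl Φ a + ((m.1 : ℝ), (m.2 : ℝ)) := by
  rw [rl, cxL_add_int, h.per, map_add]; simp [rl, icx, rpL_apply]

lemma Reg.dr_per {Φ} (h : Reg Φ) (a : ℝ × ℝ) (m : ℤ × ℤ) :
    dr Φ (a + ((m.1 : ℝ), (m.2 : ℝ))) = dr Φ a := by
  rw [dr, cxL_add_int, h.fderiv_per]; rfl

lemma Reg.fderiv_real {Φ} (h : Reg Φ) (a v : ℝ × ℝ) : fderiv ℂ Φ (cxL a) (cxL v) = cxL (dr Φ a v) := by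
  have h1 : HasFDerivAt (fun x : ℝ × ℝ => Φ (cxL x)) (((fderiv ℂ Φ (cxL a)).restrictScalars ℝ) ∘L cxL) a :=
    ((h.diff (cxL a)).hasFDerivAt.restrictScalars ℝ).comp a cxL.hasFDerivAt
  have h2 : HasFDerivAt (fun x : ℝ × ℝ => cxL (rl Φ x)) (cxL ∘L dr Φ a) a :=
    cxL.hasFDerivAt.comp a (rpL.hasFDerivAt.comp a h1)
  have h3 : (fun x : ℝ × ℝ => Φ (cxL x)) = fun x => cxL (rl Φ x) := funext h.real
  rw [h3] at h1
  exact congrArg (fun L => L v) (h1.unique h2)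

lemma Reg.hasFDerivAt_rl {Φ} (h : Reg Φ) (a : ℝ × ℝ) : HasFDerivAt (rl Φ) (dr Φ a) a :=
  rpL.hasFDerivAt.comp a (((h.diff (cxL a)).hasFDerivAt.restrictScalars ℝ).comp a cxL.hasFDerivAt)

lemma Reg.tang_Pj {Φ} (h : Reg Φ) (p) : tang Φ (Pj p) = Pj (TL Φ p) := by
  obtain ⟨a, v⟩ := p
  obtain ⟨m, hm⟩ := exists_rep a
  have h1 : TL Φ (a, v) = (rl Φ (rep (pro a)) + ((m.1 : ℝ), (m.2 : ℝ)), dr Φ (rep (pro a)) v) := by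
    simp only [TL]
    rw [← h.rl_per, ← h.dr_per (rep (pro a)) m, ← hm]
  rw [h1]
  simp only [Pj, tang, TL, pro_add_int]

lemma Reg.tor_pro {Φ} (h : Reg Φ) (a) : tor Φ (pro a) = pro (rl Φ a) := by
  obtain ⟨m, hm⟩ := exists_rep a
  conv_rhs => rw [hm, h.rl_per, pro_add_int]
  rfl

lemma tang_fst (Φ) (w : EE) : (tang Φ w).1 = tor Φ w.1 := rfl
lemma tang_snd (Φ) (w : EE) : (tang Φ w).2 = dr Φ (rep w.1) w.2 := rfl

lemma Reg.rl_comp {Φ Ψ} (hΦ : Reg Φ) (hΨ : Reg Ψ) (a) : rl (Φ ∘ Ψ) a = rl Φ (rl Ψ a) := by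
  simp only [rl, Function.comp]
  rw [hΨ.real]; rfl

lemma Reg.comp {Φ Ψ} (hΦ : Reg Φ) (hΨ : Reg Ψ) : Reg (Φ ∘ Ψ) where
  diff := hΦ.diff.comp hΨ.diff
  real x := by
    rw [hΦ.rl_comp hΨ, Function.comp, hΨ.real, hΦ.real]
  per z m := by simp [Function.comp, hΨ.per, hΦ.per]

lemma Reg.id : Reg id where
  diff := differentiable_id
  real x := by simp [rl, rpL_cxL]
  per z m := rfl

lemma Reg.TL_comp {Φ Ψ} (hΦ : Reg Φ) (hΨ : Reg Ψ) (p) : TL (Φ ∘ Ψ) p = TL Φ (TL Ψ p) := by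
  simp only [TL]
  rw [hΦ.rl_comp hΨ]
  congr 1
  rw [dr_apply, fderiv_comp _ (hΦ.diff _) (hΨ.diff _), ContinuousLinearMap.comp_apply, hΨ.fderiv_real,
    hΨ.real]
  rfl

lemma Reg.tang_comp {Φ Ψ} (hΦ : Reg Φ) (hΨ : Reg Ψ) (w) : tang (Φ ∘ Ψ) w = tang Φ (tang Ψ w) := by
  conv_rhs => rw [tang.eq_def Ψ, hΦ.tang_Pj, ← hΦ.TL_comp hΨ]
  rfl

lemma tang_id (w) : tang (id) w = w := by
  simp [tang, TL, Pj, rl, dr_apply, rpL_cxL, pro_rep]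

lemma isOpenQuotientMap_pro : IsOpenQuotientMap pro := by
  have : IsOpenQuotientMap (fun x : ℝ => (x : T1)) := QuotientAddGroup.isOpenQuotientMap_mk
  exact this.prodMap this
lemma isOpenQuotientMap_Pj : IsOpenQuotientMap Pj := isOpenQuotientMap_pro.prodMap IsOpenQuotientMap.id

lemma continuous_TL {Φ} (h : ContDiff ℂ 1 Φ) : Continuous (TL Φ) := by
  have h1 : Continuous (fderiv ℂ Φ) := h.continuous_fderiv (by norm_num)
  have h2 := h.continuous
  refine Continuous.prodMk ?_ ?_
  · unfold rl; fun_prop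
  · simp only [dr_apply]
    refine rpL.continuous.comp ?_
    exact (h1.comp (by fun_prop)).clm_apply (by fun_prop)

lemma Reg.continuous_tang {Φ} (h : Reg Φ) (h1 : ContDiff ℂ 1 Φ) : Continuous (tang Φ) := by
  rw [isOpenQuotientMap_Pj.isQuotientMap.continuous_iff]
  have : tang Φ ∘ Pj = Pj ∘ TL Φ := funext h.tang_Pj
  rw [this]
  exact isOpenQuotientMap_Pj.continuous.comp (continuous_TL h1)

/-- good maps -/
structure Good (Φ : ℂ × ℂ → ℂ × ℂ) : Prop where
  reg : Reg Φ
  cd : ContDiff ℂ 1 Φ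
  mp : MeasurePreserving (tang Φ) (volume : Measure EE) volume
  mpt : MeasurePreserving (tor Φ) (volume : Measure T2) volume

lemma Reg.tor_comp {Φ Ψ} (hΦ : Reg Φ) (hΨ : Reg Ψ) (w) : tor (Φ ∘ Ψ) w = tor Φ (tor Ψ w) :=
  congrArg Prod.fst (hΦ.tang_comp hΨ (w, 0))

lemma Good.comp {Φ Ψ} (hΦ : Good Φ) (hΨ : Good Ψ) : Good (Φ ∘ Ψ) where
  reg := hΦ.reg.comp hΨ.reg
  cd := hΦ.cd.comp hΨ.cd
  mp := by
    have : tang (Φ ∘ Ψ) = tang Φ ∘ tang Ψ := funext (hΦ.reg.tang_comp hΨ.reg)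
    rw [this]; exact hΦ.mp.comp hΨ.mp
  mpt := by
    have : tor (Φ ∘ Ψ) = tor Φ ∘ tor Ψ := funext (hΦ.reg.tor_comp hΨ.reg)
    rw [this]; exact hΦ.mpt.comp hΨ.mpt

lemma Good.id : Good id where
  reg := Reg.id
  cd := contDiff_id
  mp := by
    have : tang _root_.id = _root_.id := funext tang_id
    rw [this]; exact MeasurePreserving.id _
  mpt := by
    have : tor _root_.id = _root_.id := funext fun z => congrArg Prod.fst (tang_id (z, 0))
    rw [this]; exact MeasurePreserving.id _

/-- the group -/
def Gam : Subgroup (Equiv.Perm (ℂ × ℂ)) where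
  carrier := {e | Good e ∧ Good e.symm}
  mul_mem' := fun {a b} ha hb => ⟨by simpa using ha.1.comp hb.1, by
    have := hb.2.comp ha.2
    exact this⟩
  one_mem' := ⟨Good.id, Good.id⟩
  inv_mem' := fun {a} ha => ⟨ha.2, ha.1⟩

lemma tang_mul {a b : Equiv.Perm (ℂ × ℂ)} (ha : a ∈ Gam) (hb : b ∈ Gam) (w) :
    tang (a * b : Equiv.Perm (ℂ × ℂ)) w = tang a (tang b w) := ha.1.reg.tang_comp hb.1.reg w
lemma tang_one (w) : tang (1 : Equiv.Perm (ℂ × ℂ)) w = w := tang_id w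
lemma tang_inv_self {a : Equiv.Perm (ℂ × ℂ)} (ha : a ∈ Gam) (w) : tang (a⁻¹ : Equiv.Perm (ℂ × ℂ)) (tang a w) = w := by
  rw [← tang_mul (Gam.inv_mem ha) ha, inv_mul_cancel, tang_one]
lemma tang_self_inv {a : Equiv.Perm (ℂ × ℂ)} (ha : a ∈ Gam) (w) : tang a (tang (a⁻¹ : Equiv.Perm (ℂ × ℂ)) w) = w := by
  rw [← tang_mul ha (Gam.inv_mem ha), mul_inv_cancel, tang_one]
lemma tang_pow {a : Equiv.Perm (ℂ × ℂ)} (ha : a ∈ Gam) (n : ℕ) (w) : tang (a ^ n : Equiv.Perm (ℂ × ℂ)) w = (tang a)^[n] w := by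
  induction n generalizing w with
  | zero => exact tang_one w
  | succ n ih => rw [pow_succ, tang_mul (Gam.pow_mem ha n) ha, ih, Function.iterate_succ_apply]

lemma tang_cont {a : Equiv.Perm (ℂ × ℂ)} (ha : a ∈ Gam) : Continuous (tang a) := ha.1.reg.continuous_tang ha.1.cd

lemma tang_zero_iff {a : Equiv.Perm (ℂ × ℂ)} (ha : a ∈ Gam) (w : EE) : (tang a w).2 = 0 ↔ w.2 = 0 := by
  constructor
  · intro h
    have := tang_inv_self ha w
    rw [← this, tang_snd, h, map_zero]
  · intro h; rw [tang_snd, h, map_zero]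


structure EP (s : ℂ → ℂ) : Prop where
  diff : Differentiable ℂ s
  per : ∀ z, s (z + 1) = s z
  real : ∀ x : ℝ, (s x).im = 0

def sR (s : ℂ → ℂ) (x : T1) : ℝ := (s (r1 x)).re

lemma EP.per_int {s} (h : EP s) (z : ℂ) (m : ℤ) : s (z + m) = s z := by
  have : Function.Periodic s 1 := h.per
  simpa using this.int_mul m z

lemma EP.sR_coe {s} (h : EP s) (a : ℝ) : sR s (a : T1) = (s a).re := by
  obtain ⟨m, hm⟩ := exists_r1 a
  conv_rhs => rw [hm]
  rw [Complex.ofReal_add, Complex.ofReal_intCast, h.per_int]; rfl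

lemma EP.continuous_sR {s} (h : EP s) : Continuous (sR s) := by
  have hq : IsOpenQuotientMap (fun x : ℝ => (x : T1)) := QuotientAddGroup.isOpenQuotientMap_mk
  rw [hq.isQuotientMap.continuous_iff]
  have : sR s ∘ (fun x : ℝ => (x : T1)) = fun a : ℝ => (s a).re := funext h.sR_coe
  rw [this]
  have := h.diff.continuous
  fun_prop

lemma EP.of_re {s} (h : EP s) (x : ℝ) : ((s x).re : ℂ) = s x := by
  apply Complex.ext <;> simp [h.real x]

lemma EP.const (c : ℝ) : EP (fun _ => (c : ℂ)) := ⟨differentiable_const _, fun _ => rfl, fun x => by simp⟩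
lemma EP.add {s t} (hs : EP s) (ht : EP t) : EP (fun z => s z + t z) :=
  ⟨hs.diff.add ht.diff, fun z => by rw [hs.per, ht.per], fun x => by simp [hs.real, ht.real]⟩
lemma EP.mul {s t} (hs : EP s) (ht : EP t) : EP (fun z => s z * t z) :=
  ⟨hs.diff.mul ht.diff, fun z => by rw [hs.per, ht.per], fun x => by simp [hs.real, ht.real]⟩
lemma EP.neg {s} (hs : EP s) : EP (fun z => - s z) :=
  ⟨hs.diff.neg, fun z => by rw [hs.per], fun x => by simp [hs.real]⟩
lemma EP.sub {s t} (hs : EP s) (ht : EP t) : EP (fun z => s z - t z) :=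
  ⟨hs.diff.sub ht.diff, fun z => by rw [hs.per, ht.per], fun x => by simp [hs.real, ht.real]⟩
lemma EP.scale {s} (hs : EP s) (N : ℕ) : EP (fun z => s (N * z)) :=
  ⟨hs.diff.comp (by fun_prop), fun z => by
    have := hs.per_int (N * z) N
    rw [← this]; push_cast; ring_nf, fun x => by
    have := hs.real (N * x); push_cast at this; exact this⟩

lemma EP.hasDerivAt_re {s} (h : EP s) (x : ℝ) : HasDerivAt (fun x : ℝ => s x) (deriv s x) x := by
  have := (h.diff (x : ℂ)).hasDerivAt.comp_ofReal
  exact this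

lemma EP.deriv {s} (h : EP s) : EP (deriv s) where
  diff := by
    have : ContDiff ℂ 2 s := h.diff.contDiff
    exact ((contDiff_succ_iff_deriv (n := 1)).1 this).2.2.differentiable (by norm_num)
  per z := by
    have h1 : (fun z => s (z + 1)) = s := funext h.per
    have h2 := congrArg (fun g => _root_.deriv g z) h1
    simpa [deriv_comp_add_const] using h2
  real x := by
    have h1 := h.hasDerivAt_re x
    have h2 : HasDerivAt (fun x : ℝ => (s x).im) (_root_.deriv s x).im x :=
      Complex.imCLM.hasFDerivAt.comp_hasDerivAt x h1
    have h3 : (fun x : ℝ => (s x).im) = fun _ => (0:ℝ) := funext h.real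
    rw [h3] at h2
    exact (h2.unique (hasDerivAt_const x 0))

lemma sR_scale {s} (hs : EP s) (N : ℕ) (x : T1) : sR (fun z => s (N * z)) x = sR s (N • x) := by
  have : N • x = (((N * r1 x : ℝ)) : T1) := by
    conv_lhs => rw [← coe_r1 x]
    rw [← nsmul_eq_mul]; rfl
  rw [this, hs.sR_coe]; simp [sR]

lemma EP.cos : EP (fun z => Complex.cos (2 * Real.pi * z)) where
  diff := by fun_prop
  per z := by rw [mul_add, mul_one, Complex.cos_add_two_pi]
  real x := by
    have : (2 * Real.pi * x : ℂ) = ((2 * Real.pi * x : ℝ) : ℂ) := by push_cast; rfl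
    rw [this]; exact Complex.cos_ofReal_im _
lemma EP.sin : EP (fun z => Complex.sin (2 * Real.pi * z)) where
  diff := by fun_prop
  per z := by rw [mul_add, mul_one, Complex.sin_add_two_pi]
  real x := by
    have : (2 * Real.pi * x : ℂ) = ((2 * Real.pi * x : ℝ) : ℂ) := by push_cast; rfl
    rw [this]; exact Complex.sin_ofReal_im _

def EPalg : Subalgebra ℝ C(T1, ℝ) where
  carrier := {f | ∃ s, EP s ∧ ∀ x, f x = sR s x}
  mul_mem' := by
    rintro f g ⟨s, hs, h1⟩ ⟨t, ht, h2⟩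
    exact ⟨_, hs.mul ht, fun x => by simp [h1, h2, sR, hs.real, ht.real]⟩
  add_mem' := by
    rintro f g ⟨s, hs, h1⟩ ⟨t, ht, h2⟩
    exact ⟨_, hs.add ht, fun x => by simp [h1, h2, sR]⟩
  algebraMap_mem' := fun c => ⟨_, EP.const c, fun x => by simp [sR]⟩

lemma EPalg_sep : EPalg.SeparatesPoints := by
  intro x y hxy
  by_contra hcon
  push Not at hcon
  have key : ∀ s, EP s → sR s x = sR s y := fun s hs => by
    have := hcon (⟨sR s, hs.continuous_sR⟩ : C(T1, ℝ)) ⟨⟨sR s, hs.continuous_sR⟩, ⟨s, hs, fun _ => rfl⟩, rfl⟩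
    simpa using this
  have h1 := key _ EP.cos
  have h2 := key _ EP.sin
  apply hxy
  apply AddCircle.injective_toCircle (T := (1:ℝ)) one_ne_zero
  have e : ∀ x : T1, ((AddCircle.toCircle x : Circle) : ℂ) = (sR (fun z => Complex.cos (2 * Real.pi * z)) x : ℂ) + (sR (fun z => Complex.sin (2 * Real.pi * z)) x : ℂ) * Complex.I := by
    intro x
    conv_lhs => rw [← coe_r1 x]
    rw [AddCircle.toCircle_apply_mk]
    simp only [sR]
    have : (2 * Real.pi * (r1 x : ℝ) : ℂ) = ((2 * Real.pi * r1 x : ℝ) : ℂ) := by push_cast; rfl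
    rw [Circle.coe_exp, this]
    rw [Complex.exp_mul_I, Complex.cos_ofReal_re, Complex.sin_ofReal_re]
    simp
  ext
  rw [e, e, h1, h2]

lemma ep_dense (G : C(T1, ℝ)) {ε : ℝ} (hε : 0 < ε) : ∃ s, EP s ∧ ∀ x, |sR s x - G x| < ε := by
  have h := ContinuousMap.exists_mem_subalgebra_near_continuousMap_of_separatesPoints EPalg EPalg_sep G ε hε
  obtain ⟨⟨g, s, hs, hg⟩, h⟩ := h
  refine ⟨s, hs, fun x => ?_⟩
  rw [← hg]
  have := (ContinuousMap.norm_lt_iff _ hε).1 h x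
  simpa using this

lemma ep_dense_meas {G : T1 → ℝ} (hG : Measurable G) {ε : ℝ} (hε : 0 < ε) :
    ∃ s, EP s ∧ volume {x | ε < |sR s x - G x|} ≤ ENNReal.ofReal ε := by
  let Gn : ℕ → T1 → ℝ := fun n x => max (-n) (min n (G x))
  have hGn : ∀ n, Measurable (Gn n) := fun n => measurable_const.max (measurable_const.min hG)
  have hb : ∀ n x, |Gn n x| ≤ n := fun n x => by
    rw [abs_le]
    exact ⟨le_max_left _ _, max_le (by linarith [(Nat.cast_nonneg n : (0:ℝ) ≤ n)]) (min_le_left _ _)⟩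
  have ht : ∀ x, Tendsto (fun n => Gn n x) atTop (𝓝 (G x)) := fun x => by
    apply tendsto_const_nhds.congr'
    filter_upwards [eventually_ge_atTop ⌈|G x|⌉₊] with n hn
    have h1 : |G x| ≤ n := (Nat.le_ceil _).trans (by exact_mod_cast hn)
    rw [abs_le] at h1
    simp only [Gn]
    rw [min_eq_right h1.2, max_eq_right h1.1]
  have hm := tendstoInMeasure_of_tendsto_ae (μ := (volume : Measure T1)) (fun n => (hGn n).aestronglyMeasurable)
    (ae_of_all _ ht)
  have h1 := (hm (ENNReal.ofReal (ε/3)) (by positivity)).eventually_lt_const (u := ENNReal.ofReal (ε/2)) (by positivity)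
  obtain ⟨n, hn⟩ := h1.exists
  have hint : Integrable (Gn n) (volume : Measure T1) :=
    Integrable.of_bound (hGn n).aestronglyMeasurable n (ae_of_all _ fun x => by simpa using hb n x)
  obtain ⟨g, hg, hgi⟩ := hint.exists_boundedContinuous_integral_sub_le (ε := (ε/3) * (ε/2)) (by positivity)
  obtain ⟨s, hs, hsg⟩ := ep_dense (g : C(T1, ℝ)) (ε := ε/3) (by positivity)
  refine ⟨s, hs, ?_⟩
  have hmk := mul_meas_ge_le_integral_of_nonneg (μ := (volume : Measure T1)) (f := fun x => ‖Gn n x - g x‖)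
    (ae_of_all _ fun x => norm_nonneg _) (hint.sub hgi).norm (ε/3)
  have hmk2 : volume.real {x | ε/3 ≤ ‖Gn n x - g x‖} ≤ ε/2 := by
    have := hmk.trans hg
    exact le_of_mul_le_mul_left this (by positivity)
  have hmk3 : volume {x | ε/3 ≤ ‖Gn n x - g x‖} ≤ ENNReal.ofReal (ε/2) := by
    rw [← ENNReal.ofReal_toReal (measure_ne_top volume _)]
    exact ENNReal.ofReal_le_ofReal hmk2
  calc volume {x | ε < |sR s x - G x|} ≤ volume ({x | ENNReal.ofReal (ε/3) ≤ edist (Gn n x) (G x)} ∪ {x | ε/3 ≤ ‖Gn n x - g x‖}) := by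
        apply measure_mono
        intro x hx
        by_contra hc
        simp only [mem_union, mem_setOf_eq, not_or, not_le] at hc
        rw [edist_dist, Real.dist_eq, ENNReal.ofReal_lt_ofReal_iff (by positivity)] at hc
        have h3 := hsg x
        have h4 := hc.1
        have h5 := hc.2
        simp only [mem_setOf_eq, Real.norm_eq_abs] at hx h5
        have h6 : |sR s x - (g : C(T1, ℝ)) x| < ε/3 := h3
        have h7 : (g : C(T1, ℝ)) x = g x := rfl
        rw [h7] at h6
        rw [abs_lt] at h4 h5 h6
        rw [lt_abs] at hx
        rcases hx with hx | hx <;> linarith [h4.1, h4.2, h5.1, h5.2, h6.1, h6.2]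
    _ ≤ _ := measure_union_le _ _
    _ ≤ ENNReal.ofReal (ε/2) + ENNReal.ofReal (ε/2) := add_le_add hn.le hmk3
    _ = ENNReal.ofReal ε := by rw [← ENNReal.ofReal_add (by positivity) (by positivity)]; congr 1; ring


lemma EP.prim {p} (hp : EP p) (h : ∫ x : T1, sR p x = 0) : ∃ w, EP w ∧ _root_.deriv w = p := by
  obtain ⟨F, hF0, hF⟩ := (hp.diff.isExactOn_univ).with_val_at 0 0
  have hF : ∀ z, HasDerivAt F (p z) z := fun z => hF z (mem_univ z)
  have hFr : ∀ x : ℝ, HasDerivAt (fun x : ℝ => F x) (p x) x := fun x => (hF x).comp_ofReal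
  have him : ∀ x : ℝ, (F x).im = 0 := by
    intro x
    have h1 : ∀ x, HasDerivAt (fun x : ℝ => (F x).im) 0 x := fun x => by
      have := Complex.imCLM.hasFDerivAt.comp_hasDerivAt x (hFr x)
      have e : Complex.imCLM (p x) = 0 := hp.real x
      rw [e] at this
      exact this
    have := is_const_of_deriv_eq_zero (f := fun x : ℝ => (F x).im) (fun x => (h1 x).differentiableAt) (fun x => (h1 x).deriv) x 0
    simpa [hF0] using this
  have hre : (F 1).re = 0 := by
    have h1 : ∀ x : ℝ, HasDerivAt (fun x : ℝ => (F x).re) (sR p (x : T1)) x := fun x => by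
      have := Complex.reCLM.hasFDerivAt.comp_hasDerivAt x (hFr x)
      rw [hp.sR_coe]
      exact this
    have h2 := intervalIntegral.integral_eq_sub_of_hasDerivAt (a := 0) (b := 0 + 1) (f := fun x : ℝ => (F x).re) (f' := fun x : ℝ => sR p (x : T1))
      (fun x _ => h1 x) (by
        apply Continuous.intervalIntegrable
        exact hp.continuous_sR.comp (AddCircle.continuous_mk' 1))
    have h3 := AddCircle.intervalIntegral_preimage (1:ℝ) 0 (sR p)
    rw [h3, h] at h2
    simpa [hF0] using h2.symm
  have h1 : F 1 = 0 := by
    apply Complex.ext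
    · exact hre
    · simpa using him 1
  refine ⟨F, ⟨fun z => (hF z).differentiableAt, fun z => ?_, him⟩, funext fun z => (hF z).deriv⟩
  have h2 : ∀ z, HasDerivAt (fun z => F (z + 1) - F z) 0 z := fun z => by
    have := ((hF (z+1)).comp_add_const z 1).sub (hF z)
    rw [hp.per, sub_self] at this
    exact this
  have := is_const_of_deriv_eq_zero (f := fun z => F (z + 1) - F z) (fun x => (h2 x).differentiableAt) (fun x => (h2 x).deriv) z 0
  simp only [zero_add, h1, hF0, sub_self] at this
  exact sub_eq_zero.1 this

instance instProbT1 : IsProbabilityMeasure (volume : Measure T1) := ⟨by rw [AddCircle.measure_univ]; simp⟩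

lemma EP.integrable {s} (h : EP s) : Integrable (sR s) (volume : Measure T1) :=
  h.continuous_sR.integrable_of_hasCompactSupport (HasCompactSupport.of_compactSpace _)

lemma wlemma {ε : ℝ} (hε : 0 < ε) : ∃ w, EP w ∧ volume {x : T1 | ε < |sR (deriv w) x - 1|} ≤ ENNReal.ofReal ε := by
  let k0 : T1 → ℝ := fun x => max 0 (ε / 2 - ‖x‖)
  have hk0 : Continuous k0 := by fun_prop
  have hpos : 0 < ∫ x, k0 x := hk0.integral_pos_of_hasCompactSupport_nonneg_nonzero (x := 0)
    (HasCompactSupport.of_compactSpace _) (fun x => le_max_left _ _) (by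
      simp only [k0, norm_zero, sub_zero]
      rw [max_eq_right (by positivity)]; positivity)
  set I := ∫ x, k0 x
  have hi0 : Integrable k0 (volume : Measure T1) := hk0.integrable_of_hasCompactSupport (HasCompactSupport.of_compactSpace _)
  let k : C(T1, ℝ) := ⟨fun x => 1 - k0 x / I, by fun_prop⟩
  have hik : Integrable k (volume : Measure T1) := k.continuous.integrable_of_hasCompactSupport (HasCompactSupport.of_compactSpace _)
  have hk : ∫ x, k x = 0 := by
    change ∫ x, (1 - k0 x / I) = 0
    rw [integral_sub (integrable_const _) (hi0.div_const _), integral_div]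
    simp [I, div_self hpos.ne']
  obtain ⟨p, hp, hpk⟩ := ep_dense k (ε := ε/2) (by positivity)
  set c := ∫ x, sR p x
  have hc : |c| ≤ ε / 2 := by
    have : c = ∫ x, (sR p x - k x) := by rw [integral_sub hp.integrable hik, hk, sub_zero]
    rw [this]
    have := norm_integral_le_of_norm_le_const (μ := (volume : Measure T1)) (f := fun x => sR p x - k x) (C := ε/2) (ae_of_all _ fun x => (hpk x).le)
    simpa using this
  have hp2 := hp.sub (EP.const c)
  have e : ∀ x, sR (fun z => p z - (c:ℂ)) x = sR p x - c := fun x => by simp [sR]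
  obtain ⟨w, hw, hwd⟩ := hp2.prim (by
    simp only [e]
    rw [integral_sub hp.integrable (integrable_const _)]
    simp [c])
  refine ⟨w, hw, ?_⟩
  rw [hwd]
  calc _ ≤ volume (Metric.closedBall (0:T1) (ε/2)) := by
        apply measure_mono
        intro x hx
        rw [mem_setOf_eq, e] at hx
        rw [mem_closedBall_zero_iff]
        by_contra hc'
        push Not at hc'
        have h1 : k x = 1 := by
          change 1 - max 0 (ε / 2 - ‖x‖) / I = 1
          rw [max_eq_left (by linarith)]; simp
        have h2 := hpk x
        rw [h1] at h2
        rw [abs_lt] at h2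
        rw [abs_le] at hc
        rw [lt_abs] at hx
        rcases hx with hx | hx <;> linarith [h2.1, h2.2, hc.1, hc.2]
    _ ≤ _ := by
        rw [AddCircle.volume_closedBall]
        exact ENNReal.ofReal_le_ofReal ((min_le_right _ _).trans (by linarith))

lemma EP.bound {s} (h : EP s) : ∃ C : ℝ, 0 ≤ C ∧ ∀ x, |sR s x| ≤ C := by
  let f : C(T1, ℝ) := ⟨sR s, h.continuous_sR⟩
  exact ⟨‖f‖, norm_nonneg _, fun x => f.norm_coe_le_norm x⟩

lemma closure_lemma {G G1 : T1 → ℝ} (hG : Measurable G) (hG1 : Measurable G1) {ε : ℝ} (hε : 0 < ε) :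
    ∃ s, EP s ∧ volume {x | ε < |sR s x - G x| ∨ ε < |sR (deriv s) x - G1 x|} ≤ ENNReal.ofReal ε := by
  obtain ⟨g, hg, hgG⟩ := ep_dense_meas hG (ε := ε/4) (by positivity)
  obtain ⟨u, hu, huG⟩ := ep_dense_meas hG1 (ε := ε/4) (by positivity)
  have hv := hu.sub hg.deriv
  obtain ⟨C, hC, hCv⟩ := hv.bound
  obtain ⟨C', hC', hCv'⟩ := hv.deriv.bound
  set v := fun z => u z - deriv g z with hvdef
  set ε' := min (ε/4) (ε/(4*(C+1))) with hε'
  have hε'p : 0 < ε' := by positivity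
  obtain ⟨w, hw, hwm⟩ := wlemma hε'p
  obtain ⟨D, hD, hDw⟩ := hw.bound
  obtain ⟨n, hn⟩ := exists_nat_gt (((C + C') * D) / (ε/4))
  set N := n + 2
  have hN : (0:ℝ) < N := by positivity
  have hN1 : (C + C') * D / N ≤ ε/4 := by
    rw [div_lt_iff₀ (by positivity)] at hn
    rw [div_le_iff₀ hN]
    have : (n:ℝ) ≤ N := by simp [N]
    nlinarith
  have hws := hw.scale N
  have hs : EP (fun z => g z + (v z * w (N * z)) * ((1/N : ℝ) : ℂ)) := hg.add ((hv.mul hws).mul (EP.const (1/N)))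
  have hmul : ∀ {s t}, EP s → EP t → ∀ x, sR (fun z => s z * t z) x = sR s x * sR t x := fun hs ht x => by
    simp [sR, hs.real, ht.real]
  have hadd : ∀ {s t} x, sR (fun z => s z + t z) x = sR s x + sR t x := fun x => by simp [sR]
  have hcn : ∀ (c : ℝ) x, sR (fun z => (c:ℂ)) x = c := fun c x => by simp [sR]
  have ev : ∀ x, sR (fun z => g z + (v z * w (N * z)) * ((1/N : ℝ) : ℂ)) x = sR g x + sR v x * sR w (N • x) * (1/N) := fun x => by
    rw [hadd, hmul (hv.mul hws) (EP.const _), hmul hv hws, hcn, sR_scale hw]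
  have hdw : ∀ z : ℂ, HasDerivAt (fun z => w (N * z)) (deriv w (N * z) * N) z := fun z => by
    have := (hw.diff (N * z)).hasDerivAt.comp z ((hasDerivAt_id z).const_mul (N:ℂ))
    rw [mul_one] at this
    exact this
  have hds : deriv (fun z => g z + (v z * w (N * z)) * ((1/N : ℝ) : ℂ)) = fun z => (deriv g z + (deriv v z * w (N * z)) * ((1/N : ℝ) : ℂ)) + v z * deriv w (N * z) := by
    funext z
    have h1 := ((hg.diff z).hasDerivAt.add (((hv.diff z).hasDerivAt.mul (hdw z)).mul_const ((1/N : ℝ) : ℂ))).deriv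
    have h2 : deriv (fun z => g z + (v z * w (N * z)) * ((1/N : ℝ) : ℂ)) z = _ := h1
    rw [h2]
    have : (N:ℂ) ≠ 0 := by exact_mod_cast hN.ne'
    push_cast
    field_simp
    ring
  have ev' : ∀ x, sR (deriv (fun z => g z + (v z * w (N * z)) * ((1/N : ℝ) : ℂ))) x = sR (deriv g) x + sR (deriv v) x * sR w (N • x) * (1/N) + sR v x * sR (deriv w) (N • x) := fun x => by
    rw [hds, hadd, hadd, hmul (hv.deriv.mul hws) (EP.const _), hmul hv.deriv hws, hcn, sR_scale hw, hmul hv (hw.deriv.scale N), sR_scale hw.deriv]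
  refine ⟨_, hs, ?_⟩
  have hmp : MeasurePreserving (fun x : T1 => N • x) := (AddCircle.ergodic_nsmul (T := (1:ℝ)) (by omega : 1 < N)).toMeasurePreserving
  have hwms : MeasurableSet {x : T1 | ε' < |sR (deriv w) x - 1|} := by
    have := hw.deriv.continuous_sR.measurable
    exact measurableSet_lt measurable_const (by fun_prop)
  have hpre := hmp.measure_preimage hwms.nullMeasurableSet
  calc _ ≤ volume (({x | ε/4 < |sR g x - G x|} ∪ {x | ε/4 < |sR u x - G1 x|}) ∪ (fun x : T1 => N • x) ⁻¹' {x : T1 | ε' < |sR (deriv w) x - 1|}) := by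
        apply measure_mono
        intro x hx
        by_contra hcon
        simp only [mem_union, mem_setOf_eq, mem_preimage, not_or, not_lt] at hcon
        obtain ⟨⟨h1, h2⟩, h3⟩ := hcon
        rw [mem_setOf_eq, ev, ev'] at hx
        have hvx : sR v x = sR u x - sR (deriv g) x := by simp [sR, v]
        have a1 : |sR v x * sR w (N • x) * (1/N)| ≤ ε/4 := by
          rw [abs_mul, abs_mul, abs_of_pos (by positivity : (0:ℝ) < 1/N)]
          calc _ ≤ C * D * (1/N) := by gcongr; exacts [hCv x, hDw _]
            _ ≤ (C + C') * D / N := by rw [mul_one_div]; gcongr; linarith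
            _ ≤ _ := hN1
        have a2 : |sR (deriv v) x * sR w (N • x) * (1/N)| ≤ ε/4 := by
          rw [abs_mul, abs_mul, abs_of_pos (by positivity : (0:ℝ) < 1/N)]
          calc _ ≤ C' * D * (1/N) := by gcongr; exacts [hCv' x, hDw _]
            _ ≤ (C + C') * D / N := by rw [mul_one_div]; gcongr; linarith
            _ ≤ _ := hN1
        have a3 : |sR v x * (sR (deriv w) (N • x) - 1)| ≤ ε/4 := by
          rw [abs_mul]
          calc _ ≤ C * (ε/(4*(C+1))) := by gcongr; exacts [hCv x, h3.trans (min_le_right _ _)]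
            _ ≤ ε/4 := by
              rw [mul_div_assoc', div_le_div_iff₀ (by positivity) (by norm_num)]
              nlinarith
        rw [abs_le] at h1 h2 a1 a2 a3
        rcases hx with hx | hx
        · rw [lt_abs] at hx
          rcases hx with hx | hx <;> linarith [h1.1, h1.2, a1.1, a1.2]
        · rw [lt_abs] at hx
          rw [mul_sub, mul_one] at a3
          rcases hx with hx | hx <;> linarith [h2.1, h2.2, a2.1, a2.2, a3.1, a3.2]
    _ ≤ volume {x | ε/4 < |sR g x - G x|} + volume {x | ε/4 < |sR u x - G1 x|} + volume ((fun x : T1 => N • x) ⁻¹' {x : T1 | ε' < |sR (deriv w) x - 1|}) :=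
        (measure_union_le _ _).trans (add_le_add_left (measure_union_le _ _) _)
    _ ≤ ENNReal.ofReal (ε/4) + ENNReal.ofReal (ε/4) + ENNReal.ofReal (ε/4) := by
        rw [hpre]
        gcongr
        exact hwm.trans (ENNReal.ofReal_le_ofReal (min_le_left _ _))
    _ ≤ ENNReal.ofReal ε := by
        rw [← ENNReal.ofReal_add (by positivity) (by positivity), ← ENNReal.ofReal_add (by positivity) (by positivity)]
        exact ENNReal.ofReal_le_ofReal (by linarith)


def SS (s : ℂ → ℂ) : Equiv.Perm (ℂ × ℂ) where
  toFun z := (z.1, z.2 + s z.1)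
  invFun z := (z.1, z.2 - s z.1)
  left_inv z := by simp
  right_inv z := by simp
def VV (s : ℂ → ℂ) : Equiv.Perm (ℂ × ℂ) where
  toFun z := (z.1 + s z.2, z.2)
  invFun z := (z.1 - s z.2, z.2)
  left_inv z := by simp
  right_inv z := by simp

lemma SS_apply (s z) : SS s z = (z.1, z.2 + s z.1) := rfl
lemma VV_apply (s z) : VV s z = (z.1 + s z.2, z.2) := rfl
lemma SS_symm (s) : (SS s).symm = SS (fun z => - s z) := by
  ext z <;> simp [SS, sub_eq_add_neg]
lemma VV_symm (s) : (VV s).symm = VV (fun z => - s z) := by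
  ext z <;> simp [VV, sub_eq_add_neg]

def fS (G G1 : T1 → ℝ) (w : EE) : EE := ((w.1.1, w.1.2 + (G w.1.1 : T1)), (w.2.1, w.2.2 + G1 w.1.1 * w.2.1))
def fV (G G1 : T1 → ℝ) (w : EE) : EE := ((w.1.1 + (G w.1.2 : T1), w.1.2), (w.2.1 + G1 w.1.2 * w.2.2, w.2.2))

lemma fS_mpt {G : T1 → ℝ} (hG : Measurable G) : MeasurePreserving (fun z : T2 => ((z.1, z.2 + (G z.1 : T1)) : T2)) := by
  have hc : Measurable (fun x : ℝ => (x : T1)) := (AddCircle.continuous_mk' 1).measurable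
  refine (MeasurePreserving.id (volume : Measure T1)).skew_product (g := fun x y => y + (G x : T1)) ?_ ?_
  · simp only [Function.uncurry_def]
    exact measurable_snd.add (hc.comp (hG.comp measurable_fst))
  · exact ae_of_all _ fun x => (measurePreserving_add_right volume _).map_eq

lemma fib_mp (c : ℝ) : MeasurePreserving (fun v : ℝ × ℝ => (v.1, v.2 + c * v.1)) := by
  refine (MeasurePreserving.id (volume : Measure ℝ)).skew_product (g := fun x y => y + c * x) ?_ ?_
  · simp only [Function.uncurry_def]; fun_prop
  · exact ae_of_all _ fun x => (measurePreserving_add_right volume _).map_eq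

lemma fS_mp {G G1 : T1 → ℝ} (hG : Measurable G) (hG1 : Measurable G1) : MeasurePreserving (fS G G1) := by
  refine (fS_mpt hG).skew_product (g := fun (z : T2) (v : ℝ × ℝ) => (v.1, v.2 + G1 z.1 * v.1)) ?_ ?_
  · simp only [Function.uncurry_def]; fun_prop
  · exact ae_of_all _ fun x => (fib_mp _).map_eq

def sw (w : EE) : EE := (w.1.swap, w.2.swap)
lemma sw_mp : MeasurePreserving sw (volume : Measure EE) volume := by
  have h1 : MeasurePreserving (Prod.swap : T2 → T2) volume volume := Measure.measurePreserving_swap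
  have h2 : MeasurePreserving (Prod.swap : ℝ × ℝ → ℝ × ℝ) volume volume := Measure.measurePreserving_swap
  exact h1.prod h2

lemma fV_mp {G G1 : T1 → ℝ} (hG : Measurable G) (hG1 : Measurable G1) : MeasurePreserving (fV G G1) := by
  have : fV G G1 = sw ∘ fS G G1 ∘ sw := rfl
  rw [this]; exact sw_mp.comp ((fS_mp hG hG1).comp sw_mp)
lemma fV_mpt {G : T1 → ℝ} (hG : Measurable G) : MeasurePreserving (fun z : T2 => ((z.1 + (G z.2 : T1), z.2) : T2)) := by
  have h1 : MeasurePreserving (Prod.swap : T2 → T2) volume volume := Measure.measurePreserving_swap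
  exact h1.comp ((fS_mpt hG).comp h1)

lemma SS_hasFDerivAt {s} (hs : EP s) (z : ℂ × ℂ) : HasFDerivAt (SS s)
    ((ContinuousLinearMap.fst ℂ ℂ ℂ).prod (ContinuousLinearMap.snd ℂ ℂ ℂ + deriv s z.1 • ContinuousLinearMap.fst ℂ ℂ ℂ)) z := by
  have h := (hs.diff z.1).hasDerivAt.comp_hasFDerivAt z (hasFDerivAt_fst (𝕜 := ℂ) (p := z))
  exact hasFDerivAt_fst.prodMk (hasFDerivAt_snd.add h)
lemma VV_hasFDerivAt {s} (hs : EP s) (z : ℂ × ℂ) : HasFDerivAt (VV s)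
    ((ContinuousLinearMap.fst ℂ ℂ ℂ + deriv s z.2 • ContinuousLinearMap.snd ℂ ℂ ℂ).prod (ContinuousLinearMap.snd ℂ ℂ ℂ)) z := by
  have h := (hs.diff z.2).hasDerivAt.comp_hasFDerivAt z (hasFDerivAt_snd (𝕜 := ℂ) (p := z))
  exact (hasFDerivAt_fst.add h).prodMk hasFDerivAt_snd

lemma SS_reg {s} (hs : EP s) : Reg (SS s) where
  diff z := (SS_hasFDerivAt hs z).differentiableAt
  real x := by
    have := hs.of_re x.1
    simp [rl, SS_apply, cxL_apply, rpL_apply, this]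
  per z m := by simp [SS_apply, icx, hs.per_int]; ring
lemma VV_reg {s} (hs : EP s) : Reg (VV s) where
  diff z := (VV_hasFDerivAt hs z).differentiableAt
  real x := by
    have := hs.of_re x.2
    simp [rl, VV_apply, cxL_apply, rpL_apply, this]
  per z m := by simp [VV_apply, icx, hs.per_int]; ring

lemma tang_SS {s} (hs : EP s) : tang (SS s) = fS (sR s) (sR (deriv s)) := by
  funext w
  simp only [tang, Pj, TL, fS, dr_apply, (SS_hasFDerivAt hs _).fderiv, rl]
  have := hs.deriv.real (r1 w.1.1)
  ext <;> simp [SS_apply, cxL_apply, rpL_apply, pro, rep, sR, coe_r1, this]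
lemma tang_VV {s} (hs : EP s) : tang (VV s) = fV (sR s) (sR (deriv s)) := by
  funext w
  simp only [tang, Pj, TL, fV, dr_apply, (VV_hasFDerivAt hs _).fderiv, rl]
  have := hs.deriv.real (r1 w.1.2)
  ext <;> simp [VV_apply, cxL_apply, rpL_apply, pro, rep, sR, coe_r1, this]

lemma SS_good {s} (hs : EP s) : Good (SS s) where
  reg := SS_reg hs
  cd := by
    have : ContDiff ℂ 1 s := hs.diff.contDiff
    have : ContDiff ℂ 1 (fun z : ℂ × ℂ => (z.1, z.2 + s z.1)) := by fun_prop
    exact this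
  mp := by rw [tang_SS hs]; exact fS_mp hs.continuous_sR.measurable hs.deriv.continuous_sR.measurable
  mpt := by
    have : tor (SS s) = (fun z : T2 => ((z.1, z.2 + (sR s z.1 : T1)) : T2)) := by
      funext z; exact congrArg Prod.fst (congrFun (tang_SS hs) (z, 0))
    rw [this]; exact fS_mpt hs.continuous_sR.measurable
lemma VV_good {s} (hs : EP s) : Good (VV s) where
  reg := VV_reg hs
  cd := by
    have : ContDiff ℂ 1 s := hs.diff.contDiff
    have : ContDiff ℂ 1 (fun z : ℂ × ℂ => (z.1 + s z.2, z.2)) := by fun_prop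
    exact this
  mp := by rw [tang_VV hs]; exact fV_mp hs.continuous_sR.measurable hs.deriv.continuous_sR.measurable
  mpt := by
    have : tor (VV s) = (fun z : T2 => ((z.1 + (sR s z.2 : T1), z.2) : T2)) := by
      funext z; exact congrArg Prod.fst (congrFun (tang_VV hs) (z, 0))
    rw [this]; exact fV_mpt hs.continuous_sR.measurable

lemma SS_mem {s} (hs : EP s) : SS s ∈ Gam := ⟨SS_good hs, by rw [SS_symm]; exact SS_good hs.neg⟩
lemma VV_mem {s} (hs : EP s) : VV s ∈ Gam := ⟨VV_good hs, by rw [VV_symm]; exact VV_good hs.neg⟩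

def RR (t : ℝ) : Equiv.Perm (ℂ × ℂ) := VV (fun _ => (t : ℂ))
lemma RR_mem (t) : RR t ∈ Gam := VV_mem (EP.const t)
lemma RR_apply (t : ℝ) (z) : RR t z = (z.1 + t, z.2) := rfl
def rot (t : ℝ) (w : EE) : EE := ((w.1.1 + (t : T1), w.1.2), w.2)
lemma tang_RR (t) (w) : tang (RR t) w = rot t w := by
  rw [RR, tang_VV (EP.const t)]
  simp [fV, rot, sR]
lemma RR_add (s t : ℝ) : RR (s + t) = RR s * RR t := by
  ext z <;> simp [RR_apply]; ring
lemma RR_zero : RR 0 = 1 := by ext z <;> simp [RR_apply]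
lemma RR_neg (t : ℝ) : RR (-t) = (RR t)⁻¹ := by
  rw [eq_inv_iff_mul_eq_one, ← RR_add, neg_add_cancel, RR_zero]
lemma RR_nat (n : ℕ) (t : ℝ) : RR (n * t) = (RR t) ^ n := by
  induction n with
  | zero => simp [RR_zero]
  | succ n ih => rw [pow_succ, ← ih, ← RR_add]; congr 1; push_cast; ring
lemma VV_comm (s) (t : ℝ) : Commute (VV s) (RR t) := by
  ext z <;> simp [RR_apply, VV_apply]; ring
lemma SS_comm {s} (hs : EP s) {q : ℕ} (hq : 2 ≤ q) : Commute (SS (fun z => s (q * z))) (RR (1 / q)) := by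
  have h0 : (q : ℂ) ≠ 0 := by norm_cast; omega
  have : ∀ z, s (q * (z + (q:ℂ)⁻¹)) = s (q * z) := fun z => by
    rw [mul_add, mul_inv_cancel₀ h0, hs.per]
  ext z <;> simp [RR_apply, SS_apply, this]

def Appr (q : ℕ) (T : EE → EE) : Prop :=
  ∃ h : ℕ → Equiv.Perm (ℂ × ℂ), (∀ k, h k ∈ Gam ∧ Commute (h k) (RR (1 / q))) ∧
    ∀ᵐ w, Tendsto (fun k => tang (h k) w) atTop (𝓝 (T w))

lemma Appr_id (q) : Appr q id := ⟨fun _ => 1, fun k => ⟨Gam.one_mem, Commute.one_left _⟩,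
  ae_of_all _ fun w => by simp only [tang_one]; exact tendsto_const_nhds⟩

lemma shear_lim {h : ℕ → Equiv.Perm (ℂ × ℂ)} (hh : ∀ k, h k ∈ Gam) {T : EE → EE}
    (hT : ∀ᵐ w, Tendsto (fun k => tang (h k) w) atTop (𝓝 (T w)))
    {ρ : T2 → T1} (hρ : MeasurePreserving ρ) (hρc : Continuous ρ)
    {G G1 : T1 → ℝ}
    (hc : ∀ᵐ w, ContinuousAt G (ρ (T w).1) ∧ ContinuousAt G1 (ρ (T w).1))
    {a b : ℕ → T1 → ℝ} {C : ℝ} {B : ℕ → Set T1} (hBm : ∀ k, MeasurableSet (B k))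
    (hB : ∀ k, volume (B k) ≤ ENNReal.ofReal ((1/2)^k))
    (hab : ∀ k x, x ∉ B k → |a k x - G x| ≤ (1/2)^k ∧ |b k x - G1 x| ≤ C * (1/2)^k) :
    ∀ᵐ w, Tendsto (fun k => a k (ρ (tang (h k) w).1)) atTop (𝓝 (G (ρ (T w).1))) ∧
      Tendsto (fun k => b k (ρ (tang (h k) w).1)) atTop (𝓝 (G1 (ρ (T w).1))) := by
  have h1 : ∀ᵐ z : T2, ∀ᶠ k in atTop, z ∉ (fun z => ρ (tor (h k) z)) ⁻¹' B k := by
    apply ae_eventually_notMem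
    have hle : ∀ k, volume ((fun z => ρ (tor (h k) z)) ⁻¹' B k) ≤ ENNReal.ofReal ((1/2)^k) := fun k => by
      have : MeasurePreserving (fun z => ρ (tor (h k) z)) := hρ.comp (hh k).1.mpt
      rw [this.measure_preimage (hBm k).nullMeasurableSet]; exact hB k
    exact ne_top_of_le_ne_top (summable_geometric_two.tsum_ofReal_ne_top) (ENNReal.tsum_le_tsum hle)
  have h2 : ∀ᵐ w : EE, ∀ᶠ k in atTop, w.1 ∉ (fun z => ρ (tor (h k) z)) ⁻¹' B k :=
    Measure.quasiMeasurePreserving_fst.ae h1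
  filter_upwards [h2, hT, hc] with w hw hTw hcw
  have hx : Tendsto (fun k => ρ (tang (h k) w).1) atTop (𝓝 (ρ (T w).1)) :=
    (hρc.comp continuous_fst).continuousAt.tendsto.comp hTw
  have hp : Tendsto (fun k : ℕ => (1/2 : ℝ)^k) atTop (𝓝 0) := tendsto_pow_atTop_nhds_zero_of_lt_one (by norm_num) (by norm_num)
  have e1 : Tendsto (fun k => a k (ρ (tang (h k) w).1) - G (ρ (tang (h k) w).1)) atTop (𝓝 0) := by
    refine squeeze_zero_norm' ?_ hp
    filter_upwards [hw] with k hk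
    exact (hab k _ hk).1
  have e2 : Tendsto (fun k => b k (ρ (tang (h k) w).1) - G1 (ρ (tang (h k) w).1)) atTop (𝓝 0) := by
    refine squeeze_zero_norm' ?_ (by have := hp.const_mul C; rwa [mul_zero] at this)
    filter_upwards [hw] with k hk
    exact (hab k _ hk).2
  have f1 := e1.add (hcw.1.tendsto.comp hx)
  have f2 := e2.add (hcw.2.tendsto.comp hx)
  simp only [zero_add, Function.comp_apply, sub_add_cancel] at f1 f2
  exact ⟨f1, f2⟩

lemma fS_tendsto {a b : ℕ → T1 → ℝ} {G G1 : T1 → ℝ} {u : ℕ → EE} {w : EE} (hu : Tendsto u atTop (𝓝 w))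
    (ha : Tendsto (fun k => a k (u k).1.1) atTop (𝓝 (G w.1.1)))
    (hb : Tendsto (fun k => b k (u k).1.1) atTop (𝓝 (G1 w.1.1))) :
    Tendsto (fun k => fS (a k) (b k) (u k)) atTop (𝓝 (fS G G1 w)) := by
  have hc : Continuous (fun x : ℝ => (x : T1)) := AddCircle.continuous_mk' 1
  rw [Prod.tendsto_iff, Prod.tendsto_iff, Prod.tendsto_iff] at hu
  obtain ⟨⟨h1, h2⟩, h3, h4⟩ := hu
  exact (h1.prodMk_nhds (h2.add ((hc.tendsto _).comp ha))).prodMk_nhds (h3.prodMk_nhds (h4.add (hb.mul h3)))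

lemma fV_tendsto {a b : ℕ → T1 → ℝ} {G G1 : T1 → ℝ} {u : ℕ → EE} {w : EE} (hu : Tendsto u atTop (𝓝 w))
    (ha : Tendsto (fun k => a k (u k).1.2) atTop (𝓝 (G w.1.2)))
    (hb : Tendsto (fun k => b k (u k).1.2) atTop (𝓝 (G1 w.1.2))) :
    Tendsto (fun k => fV (a k) (b k) (u k)) atTop (𝓝 (fV G G1 w)) := by
  have hc : Continuous (fun x : ℝ => (x : T1)) := AddCircle.continuous_mk' 1
  rw [Prod.tendsto_iff, Prod.tendsto_iff, Prod.tendsto_iff] at hu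
  obtain ⟨⟨h1, h2⟩, h3, h4⟩ := hu
  exact ((h1.add ((hc.tendsto _).comp ha)).prodMk_nhds h2).prodMk_nhds ((h3.add (hb.mul h4)).prodMk_nhds h4)

lemma Appr.V {q : ℕ} {T} (hT : Appr q T) {G G1 : T1 → ℝ} (hG : Measurable G) (hG1 : Measurable G1)
    (hc : ∀ᵐ w, ContinuousAt G (T w).1.2 ∧ ContinuousAt G1 (T w).1.2) : Appr q (fV G G1 ∘ T) := by
  obtain ⟨h, hh, hlim⟩ := hT
  choose s hs hsB using fun k : ℕ => closure_lemma hG hG1 (ε := (1/2)^k) (by positivity)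
  refine ⟨fun k => VV (s k) * h k, fun k => ⟨Gam.mul_mem (VV_mem (hs k)) (hh k).1, (VV_comm _ _).mul_left (hh k).2⟩, ?_⟩
  have := shear_lim (fun k => (hh k).1) hlim (ρ := Prod.snd) measurePreserving_snd continuous_snd hc
    (a := fun k => sR (s k)) (b := fun k => sR (deriv (s k))) (C := 1)
    (B := fun k => {x | (1/2)^k < |sR (s k) x - G x| ∨ (1/2)^k < |sR (deriv (s k)) x - G1 x|})
    (fun k => by
      have h1 := (hs k).continuous_sR.measurable
      have h2 := (hs k).deriv.continuous_sR.measurable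
      have h3 : Measurable fun x => |sR (s k) x - G x| := by fun_prop
      have h4 : Measurable fun x => |sR (deriv (s k)) x - G1 x| := by fun_prop
      exact (measurableSet_lt measurable_const h3).union (measurableSet_lt measurable_const h4))
    hsB (fun k x hx => by
      simp only [mem_setOf_eq, not_or, not_lt] at hx
      rw [one_mul]; exact hx)
  filter_upwards [this, hlim] with w hw hl
  simp only [tang_mul (VV_mem (hs _)) (hh _).1, tang_VV (hs _)]
  exact fV_tendsto hl hw.1 hw.2

lemma Appr.S {q : ℕ} (hq : 2 ≤ q) {T} (hT : Appr q T) {G G1 : T1 → ℝ} (hG : Measurable G) (hG1 : Measurable G1)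
    (hc : ∀ᵐ w, ContinuousAt G (q • (T w).1.1) ∧ ContinuousAt G1 (q • (T w).1.1)) :
    Appr q (fS (fun x => G (q • x)) (fun x => G1 (q • x)) ∘ T) := by
  obtain ⟨h, hh, hlim⟩ := hT
  have hq0 : (0:ℝ) < q := by norm_cast; omega
  choose s hs hsB using fun k : ℕ => closure_lemma hG (hG1.div_const (q:ℝ)) (ε := (1/2)^k) (by positivity)
  have hss := fun k => (hs k).scale q
  refine ⟨fun k => SS (fun z => s k (q * z)) * h k, fun k => ⟨Gam.mul_mem (SS_mem (hss k)) (hh k).1, (SS_comm (hs k) hq).mul_left (hh k).2⟩, ?_⟩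
  have hmp : MeasurePreserving (fun x : T1 => q • x) := (AddCircle.ergodic_nsmul (T := (1:ℝ)) (by omega : 1 < q)).toMeasurePreserving
  have hder : ∀ k x, sR (deriv (fun z => s k (q * z))) x = q * sR (deriv (s k)) (q • x) := fun k x => by
    have : deriv (fun z => s k (q * z)) = fun z => ((q:ℝ):ℂ) * (deriv (s k) (q * z)) := by
      funext z
      have := ((hs k).diff (q * z)).hasDerivAt.comp z ((hasDerivAt_id z).const_mul (q:ℂ))
      rw [mul_one] at this
      have e : deriv (fun z => s k (q * z)) z = _ := this.deriv
      rw [e, mul_comm]; push_cast; rfl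
    rw [this, ← sR_scale (hs k).deriv]
    simp [sR]
  have hBm : ∀ k, MeasurableSet {x | (1/2)^k < |sR (s k) x - G x| ∨ (1/2)^k < |sR (deriv (s k)) x - G1 x / q|} := fun k => by
    have h1 := (hs k).continuous_sR.measurable
    have h2 := (hs k).deriv.continuous_sR.measurable
    have h3 : Measurable fun x => |sR (s k) x - G x| := by fun_prop
    have h4 : Measurable fun x => |sR (deriv (s k)) x - G1 x / q| := by fun_prop
    exact (measurableSet_lt measurable_const h3).union (measurableSet_lt measurable_const h4)
  have hqc : Continuous (fun x : T1 => q • x) := by fun_prop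
  have := shear_lim (fun k => (hh k).1) hlim (ρ := fun z => z.1) measurePreserving_fst continuous_fst
    (G := fun x => G (q • x)) (G1 := fun x => G1 (q • x))
    (hc.mono fun w hw => ⟨hw.1.comp (f := fun x : T1 => q • x) hqc.continuousAt, hw.2.comp (f := fun x : T1 => q • x) hqc.continuousAt⟩)
    (a := fun k => sR (fun z => s k (q * z))) (b := fun k => sR (deriv (fun z => s k (q * z)))) (C := q)
    (B := fun k => (fun x : T1 => q • x) ⁻¹' {x | (1/2)^k < |sR (s k) x - G x| ∨ (1/2)^k < |sR (deriv (s k)) x - G1 x / q|})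
    (fun k => hmp.measurable (hBm k))
    (fun k => by rw [hmp.measure_preimage (hBm k).nullMeasurableSet]; exact hsB k) (fun k x hx => by
      simp only [mem_preimage, mem_setOf_eq, not_or, not_lt] at hx
      refine ⟨by rw [sR_scale (hs k)]; exact hx.1, ?_⟩
      rw [hder]
      have : (q:ℝ) * sR (deriv (s k)) (q • x) - G1 (q • x) = q * (sR (deriv (s k)) (q • x) - G1 (q • x) / q) := by
        field_simp
      rw [this, abs_mul, abs_of_pos hq0]
      gcongr; exact hx.2)
  filter_upwards [this, hlim] with w hw hl
  simp only [tang_mul (SS_mem (hss _)) (hh _).1, tang_SS (hss _)]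
  exact fS_tendsto hl hw.1 hw.2


instance instNoAtomsT1 : NullSingletonClass (volume : Measure T1) := ⟨fun x => by
  have h : ∀ n : ℕ, volume ({x} : Set T1) ≤ ENNReal.ofReal (2 * (1 / ((n:ℝ) + 1))) := fun n => by
    refine (measure_mono (t := Metric.closedBall x (1 / ((n:ℝ) + 1))) ?_).trans ?_
    · intro y hy; rw [mem_singleton_iff] at hy; subst hy
      exact Metric.mem_closedBall_self (by positivity)
    · rw [AddCircle.volume_closedBall]; exact ENNReal.ofReal_le_ofReal (min_le_right _ _)
  have ht : Tendsto (fun n : ℕ => ENNReal.ofReal (2 * (1 / ((n:ℝ) + 1)))) atTop (𝓝 0) := by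
    have := ENNReal.tendsto_ofReal ((tendsto_one_div_add_atTop_nhds_zero_nat (𝕜 := ℝ)).const_mul 2)
    simpa using this
  exact le_antisymm (ge_of_tendsto' ht h) bot_le⟩

/-- profile -/
def gam (u : T1) : ℝ := if r1 u < 1/2 then 2 * r1 u else 0
lemma measurable_gam : Measurable gam :=
  Measurable.ite (measurableSet_lt measurable_r1 measurable_const) (measurable_r1.const_mul 2) measurable_const

lemma ae_gam : ∀ᵐ u : T1, ContinuousAt gam u := by
  have h : ({0, ((1/2 : ℝ) : T1)} : Set T1).Countable := by simp
  filter_upwards [h.ae_notMem volume] with u hu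
  simp only [mem_insert_iff, mem_singleton_iff, not_or] at hu
  have hc := continuousAt_r1 hu.1
  have hne : r1 u ≠ 1/2 := fun h => hu.2 (by rw [← h, coe_r1])
  rcases lt_or_gt_of_ne hne with h1 | h1
  · refine ContinuousAt.congr (f := fun u => 2 * r1 u) (by fun_prop) ?_
    filter_upwards [hc.eventually_lt continuousAt_const h1] with y hy
    simp only [gam]; rw [if_pos hy]
  · refine ContinuousAt.congr (f := fun u => 0) (by fun_prop) ?_
    filter_upwards [continuousAt_const.eventually_lt hc h1] with y hy
    simp only [gam]; rw [if_neg (not_lt.2 hy.le)]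

def th (N : ℕ) (y : T1) : ℝ := Real.pi * (N^2 : ℝ) * r1 y
def fa (N : ℕ) (y : T1) : ℝ := Real.cos (th N y) / Real.sin (th N y) - 1
def fb (N : ℕ) (y : T1) : ℝ := Real.sin (2 * th N y) - 2
def fc (N : ℕ) (y : T1) : ℝ := N * r1 y
lemma measurable_th (N) : Measurable (th N) := measurable_r1.const_mul _
lemma measurable_fa (N) : Measurable (fa N) := by
  have := measurable_th N; unfold fa; fun_prop
lemma measurable_fb (N) : Measurable (fb N) := by
  have := measurable_th N; unfold fb; fun_prop
lemma measurable_fc (N) : Measurable (fc N) := measurable_r1.const_mul _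

lemma ae_th {N : ℕ} (hN : 0 < N) : ∀ᵐ y : T1, y ≠ 0 ∧ Real.sin (th N y) ≠ 0 := by
  have h : (({0} : Set T1) ∪ range (fun k : ℤ => ((k / N^2 : ℝ) : T1))).Countable :=
    (countable_singleton _).union (countable_range _)
  filter_upwards [h.ae_notMem volume] with y hy
  simp only [mem_union, mem_singleton_iff, not_or] at hy
  refine ⟨hy.1, fun h0 => hy.2 ?_⟩
  rw [Real.sin_eq_zero_iff] at h0
  obtain ⟨k, hk⟩ := h0
  refine ⟨k, ?_⟩
  have : r1 y = k / N^2 := by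
    have hN' : (0:ℝ) < N := by exact_mod_cast hN
    rw [eq_div_iff (by positivity)]
    have h3 : Real.pi * (r1 y * N^2 - k) = 0 := by rw [th] at hk; linarith
    rcases mul_eq_zero.1 h3 with h | h
    · exact absurd h Real.pi_ne_zero
    · linarith
  simp only [← this, coe_r1]

lemma ae_abc {N : ℕ} (hN : 0 < N) : ∀ᵐ y : T1, (ContinuousAt (fa N) y ∧ ContinuousAt (fb N) y ∧ ContinuousAt (fc N) y) ∧ Real.sin (th N y) ≠ 0 := by
  filter_upwards [ae_th hN] with y hy
  have hc := continuousAt_r1 hy.1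
  have ht : ContinuousAt (th N) y := by unfold th; fun_prop
  refine ⟨⟨?_, ?_, ?_⟩, hy.2⟩
  · unfold fa
    have h1 : ContinuousAt (fun y => Real.cos (th N y)) y := by fun_prop
    have h2 : ContinuousAt (fun y => Real.sin (th N y)) y := by fun_prop
    exact (h1.div h2 hy.2).sub continuousAt_const
  · unfold fb; fun_prop
  · unfold fc; fun_prop

def rotv (φ : ℝ) (v : ℝ × ℝ) : ℝ × ℝ := (Real.cos φ * v.1 - Real.sin φ * v.2, Real.sin φ * v.1 + Real.cos φ * v.2)

/-- ideal map -/
def Tn (q N : ℕ) (w : EE) : EE :=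
  ((w.1.1 + N • (w.1.2 + (gam (q • w.1.1) : T1)), w.1.2 + (gam (q • w.1.1) : T1)),
    rotv (2 * th N (w.1.2 + (gam (q • w.1.1) : T1))) w.2)

lemma mat_id (θ v1 v2 : ℝ) (hs : Real.sin θ ≠ 0) :
   fV (fun _ => 0) (fun _ => Real.cos θ / Real.sin θ - 1) (fS (fun _ => 0) (fun _ => 1) (fV (fun _ => 0) (fun _ => Real.sin (2 * θ) - 2)
    (fS (fun _ => 0) (fun _ => 1) ((0,0), (v1 + (Real.cos θ / Real.sin θ - 1) * v2, v2))))) = ((0,0), rotv (2 * θ) (v1, v2)) := by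
  have h := Real.sin_sq_add_cos_sq θ
  simp only [fV, fS, rotv, Real.sin_two_mul, Real.cos_two_mul]
  ext
  · simp
  · simp
  · simp only
    field_simp
    have : Real.cos θ ^ 2 = 1 - Real.sin θ ^ 2 := by linarith
    ring_nf
    simp only [show Real.cos θ ^ 3 = Real.cos θ * Real.cos θ ^ 2 by ring, this]
    ring
  · simp only
    field_simp
    ring

lemma Appr_Tn {q N : ℕ} (hq : 2 ≤ q) (hN : 0 < N) : Appr q (Tn q N) := by
  have hmp : MeasurePreserving (fun x : T1 => q • x) := (AddCircle.ergodic_nsmul (T := (1:ℝ)) (by omega : 1 < q)).toMeasurePreserving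
  have hm11 : Measure.QuasiMeasurePreserving (fun w : EE => w.1.1) volume (volume : Measure T1) :=
    (Measure.quasiMeasurePreserving_fst (μ := (volume : Measure T1)) (ν := (volume : Measure T1))).comp (Measure.quasiMeasurePreserving_fst (μ := (volume : Measure T2)) (ν := (volume : Measure (ℝ × ℝ))))
  have hm12 : Measure.QuasiMeasurePreserving (fun w : EE => w.1.2) volume (volume : Measure T1) :=
    (Measure.quasiMeasurePreserving_snd (μ := (volume : Measure T1)) (ν := (volume : Measure T1))).comp (Measure.quasiMeasurePreserving_fst (μ := (volume : Measure T2)) (ν := (volume : Measure (ℝ × ℝ))))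
  have hgq : Measurable (fun x : T1 => gam (q • x)) := measurable_gam.comp hmp.measurable
  have hfS : MeasurePreserving (fS (fun x => gam (q • x)) (fun x => 0)) := fS_mp hgq measurable_const
  have hae : ∀ᵐ w : EE, (ContinuousAt (fa N) (w.1.2 + (gam (q • w.1.1) : T1)) ∧ ContinuousAt (fb N) (w.1.2 + (gam (q • w.1.1) : T1)) ∧ ContinuousAt (fc N) (w.1.2 + (gam (q • w.1.1) : T1))) ∧ Real.sin (th N (w.1.2 + (gam (q • w.1.1) : T1))) ≠ 0 :=
    hfS.quasiMeasurePreserving.ae (hm12.ae (ae_abc hN))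
  have hae0 : ∀ᵐ w : EE, ContinuousAt gam (q • w.1.1) := hm11.ae (hmp.quasiMeasurePreserving.ae ae_gam)
  have A1 := (Appr_id q).S hq measurable_gam (measurable_const (a := (0:ℝ))) (hae0.mono fun w hw => ⟨hw, continuousAt_const⟩)
  have A2 := A1.V (measurable_fc N) (measurable_fa N) (hae.mono fun w hw => ⟨hw.1.2.2, hw.1.1⟩)
  have A3 := A2.S hq (measurable_const (a := (0:ℝ))) (measurable_const (a := (1:ℝ))) (ae_of_all _ fun w => ⟨continuousAt_const, continuousAt_const⟩)
  have A4 := A3.V (measurable_const (a := (0:ℝ))) (measurable_fb N) (hae.mono fun w hw => ⟨continuousAt_const, by simpa [fS, fV] using hw.1.2.1⟩)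
  have A5 := A4.S hq (measurable_const (a := (0:ℝ))) (measurable_const (a := (1:ℝ))) (ae_of_all _ fun w => ⟨continuousAt_const, continuousAt_const⟩)
  have A6 := A5.V (measurable_const (a := (0:ℝ))) (measurable_fa N) (hae.mono fun w hw => ⟨continuousAt_const, by simpa [fS, fV] using hw.1.1⟩)
  obtain ⟨h, hh, hl⟩ := A6
  refine ⟨h, hh, ?_⟩
  filter_upwards [hl, hae] with w hw h2
  convert hw using 2
  have key := mat_id (th N (w.1.2 + (gam (q • w.1.1) : T1))) w.2.1 w.2.2 h2.2
  have hfc : ∀ y, ((fc N y : ℝ) : T1) = N • y := fun y => by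
    conv_rhs => rw [← coe_r1 y]
    rw [fc, ← nsmul_eq_mul]; rfl
  have k2 := congrArg Prod.snd key
  simp only [fV, fS] at k2
  simp only [Function.comp, fV, fS, Tn, id, hfc]
  simp only [AddCircle.coe_zero, add_zero, zero_mul]
  rw [← k2]
  rfl


def toC (v : ℝ × ℝ) : ℂ := ⟨v.1, v.2⟩
lemma toC_ne {v : ℝ × ℝ} (hv : v ≠ 0) : toC v ≠ 0 := fun h => hv (by
  have h1 := congrArg Complex.re h
  have h2 := congrArg Complex.im h
  exact Prod.ext h1 h2)
lemma continuous_toC : Continuous toC := Complex.equivRealProdCLM.symm.continuous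
def nrm (v : ℝ × ℝ) : T1 := (((toC v).arg / (2 * Real.pi) : ℝ) : T1)
lemma measurable_nrm : Measurable nrm :=
  (AddCircle.continuous_mk' 1).measurable.comp ((Complex.measurable_arg.comp continuous_toC.measurable).div_const _)
lemma toCircle_div (φ : ℝ) : AddCircle.toCircle (((φ / (2 * Real.pi) : ℝ)) : T1) = Circle.exp φ := by
  rw [AddCircle.toCircle_apply_mk]; congr 1; field_simp
lemma toCircle_nrm (v) : ((AddCircle.toCircle (nrm v) : Circle) : ℂ) = Complex.exp ((toC v).arg * Complex.I) := by
  rw [nrm, toCircle_div, Circle.coe_exp]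
lemma toCircle_nrm' {v} (hv : v ≠ 0) : ((AddCircle.toCircle (nrm v) : Circle) : ℂ) = toC v / ‖toC v‖ := by
  rw [toCircle_nrm, eq_div_iff (by simpa using toC_ne hv), mul_comm]
  exact Complex.norm_mul_exp_arg_mul_I _

lemma continuousAt_nrm {v} (hv : v ≠ 0) : ContinuousAt nrm v := by
  have h1 : ContinuousAt (fun v => AddCircle.toCircle (nrm v)) v := by
    refine (Topology.IsInducing.subtypeVal.continuousAt_iff (f := fun v => AddCircle.toCircle (nrm v))).2 ?_
    refine ContinuousAt.congr (f := fun v => toC v / ‖toC v‖) ?_ ?_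
    · have := continuous_toC
      exact ContinuousAt.div (by fun_prop) (by fun_prop) (by simpa using toC_ne hv)
    · filter_upwards [isOpen_ne.mem_nhds hv] with u hu
      exact (toCircle_nrm' hu).symm
  have h2 := (AddCircle.homeomorphCircle (T := (1:ℝ)) one_ne_zero).symm.continuous.continuousAt.comp h1
  have e : (AddCircle.homeomorphCircle (T := (1:ℝ)) one_ne_zero).symm ∘ (fun v => AddCircle.toCircle (nrm v)) = nrm := by
    funext u
    rw [Function.comp, Homeomorph.symm_apply_eq]
    rw [AddCircle.homeomorphCircle_apply]
  rwa [e] at h2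

lemma toC_rotv (φ v) : toC (rotv φ v) = Complex.exp (φ * Complex.I) * toC v := by
  rw [Complex.exp_mul_I, ← Complex.ofReal_cos, ← Complex.ofReal_sin]
  apply Complex.ext <;> simp only [toC, rotv, Complex.mul_re, Complex.mul_im, Complex.add_re, Complex.add_im, Complex.ofReal_re, Complex.ofReal_im, Complex.I_re, Complex.I_im] <;> ring
lemma rotv_ne (φ) {v} (hv : v ≠ 0) : rotv φ v ≠ 0 := fun h => by
  have := toC_rotv φ v
  rw [h] at this
  have h0 : toC 0 = 0 := rfl
  rw [h0] at this
  exact (mul_ne_zero (Complex.exp_ne_zero _) (toC_ne hv)) this.symm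
lemma nrm_rotv (φ : ℝ) {v} (hv : v ≠ 0) : nrm (rotv φ v) = ((φ / (2 * Real.pi) : ℝ) : T1) + nrm v := by
  apply AddCircle.injective_toCircle (T := (1:ℝ)) one_ne_zero
  rw [AddCircle.toCircle_add, toCircle_div]
  ext
  rw [toCircle_nrm' (rotv_ne φ hv), Circle.coe_mul, toCircle_nrm' hv, toC_rotv, norm_mul, Complex.norm_exp_ofReal_mul_I, Circle.coe_exp]
  simp only [one_mul]; ring
lemma nrm_smul {c : ℝ} (hc : 0 < c) (v) : nrm (c • v) = nrm v := by
  have : toC (c • v) = c * toC v := by apply Complex.ext <;> simp [toC]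
  rw [nrm, nrm, this, Complex.arg_real_mul _ hc]

lemma rotv_mp (φ : ℝ) : MeasurePreserving (rotv φ) := by
  have h1 := Complex.volume_preserving_equiv_real_prod
  have h2 := (rotation (Circle.exp φ)).measurePreserving
  have := h1.comp (h2.comp h1.symm)
  convert this using 1
  funext v
  have h3 : Complex.measurableEquivRealProd.symm v = toC v := rfl
  simp only [Function.comp, h3]
  rw [rotation_apply, Circle.coe_exp, ← toC_rotv]
  rfl

def Wd (v : ℝ × ℝ) : ℝ := (Real.sqrt Real.pi)⁻¹ * Real.exp (-1 * v.1 ^ 2) * ((Real.sqrt Real.pi)⁻¹ * Real.exp (-1 * v.2 ^ 2))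
lemma Wd_nonneg (v) : 0 ≤ Wd v := by unfold Wd; positivity
lemma continuous_Wd : Continuous Wd := by unfold Wd; fun_prop
lemma integrable_Wd : Integrable Wd := by
  have h := integrable_exp_neg_mul_sq (b := 1) one_pos
  have h2 := h.const_mul (Real.sqrt Real.pi)⁻¹
  exact h2.mul_prod h2
lemma integral_Wd : ∫ v, Wd v = 1 := by
  have h := integral_gaussian 1
  have e : ∫ x : ℝ, (Real.sqrt Real.pi)⁻¹ * Real.exp (-1 * x ^ 2) = 1 := by
    rw [integral_const_mul, h, div_one, inv_mul_cancel₀]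
    positivity
  have := integral_prod_mul (μ := (volume : Measure ℝ)) (ν := (volume : Measure ℝ)) (fun x : ℝ => (Real.sqrt Real.pi)⁻¹ * Real.exp (-1 * x ^ 2)) (fun x : ℝ => (Real.sqrt Real.pi)⁻¹ * Real.exp (-1 * x ^ 2))
  rw [e, mul_one] at this
  exact this
lemma Wd_rotv (φ v) : Wd (rotv φ v) = Wd v := by
  have h : ∀ v, Wd v = (Real.sqrt Real.pi)⁻¹ * (Real.sqrt Real.pi)⁻¹ * Real.exp (-1 * v.1 ^ 2 + -1 * v.2^2) := fun v => by
    rw [Wd, Real.exp_add]; ring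
  rw [h, h]; congr 2
  simp only [rotv]
  have := Real.sin_sq_add_cos_sq φ
  linear_combination (-v.1^2 - v.2^2) * this

def gw : Measure (ℝ × ℝ) := volume.withDensity (fun v => ENNReal.ofReal (Wd v))
instance instGw : IsProbabilityMeasure gw := ⟨by
  rw [gw, withDensity_apply _ MeasurableSet.univ, Measure.restrict_univ, ← ofReal_integral_eq_lintegral_ofReal integrable_Wd (ae_of_all _ Wd_nonneg), integral_Wd, ENNReal.ofReal_one]⟩
lemma gw_ac : gw ≪ volume := withDensity_absolutelyContinuous _ _
lemma gw_ne : ∀ᵐ v ∂gw, v ≠ 0 := gw_ac.ae_le (Measure.ae_ne volume 0)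
lemma rotv_gw (φ) : MeasurePreserving (rotv φ) gw gw := by
  refine ⟨(rotv_mp φ).measurable, ?_⟩
  ext s hs
  have hm : Measurable fun v => ENNReal.ofReal (Wd v) := (continuous_Wd.measurable).ennreal_ofReal
  rw [Measure.map_apply (rotv_mp φ).measurable hs, gw, withDensity_apply _ hs, withDensity_apply _ ((rotv_mp φ).measurable hs),
    ← (rotv_mp φ).setLIntegral_comp_preimage hs hm]
  simp only [Wd_rotv]

def P0 : Measure EE := (volume : Measure T2).prod gw
instance instP0 : IsProbabilityMeasure P0 := by unfold P0; infer_instance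
lemma P0_eq : P0 = volume.withDensity (fun w : EE => ENNReal.ofReal (Wd w.2)) := by
  rw [P0, gw, prod_withDensity_right (continuous_Wd.measurable).ennreal_ofReal]; rfl
lemma P0_ac : P0 ≪ (volume : Measure EE) := by rw [P0_eq]; exact withDensity_absolutelyContinuous _ _
lemma vol_ne : ∀ᵐ w : EE, w.2 ≠ 0 := Measure.quasiMeasurePreserving_snd.ae (Measure.ae_ne (volume : Measure (ℝ × ℝ)) 0)
lemma P0_ne : ∀ᵐ w ∂P0, w.2 ≠ 0 := P0_ac.ae_le vol_ne

abbrev QQ : Type := T2 × T1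
def NQ (w : EE) : QQ := (w.1, nrm w.2)
lemma measurable_NQ : Measurable NQ := measurable_fst.prodMk (measurable_nrm.comp measurable_snd)
lemma continuousAt_NQ {w : EE} (hw : w.2 ≠ 0) : ContinuousAt NQ w :=
  continuousAt_fst.prodMk ((continuousAt_nrm hw).comp continuousAt_snd)

def chi (a : ℤ × ℤ × ℤ) : C(QQ, ℂ) := ⟨fun p => fourier a.1 p.1.1 * fourier a.2.1 p.1.2 * fourier a.2.2 p.2, by fun_prop⟩
lemma chi_apply (a p) : chi a p = fourier a.1 p.1.1 * fourier a.2.1 p.1.2 * fourier a.2.2 p.2 := rfl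
lemma fourier_nm (n : ℤ) (x : T1) : ‖fourier n x‖ = 1 := Circle.norm_coe _
lemma chi_norm (a p) : ‖chi a p‖ = 1 := by simp only [chi_apply, norm_mul, fourier_nm, mul_one]

def chiAlg : StarSubalgebra ℂ C(QQ, ℂ) where
  toSubalgebra := Algebra.adjoin ℂ (range chi)
  star_mem' := by
    change Algebra.adjoin ℂ (range chi) ≤ star (Algebra.adjoin ℂ (range chi))
    refine Algebra.adjoin_le ?_
    rintro - ⟨n, rfl⟩
    exact Algebra.subset_adjoin ⟨-n, ContinuousMap.ext fun _ => by
      simp only [chi_apply, Prod.fst_neg, Prod.snd_neg, fourier_neg, ContinuousMap.star_apply, RCLike.star_def, map_mul]⟩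

lemma chiAlg_coe : Subalgebra.toSubmodule chiAlg.toSubalgebra = Submodule.span ℂ (range chi) := by
  apply Algebra.adjoin_eq_span_of_subset
  refine Subset.trans ?_ Submodule.subset_span
  intro x hx
  refine Submonoid.closure_induction (fun _ => id) ⟨0, ?_⟩ ?_ hx
  · ext1 z; simp [chi_apply]
  · rintro - - - - ⟨m, rfl⟩ ⟨n, rfl⟩
    refine ⟨m + n, ?_⟩
    ext1 z
    simp only [chi_apply, Prod.fst_add, Prod.snd_add, fourier_add, ContinuousMap.mul_apply]; ring

lemma chiAlg_sep : chiAlg.SeparatesPoints := by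
  intro x y hxy
  by_contra hcon
  push Not at hcon
  have key : ∀ a, chi a x = chi a y := fun a => hcon _ ⟨chi a, Algebra.subset_adjoin ⟨a, rfl⟩, rfl⟩
  have inj : ∀ u v : T1, fourier 1 u = fourier 1 v → u = v := fun u v h => by
    rw [fourier_one, fourier_one] at h
    exact AddCircle.injective_toCircle (T := (1:ℝ)) one_ne_zero (Circle.ext h)
  apply hxy
  have h1 := key (1,0,0)
  have h2 := key (0,1,0)
  have h3 := key (0,0,1)
  simp only [chi_apply, fourier_zero, one_mul, mul_one] at h1 h2 h3
  exact Prod.ext (Prod.ext (inj _ _ h1) (inj _ _ h2)) (inj _ _ h3)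

lemma chi_dense (φ : C(QQ, ℂ)) {ε : ℝ} (hε : 0 < ε) : ∃ ψ ∈ Submodule.span ℂ (range chi), ∀ p, ‖ψ p - φ p‖ ≤ ε := by
  have h := ContinuousMap.starSubalgebra_topologicalClosure_eq_top_of_separatesPoints chiAlg chiAlg_sep
  have h2 : φ ∈ closure (chiAlg : Set C(QQ, ℂ)) := by
    have : φ ∈ chiAlg.topologicalClosure := by rw [h]; trivial
    exact this
  obtain ⟨ψ, hψ, hd⟩ := Metric.mem_closure_iff.1 h2 ε hε
  refine ⟨ψ, ?_, fun p => ?_⟩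
  · rw [← chiAlg_coe]; exact hψ
  · have := (ContinuousMap.dist_lt_iff hε).1 hd p
    rw [dist_comm, dist_eq_norm] at this
    exact this.le


section bil
variable {Ω : Type*} [MeasurableSpace Ω] {P : Measure Ω} [IsProbabilityMeasure P] {m : Measure QQ} [IsProbabilityMeasure m]

lemma C_integrable (φ : C(QQ, ℂ)) {a : Ω → QQ} (ha : Measurable a) : Integrable (fun ω => φ (a ω)) P :=
  Integrable.of_bound (φ.continuous.measurable.comp ha).aestronglyMeasurable ‖φ‖ (ae_of_all _ fun ω => φ.norm_coe_le_norm _)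

lemma C_integrable_id (φ : C(QQ, ℂ)) : Integrable (fun p => φ p) m := C_integrable (P := m) φ measurable_id

lemma C_mul_integrable (φ : C(QQ, ℂ)) {a : Ω → QQ} (ha : Measurable a) {β : Ω → ℂ} (hβ : Measurable β) {C : ℝ}
    (hC : ∀ ω, ‖β ω‖ ≤ C) : Integrable (fun ω => φ (a ω) * β ω) P :=
  (C_integrable φ ha).mul_bdd hβ.aestronglyMeasurable (ae_of_all _ hC)

lemma bil1 {a : ℕ → Ω → QQ} (ha : ∀ n, Measurable (a n)) {β : ℕ → Ω → ℂ} (hβ : ∀ n, Measurable (β n)) {C : ℝ}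
    (hC : ∀ n ω, ‖β n ω‖ ≤ C) {l : ℂ}
    (H : ∀ c, Tendsto (fun n => ∫ ω, chi c (a n ω) * β n ω ∂P) atTop (𝓝 ((∫ p, chi c p ∂m) * l))) (φ : C(QQ, ℂ)) :
    Tendsto (fun n => ∫ ω, φ (a n ω) * β n ω ∂P) atTop (𝓝 ((∫ p, φ p ∂m) * l)) := by
  have h1 : ∀ ψ ∈ Submodule.span ℂ (range chi), Tendsto (fun n => ∫ ω, ψ (a n ω) * β n ω ∂P) atTop (𝓝 ((∫ p, ψ p ∂m) * l)) := by
    intro ψ hψ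
    induction hψ using Submodule.span_induction with
    | mem x h => obtain ⟨c, rfl⟩ := h; exact H c
    | zero => simp
    | add x y hx hy h1 h2 =>
      have := h1.add h2
      rw [← add_mul, ← integral_add (C_integrable_id (m := m) x) (C_integrable_id (m := m) y)] at this
      refine this.congr fun n => ?_
      rw [← integral_add (C_mul_integrable x (ha n) (hβ n) (hC n)) (C_mul_integrable y (ha n) (hβ n) (hC n))]
      simp [add_mul]
    | smul c x hx h1 =>
      have := h1.const_mul c
      rw [← mul_assoc, ← integral_const_mul] at this
      refine this.congr fun n => ?_
      rw [← integral_const_mul]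
      simp [mul_assoc]
  have hC0 : 0 ≤ C := by
    obtain ⟨ω⟩ : Nonempty Ω := nonempty_of_isProbabilityMeasure P
    exact (norm_nonneg _).trans (hC 0 ω)
  rw [Metric.tendsto_atTop]
  intro ε hε
  set δ := ε / (2 * (C + ‖l‖ + 1)) with hδ
  have hδp : 0 < δ := by positivity
  obtain ⟨ψ, hψ, hψφ⟩ := chi_dense φ hδp
  obtain ⟨n0, hn0⟩ := Metric.tendsto_atTop.1 (h1 ψ hψ) (ε/2) (by positivity)
  refine ⟨n0, fun n hn => ?_⟩
  have h2 := hn0 n hn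
  rw [dist_eq_norm] at h2 ⊢
  have e1 : ‖(∫ ω, ψ (a n ω) * β n ω ∂P) - ∫ ω, φ (a n ω) * β n ω ∂P‖ ≤ δ * C := by
    rw [← integral_sub (C_mul_integrable ψ (ha n) (hβ n) (hC n)) (C_mul_integrable φ (ha n) (hβ n) (hC n))]
    have := norm_integral_le_of_norm_le_const (μ := P) (f := fun ω => ψ (a n ω) * β n ω - φ (a n ω) * β n ω) (C := δ * C) (ae_of_all _ fun ω => by
      rw [← sub_mul, norm_mul]
      gcongr
      exacts [hψφ _, hC n ω])
    simpa using this
  have e2 : ‖(∫ p, ψ p ∂m) * l - (∫ p, φ p ∂m) * l‖ ≤ δ * ‖l‖ := by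
    rw [← sub_mul, norm_mul, ← integral_sub (C_integrable_id (m := m) ψ) (C_integrable_id (m := m) φ)]
    gcongr
    have := norm_integral_le_of_norm_le_const (μ := m) (f := fun p => ψ p - φ p) (C := δ) (ae_of_all _ hψφ)
    simpa using this
  have e3 : δ * C + δ * ‖l‖ < ε / 2 := by
    have : δ * (C + ‖l‖ + 1) = ε/2 := by rw [hδ]; field_simp
    nlinarith
  calc _ = ‖((∫ ω, ψ (a n ω) * β n ω ∂P) - (∫ p, ψ p ∂m) * l) - ((∫ ω, ψ (a n ω) * β n ω ∂P) - ∫ ω, φ (a n ω) * β n ω ∂P) + ((∫ p, ψ p ∂m) * l - (∫ p, φ p ∂m) * l)‖ := by congr 1; ring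
    _ ≤ _ := (norm_add_le _ _).trans (add_le_add_left (norm_sub_le _ _) _)
    _ < ε := by linarith

lemma bil2 {a b : ℕ → Ω → QQ} (ha : ∀ n, Measurable (a n)) (hb : ∀ n, Measurable (b n))
    (H : ∀ c d, Tendsto (fun n => ∫ ω, chi c (a n ω) * chi d (b n ω) ∂P) atTop (𝓝 ((∫ p, chi c p ∂m) * ∫ p, chi d p ∂m)))
    (φ ψ : C(QQ, ℂ)) :
    Tendsto (fun n => ∫ ω, φ (a n ω) * ψ (b n ω) ∂P) atTop (𝓝 ((∫ p, φ p ∂m) * ∫ p, ψ p ∂m)) := by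
  refine bil1 (β := fun n ω => ψ (b n ω)) ha (fun n => ψ.continuous.measurable.comp (hb n)) (C := ‖ψ‖) (fun n ω => ψ.norm_coe_le_norm _) (fun c => ?_) φ
  have := bil1 (P := P) (m := m) (a := b) (β := fun n ω => chi c (a n ω)) (C := 1) (l := ∫ p, chi c p ∂m) hb
    (fun n => (chi c).continuous.measurable.comp (ha n)) (fun n ω => (chi_norm _ _).le) (fun d => by
      simpa only [mul_comm] using H c d) ψ
  simpa only [mul_comm] using this
end bil

lemma fourier_arg_add (n : ℤ) (x y : T1) : fourier n (x + y) = fourier n x * fourier n y := by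
  simp only [fourier_apply, smul_add, AddCircle.toCircle_add, Circle.coe_mul]
lemma fourier_arg_nsmul (n : ℤ) (N : ℕ) (y : T1) : fourier n (N • y) = fourier (n * N) y := by
  simp only [fourier_apply, mul_smul, natCast_zsmul]

lemma int_fourier (n : ℤ) : ∫ x : T1, fourier n x = if n = 0 then 1 else 0 := by
  split_ifs with h
  · subst h; simp
  · have h1 := integral_add_right_eq_self (μ := (volume : Measure T1)) (fun x => fourier n x) (((1:ℝ) / 2 / n : ℝ) : T1)
    simp only [fourier_add_half_inv_index h one_pos] at h1
    rw [integral_neg] at h1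
    exact self_eq_neg.1 h1.symm

lemma fourier_nrm_rot (j : ℤ) (hj : j ≠ 0) {v} (hv : v ≠ 0) : fourier j (nrm (rotv (Real.pi / j) v)) = - fourier j (nrm v) := by
  rw [nrm_rotv _ hv, add_comm]
  have : (Real.pi / j) / (2 * Real.pi) = (1:ℝ) / 2 / j := by
    have : (j:ℝ) ≠ 0 := by exact_mod_cast hj
    field_simp
  rw [this, fourier_add_half_inv_index hj one_pos]

lemma int_gw (j : ℤ) : ∫ v, fourier j (nrm v) ∂gw = if j = 0 then 1 else 0 := by
  split_ifs with h
  · subst h; simp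
  · have hm : Measurable fun v => fourier j (nrm v) := (fourier j).continuous.measurable.comp measurable_nrm
    have h1 : ∫ v, fourier j (nrm (rotv (Real.pi / j) v)) ∂gw = ∫ v, fourier j (nrm v) ∂gw := by
      have := integral_map (μ := gw) (rotv_gw (Real.pi / j)).measurable.aemeasurable (f := fun v => fourier j (nrm v)) hm.aestronglyMeasurable
      rw [(rotv_gw _).map_eq] at this
      exact this.symm
    have h2 : ∫ v, fourier j (nrm (rotv (Real.pi / j) v)) ∂gw = ∫ v, - fourier j (nrm v) ∂gw :=
      integral_congr_ae (gw_ne.mono fun v hv => fourier_nrm_rot j h hv)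
    rw [h1, integral_neg] at h2
    exact self_eq_neg.1 h2

lemma int_prod3 (F : T1 → ℂ) (n j : ℤ) : ∫ w, F w.1.1 * fourier n w.1.2 * fourier j (nrm w.2) ∂P0 =
    (∫ x, F x) * (if n = 0 then 1 else 0) * (if j = 0 then 1 else 0) := by
  rw [P0, integral_prod_mul (fun z : T2 => F z.1 * fourier n z.2) (fun v => fourier j (nrm v)), int_gw]
  congr 1
  rw [← int_fourier]
  exact integral_prod_mul (μ := (volume : Measure T1)) (ν := (volume : Measure T1)) F (fun y => fourier n y)

lemma int_chi (c : ℤ × ℤ × ℤ) : ∫ w, chi c (NQ w) ∂P0 = if c = 0 then 1 else 0 := by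
  have := int_prod3 (fun x => fourier c.1 x) c.2.1 c.2.2
  rw [int_fourier] at this
  refine Eq.trans this ?_
  obtain ⟨k, l, j⟩ := c
  simp only [Prod.ext_iff, Prod.fst_zero, Prod.snd_zero]
  split_ifs <;> simp_all

lemma int_gam {n : ℤ} (hn : n ≠ 0) : ∫ u : T1, fourier n ((gam (u + ((1/2 : ℝ) : T1)) : ℝ) : T1) * fourier (-n) ((gam u : ℝ) : T1) = 0 := by
  set F : T1 → ℂ := fun u => fourier n ((gam (u + ((1/2 : ℝ) : T1)) : ℝ) : T1) * fourier (-n) ((gam u : ℝ) : T1) with hF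
  have hco : Measurable (fun x : ℝ => (x : T1)) := (AddCircle.continuous_mk' 1).measurable
  have hFm : Measurable F := by
    have h1 := measurable_gam
    have h2 : ∀ n : ℤ, Measurable (fun x : T1 => fourier n x) := fun n => (fourier n).continuous.measurable
    exact ((h2 n).comp (hco.comp (h1.comp (by fun_prop)))).mul ((h2 (-n)).comp (hco.comp h1))
  have hFb : ∀ u, ‖F u‖ ≤ 1 := fun u => by simp only [hF, norm_mul, fourier_nm, mul_one]; exact le_refl _
  rw [← AddCircle.intervalIntegral_preimage (1:ℝ) 0 F]
  have hii : ∀ a b : ℝ, IntervalIntegrable (fun x : ℝ => F (x : T1)) volume a b := fun a b => by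
    rw [intervalIntegrable_iff]
    exact Measure.integrableOn_of_bounded (by simp) (hFm.comp hco).aestronglyMeasurable (M := 1) (ae_of_all _ fun x => hFb _)
  rw [zero_add, ← intervalIntegral.integral_add_adjacent_intervals (hii 0 (1/2)) (hii (1/2) 1)]
  have key : ∀ (k : ℤ), k ≠ 0 → ∀ a : ℤ, ∫ x in ((a:ℝ) / 2)..((a + 1 : ℝ)/2), Complex.exp ((4 * Real.pi * Complex.I * k) * x) = 0 := fun k hk a => by
    rw [integral_exp_mul_complex]
    · have e : ∀ b : ℤ, Complex.exp ((4 * Real.pi * Complex.I * k) * ((b / 2 : ℝ) : ℂ)) = 1 := fun b => by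
        rw [Complex.exp_eq_one_iff]; exact ⟨k * b, by push_cast; ring⟩
      have e2 := e (a + 1)
      push_cast at e2
      have e1 := e a
      push_cast at e1 ⊢
      rw [e1, e2]; simp
    · have : (k:ℂ) ≠ 0 := by exact_mod_cast hk
      simp [this, Real.pi_ne_zero]
  have I1 : ∫ x in (0:ℝ)..(1/2), F (x : T1) = 0 := by
    have k0 := key (-n) (by simpa using hn) 0
    norm_num at k0
    rw [← k0, intervalIntegral.integral_of_le (by norm_num), intervalIntegral.integral_of_le (by norm_num), integral_Ioc_eq_integral_Ioo, integral_Ioc_eq_integral_Ioo]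
    apply setIntegral_congr_fun measurableSet_Ioo
    intro x hx
    have hx1 : r1 (x : T1) = x := by rw [r1_coe, Int.fract_eq_self]; exact ⟨hx.1.le, by linarith [hx.2]⟩
    have hx2 : r1 ((x : T1) + ((1/2 : ℝ) : T1)) = x + 1/2 := by
      rw [← AddCircle.coe_add, r1_coe, Int.fract_eq_self]; exact ⟨by linarith [hx.1], by linarith [hx.2]⟩
    simp only [hF, gam, hx1, hx2]
    rw [if_neg (by linarith [hx.1]), if_pos (by linarith [hx.2]), AddCircle.coe_zero, fourier_eval_zero, one_mul, fourier_coe_apply]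
    congr 1; push_cast; ring
  have I2 : ∫ x in (1/2:ℝ)..1, F (x : T1) = 0 := by
    have k0 := key n hn 1
    norm_num at k0
    rw [← k0, intervalIntegral.integral_of_le (by norm_num), intervalIntegral.integral_of_le (by norm_num), integral_Ioc_eq_integral_Ioo, integral_Ioc_eq_integral_Ioo]
    apply setIntegral_congr_fun measurableSet_Ioo
    intro x hx
    have hx1 : r1 (x : T1) = x := by rw [r1_coe, Int.fract_eq_self]; exact ⟨by linarith [hx.1], by linarith [hx.2]⟩
    have hx2 : r1 ((x : T1) + ((1/2 : ℝ) : T1)) = x - 1/2 := by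
      rw [← AddCircle.coe_add, r1_coe, Int.fract_eq_iff]
      exact ⟨by linarith [hx.1], by linarith [hx.2], 1, by push_cast; ring⟩
    simp only [hF, gam, hx1, hx2]
    rw [if_pos (by linarith [hx.2]), if_neg (by linarith [hx.1]), AddCircle.coe_zero, fourier_eval_zero, mul_one, fourier_coe_apply]
    rw [Complex.exp_eq_exp_iff_exists_int]
    exact ⟨-n, by push_cast; ring⟩
  rw [I1, I2, add_zero]

def nn (c : ℤ × ℤ × ℤ) (N : ℕ) : ℤ := c.1 * N + c.2.1 + c.2.2 * (N:ℤ)^2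
lemma nn_add (c d N) : nn (c + d) N = nn c N + nn d N := by simp [nn]; ring
lemma nn_neg (c N) : nn (-c) N = - nn c N := by simp [nn]; ring
lemma nn_ne (c : ℤ × ℤ × ℤ) (hc : c ≠ 0) : ∀ᶠ N in atTop, nn c N ≠ 0 := by
  obtain ⟨k, l, j⟩ := c
  filter_upwards [eventually_gt_atTop (|k| + |l| + 1).toNat] with N hN h
  have hN : |k| + |l| + 1 < (N:ℤ) := by omega
  simp only [nn] at h
  apply hc
  have hj : j = 0 := by
    by_contra hj
    have h1 : j * (N:ℤ)^2 = -(k * N + l) := by linarith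
    have h2 := congrArg abs h1
    rw [abs_neg, abs_mul] at h2
    have h3 : |k * N + l| ≤ |k| * N + |l| := (abs_add_le _ _).trans (by rw [abs_mul, Nat.abs_cast])
    have h4 : 1 ≤ |j| := Int.one_le_abs hj
    rw [abs_of_nonneg (by positivity : (0:ℤ) ≤ (N:ℤ)^2)] at h2
    nlinarith [abs_nonneg k, abs_nonneg l]
  subst hj
  have hk : k = 0 := by
    by_contra hk
    have h1 : k * (N:ℤ) = -l := by linarith
    have h2 := congrArg abs h1
    rw [abs_neg, abs_mul, Nat.abs_cast] at h2
    have h4 : 1 ≤ |k| := Int.one_le_abs hk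
    nlinarith [abs_nonneg k, abs_nonneg l]
  subst hk
  have hl : l = 0 := by linarith
  subst hl; rfl

lemma chi_Tn (c : ℤ × ℤ × ℤ) (q N : ℕ) {w : EE} (hw : w.2 ≠ 0) : chi c (NQ (Tn q N w)) =
    (fourier c.1 w.1.1 * fourier (nn c N) (gam (q • w.1.1) : T1)) * fourier (nn c N) w.1.2 * fourier c.2.2 (nrm w.2) := by
  have hth : ∀ y, ((2 * th N y / (2 * Real.pi) : ℝ) : T1) = (N^2) • y := fun y => by
    have : 2 * th N y / (2 * Real.pi) = (N^2 : ℕ) • r1 y := by rw [th, nsmul_eq_mul]; push_cast; field_simp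
    rw [this]
    conv_rhs => rw [← coe_r1 y]
    rfl
  simp only [chi_apply, NQ, Tn]
  rw [nrm_rotv _ hw, hth]
  simp only [fourier_arg_add _ _ (N • _), fourier_arg_add _ ((N^2) • _), fourier_arg_nsmul, nn, fourier_add]
  simp only [fourier_arg_add]
  push_cast
  ring

lemma measurable_Tn (q N) : Measurable (Tn q N) := by
  have hco : Measurable (fun x : ℝ => (x : T1)) := (AddCircle.continuous_mk' 1).measurable
  have hy : Measurable fun w : EE => w.1.2 + (gam (q • w.1.1) : T1) :=
    measurable_fst.snd.add (hco.comp (measurable_gam.comp ((by fun_prop : Continuous fun x : T1 => q • x).measurable.comp measurable_fst.fst)))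
  have ht := (measurable_th N).comp hy
  refine Measurable.prodMk (Measurable.prodMk (measurable_fst.fst.add ((by fun_prop : Continuous fun x : T1 => N • x).measurable.comp hy)) hy) ?_
  simp only [Function.comp_def] at ht
  unfold rotv
  fun_prop

lemma measurable_rot (t) : Measurable (rot t) := by unfold rot; fun_prop
lemma rot_ne {t w} : (rot t w).2 = w.2 := rfl

lemma ideal_eq {q N : ℕ} (hq : 2 ≤ q) (c d : ℤ × ℤ × ℤ) (hc : c ≠ 0 → nn c N ≠ 0) (hcd : c + d ≠ 0 → nn (c + d) N ≠ 0) :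
    ∫ w, chi c (NQ (Tn q N (rot (1 / (2 * q)) w))) * chi d (NQ (Tn q N w)) ∂P0 = (∫ w, chi c (NQ w) ∂P0) * ∫ w, chi d (NQ w) ∂P0 := by
  set t : ℝ := 1 / (2 * q) with ht
  let F : T1 → ℂ := fun x => (fourier c.1 (x + (t : T1)) * fourier (nn c N) (gam (q • (x + (t : T1))) : T1)) * (fourier d.1 x * fourier (nn d N) (gam (q • x) : T1))
  have e : ∀ᵐ w ∂P0, chi c (NQ (Tn q N (rot t w))) * chi d (NQ (Tn q N w)) = F w.1.1 * fourier (nn (c + d) N) w.1.2 * fourier (c.2.2 + d.2.2) (nrm w.2) := by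
    filter_upwards [P0_ne] with w hw
    rw [chi_Tn c q N (w := rot t w) hw, chi_Tn d q N hw, nn_add, fourier_add, fourier_add]
    simp only [F, rot]; ring
  rw [integral_congr_ae e, int_prod3, int_chi, int_chi]
  by_cases h0 : c + d = 0
  · have hd : d = -c := (neg_eq_of_add_eq_zero_right h0).symm
    have e1 : nn (c + d) N = 0 := by rw [h0]; simp [nn]
    have e2 : c.2.2 + d.2.2 = 0 := by rw [hd]; simp
    rw [if_pos e1, if_pos e2, mul_one, mul_one]
    have hF : ∀ x, F x = fourier c.1 (t : T1) * (fourier (nn c N) (gam (q • x + ((1/2:ℝ) : T1)) : T1) * fourier (-nn c N) (gam (q • x) : T1)) := fun x => by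
      have hqt : q • (t : T1) = ((1/2:ℝ) : T1) := by
        have hq0 : (q:ℝ) ≠ 0 := by norm_cast; omega
        have : q • t = 1/2 := by rw [ht, nsmul_eq_mul]; field_simp
        rw [← this]; rfl
      simp only [F]
      have h1 : fourier c.1 x * fourier d.1 x = 1 := by
        rw [hd, ← fourier_add]; simp
      rw [smul_add, hqt, fourier_arg_add _ x, hd, nn_neg]
      rw [hd] at h1
      linear_combination (fourier c.1 (t : T1) * (fourier (nn c N) (gam (q • x + ((1/2:ℝ) : T1)) : T1) * fourier (-nn c N) (gam (q • x) : T1))) * h1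
    by_cases hc0 : c = 0
    · have hd0 : d = 0 := by rw [hd, hc0, neg_zero]
      rw [if_pos hc0, if_pos hd0]
      have : nn c N = 0 := by rw [hc0]; simp [nn]
      simp only [hF, this]
      rw [hc0]
      simp
    · rw [if_neg hc0, zero_mul]
      simp only [hF]
      rw [integral_const_mul]
      have hmp : MeasurePreserving (fun x : T1 => q • x) := (AddCircle.ergodic_nsmul (T := (1:ℝ)) (by omega : 1 < q)).toMeasurePreserving
      have hco : Measurable (fun x : ℝ => (x : T1)) := (AddCircle.continuous_mk' 1).measurable
      have hFm : Measurable fun u => fourier (nn c N) ((gam (u + ((1/2 : ℝ) : T1)) : ℝ) : T1) * fourier (-nn c N) ((gam u : ℝ) : T1) := by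
        have h1 := measurable_gam
        have h2 : ∀ n : ℤ, Measurable (fun x : T1 => fourier n x) := fun n => (fourier n).continuous.measurable
        exact ((h2 _).comp (hco.comp (h1.comp (by fun_prop)))).mul ((h2 _).comp (hco.comp h1))
      have := integral_map (μ := volume) hmp.measurable.aemeasurable hFm.aestronglyMeasurable
      rw [hmp.map_eq, int_gam (hc hc0)] at this
      rw [← this, mul_zero]
  · rw [if_neg (hcd h0), mul_zero, zero_mul]
    by_cases hc0 : c = 0
    · have : d ≠ 0 := fun h => h0 (by rw [hc0, h, add_zero])
      rw [if_neg this, mul_zero]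
    · rw [if_neg hc0, zero_mul]

instance instMQ : IsProbabilityMeasure (P0.map NQ) := Measure.isProbabilityMeasure_map measurable_NQ.aemeasurable
lemma map_NQ {P : Measure EE} (φ : C(QQ, ℂ)) : ∫ p, φ p ∂(P.map NQ) = ∫ w, φ (NQ w) ∂P :=
  integral_map measurable_NQ.aemeasurable φ.continuous.measurable.aestronglyMeasurable

lemma ideal_mix {q : ℕ} (hq : 2 ≤ q) (φ ψ : C(QQ, ℂ)) :
    Tendsto (fun N => ∫ w, φ (NQ (Tn q N (rot (1 / (2 * q)) w))) * ψ (NQ (Tn q N w)) ∂P0) atTop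
      (𝓝 ((∫ w, φ (NQ w) ∂P0) * ∫ w, ψ (NQ w) ∂P0)) := by
  have := bil2 (P := P0) (m := P0.map NQ) (a := fun N w => NQ (Tn q N (rot (1 / (2 * q)) w))) (b := fun N w => NQ (Tn q N w))
    (fun N => measurable_NQ.comp ((measurable_Tn q N).comp (measurable_rot _))) (fun N => measurable_NQ.comp (measurable_Tn q N)) (fun c d => ?_) φ ψ
  · rwa [map_NQ, map_NQ] at this
  · rw [map_NQ, map_NQ]
    refine tendsto_const_nhds.congr' ?_
    have h1 : ∀ᶠ N in atTop, (c ≠ 0 → nn c N ≠ 0) := by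
      by_cases h : c = 0
      · exact Eventually.of_forall fun N hc => absurd h hc
      · exact (nn_ne c h).mono fun N hN _ => hN
    have h2 : ∀ᶠ N in atTop, (c + d ≠ 0 → nn (c + d) N ≠ 0) := by
      by_cases h : c + d = 0
      · exact Eventually.of_forall fun N hc => absurd h hc
      · exact (nn_ne _ h).mono fun N hN _ => hN
    filter_upwards [h1, h2] with N h3 h4
    exact (ideal_eq hq c d h3 h4).symm


def ev (u : T1) : ℝ × ℝ := (((AddCircle.toCircle u : Circle) : ℂ).re, ((AddCircle.toCircle u : Circle) : ℂ).im)
lemma toC_ev (u) : toC (ev u) = ((AddCircle.toCircle u : Circle) : ℂ) := rfl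
lemma ev_ne (u) : ev u ≠ 0 := fun h => by
  have h1 := toC_ev u
  rw [h] at h1
  have h0 : toC 0 = 0 := rfl
  rw [h0] at h1
  exact Circle.coe_ne_zero _ h1.symm
lemma continuous_ev : Continuous ev := by
  have : Continuous (fun u : T1 => ((AddCircle.toCircle u : Circle) : ℂ)) := continuous_subtype_val.comp AddCircle.continuous_toCircle
  exact (Complex.continuous_re.comp this).prodMk (Complex.continuous_im.comp this)
lemma ev_nrm {v} (hv : v ≠ 0) : ev (nrm v) = (‖toC v‖)⁻¹ • v := by
  have h1 : ((AddCircle.toCircle (nrm v) : Circle) : ℂ) = ((‖toC v‖⁻¹ : ℝ) : ℂ) * toC v := by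
    rw [toCircle_nrm' hv]; push_cast; ring
  unfold ev
  rw [h1]
  ext <;> simp [toC]

def HQ (a : Equiv.Perm (ℂ × ℂ)) (p : QQ) : QQ := NQ (tang a (p.1, ev p.2))
lemma continuous_HQ {a} (ha : a ∈ Gam) : Continuous (HQ a) := by
  rw [continuous_iff_continuousAt]
  intro p
  have h1 : ContinuousAt (fun p : QQ => tang a (p.1, ev p.2)) p :=
    ((tang_cont ha).comp (continuous_fst.prodMk (continuous_ev.comp continuous_snd))).continuousAt
  exact (continuousAt_NQ (w := tang a (p.1, ev p.2)) (by rw [Ne, tang_zero_iff ha]; exact ev_ne _)).comp (f := fun p : QQ => tang a (p.1, ev p.2)) h1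
lemma HQ_NQ {a : Equiv.Perm (ℂ × ℂ)} (w : EE) (hw : w.2 ≠ 0) : NQ (tang a w) = HQ a (NQ w) := by
  simp only [HQ, NQ]
  rw [ev_nrm hw]
  refine Prod.ext rfl ?_
  simp only [tang_snd, map_smul]
  rw [nrm_smul]
  have := toC_ne hw
  positivity

lemma tang_emb {a} (ha : a ∈ Gam) : MeasurableEmbedding (tang (a : Equiv.Perm (ℂ × ℂ))) := by
  let e : EE ≃ₜ EE := { toFun := tang a, invFun := tang (a⁻¹ : Equiv.Perm (ℂ × ℂ)), left_inv := tang_inv_self ha, right_inv := tang_self_inv ha, continuous_toFun := tang_cont ha, continuous_invFun := tang_cont (Gam.inv_mem ha) }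
  exact e.measurableEmbedding

section
variable {E : Type*} [NormedAddCommGroup E] [NormedSpace ℝ E]
lemma int_P0 (g : EE → E) : ∫ w, g w ∂P0 = ∫ w : EE, Wd w.2 • g w := by
  rw [P0_eq, integral_withDensity_eq_integral_toReal_smul]
  · simp only [ENNReal.toReal_ofReal (Wd_nonneg _)]
  · exact (continuous_Wd.measurable.comp measurable_snd).ennreal_ofReal
  · exact ae_of_all _ fun w => ENNReal.ofReal_lt_top

def KK (a : Equiv.Perm (ℂ × ℂ)) (w : EE) : ℝ := Wd (tang (a⁻¹ : Equiv.Perm (ℂ × ℂ)) w).2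
lemma KK_nonneg (a w) : 0 ≤ KK a w := Wd_nonneg _
lemma int_KK {a} (ha : a ∈ Gam) (g : EE → E) : ∫ w, KK a w • g w = ∫ w, g (tang a w) ∂P0 := by
  rw [int_P0, ← ha.1.mp.integral_comp (tang_emb ha)]
  refine integral_congr_ae (ae_of_all _ fun w => ?_)
  simp only [KK, tang_inv_self ha]
end
lemma continuous_KK {a} (ha : a ∈ Gam) : Continuous (KK a) :=
  continuous_Wd.comp (continuous_snd.comp (tang_cont (Gam.inv_mem ha)))
lemma integrable_W2 : Integrable (fun w : EE => Wd w.2) := by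
  have := (integrable_const (1:ℝ) (μ := (volume : Measure T2))).mul_prod integrable_Wd
  simp only [one_mul] at this
  exact this
lemma integrable_KK {a} (ha : a ∈ Gam) : Integrable (KK a) := by
  exact ((Gam.inv_mem ha).1.mp.integrable_comp_emb (tang_emb (Gam.inv_mem ha))).2 integrable_W2

def Cj (H : Equiv.Perm (ℂ × ℂ)) (s : ℝ) : Equiv.Perm (ℂ × ℂ) := H * RR s * H⁻¹
lemma Cj_mem {H} (hH : H ∈ Gam) (s) : Cj H s ∈ Gam := Gam.mul_mem (Gam.mul_mem hH (RR_mem s)) (Gam.inv_mem hH)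
lemma Cj_pow (H s) (l : ℕ) : Cj H s ^ l = Cj H (l * s) := by
  rw [Cj, conj_pow, Cj, RR_nat]
lemma Cj_inv (H s) : (Cj H s)⁻¹ = Cj H (-s) := by
  rw [Cj, Cj, RR_neg]; group

def II (H : Equiv.Perm (ℂ × ℂ)) (c : ℤ × ℤ × ℤ) : ℂ := ∫ w, KK H w • chi c (NQ w)
def corr (H : Equiv.Perm (ℂ × ℂ)) (s : ℝ) (c d : ℤ × ℤ × ℤ) (l : ℕ) : ℂ :=
  ∫ w, KK H w • (chi c (NQ ((tang (Cj H s))^[l] w)) * chi d (NQ w))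

lemma corr_eq {H} (hH : H ∈ Gam) (s c d l) : corr H s c d l =
    ∫ w, chi c (NQ (tang H (rot (l * s) w))) * chi d (NQ (tang H w)) ∂P0 := by
  rw [corr, int_KK hH (g := fun w => chi c (NQ ((tang (Cj H s))^[l] w)) * chi d (NQ w))]
  refine integral_congr_ae (ae_of_all _ fun w => ?_)
  simp only
  rw [← tang_pow (Cj_mem hH s), Cj_pow, Cj, tang_mul (Gam.mul_mem hH (RR_mem _)) (Gam.inv_mem hH), tang_inv_self hH, tang_mul hH (RR_mem _), tang_RR]
lemma II_eq {H} (hH : H ∈ Gam) (c) : II H c = ∫ w, chi c (NQ (tang H w)) ∂P0 := int_KK hH (g := fun w => chi c (NQ w))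

lemma L1_bound {k1 k2 : EE → ℝ} (h1 : Integrable k1) (h2 : Integrable k2) {g : EE → ℂ} (hg : Measurable g) (hb : ∀ w, ‖g w‖ ≤ 1) :
    ‖(∫ w, k1 w • g w) - ∫ w, k2 w • g w‖ ≤ ∫ w, |k1 w - k2 w| := by
  have i1 : ∀ {k : EE → ℝ}, Integrable k → Integrable (fun w => k w • g w) := fun {k} hk =>
    hk.smul_bdd 1 hg.aestronglyMeasurable (ae_of_all _ hb)
  rw [← integral_sub (i1 h1) (i1 h2)]
  refine norm_integral_le_of_norm_le (h1.sub h2).abs (ae_of_all _ fun w => ?_)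
  rw [← sub_smul, norm_smul]
  exact mul_le_of_le_one_right (norm_nonneg _) (hb w)

lemma Cj_eq {H h : Equiv.Perm (ℂ × ℂ)} {s : ℝ} (hc : Commute h (RR s)) : Cj (H * h) s = Cj H s := by
  have : h * RR s * h⁻¹ = RR s := by rw [hc.eq]; group
  calc Cj (H * h) s = H * (h * RR s * h⁻¹) * H⁻¹ := by rw [Cj]; group
    _ = _ := by rw [this]; rfl

lemma KK_L1 {H h} (hH : H ∈ Gam) (hh : h ∈ Gam) : ∫ w, |KK (H * h) w - KK H w| = ∫ w : EE, |Wd w.2 - Wd (tang h w).2| := by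
  have hHh := Gam.mul_mem hH hh
  rw [← hHh.1.mp.integral_comp (tang_emb hHh)]
  refine integral_congr_ae (ae_of_all _ fun w => ?_)
  simp only [KK, tang_inv_self hHh]
  rw [tang_mul hH hh, tang_inv_self hH]

lemma measurable_tang {a} (ha : a ∈ Gam) : Measurable (tang (a : Equiv.Perm (ℂ × ℂ))) := (tang_cont ha).measurable

lemma corr_L1 {H h} (hH : H ∈ Gam) (hh : h ∈ Gam) {s : ℝ} (hc : Commute h (RR s)) (c d l) :
    ‖corr (H * h) s c d l - corr H s c d l‖ ≤ ∫ w : EE, |Wd w.2 - Wd (tang h w).2| := by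
  rw [← KK_L1 hH hh, corr, corr, Cj_eq hc]
  refine L1_bound (g := fun w => chi c (NQ ((tang (Cj H s))^[l] w)) * chi d (NQ w)) (integrable_KK (Gam.mul_mem hH hh)) (integrable_KK hH) ?_ ?_
  · have h1 : Measurable ((tang (Cj H s))^[l]) := (measurable_tang (Cj_mem hH s)).iterate l
    exact ((chi c).continuous.measurable.comp (measurable_NQ.comp h1)).mul ((chi d).continuous.measurable.comp measurable_NQ)
  · intro w; rw [norm_mul, chi_norm, chi_norm, mul_one]

/-- Scheffe -/
lemma L1_lim {h : ℕ → Equiv.Perm (ℂ × ℂ)} (hh : ∀ k, h k ∈ Gam) {T : EE → EE} (hW : ∀ w, Wd (T w).2 = Wd w.2)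
    (hT : ∀ᵐ w, Tendsto (fun k => tang (h k) w) atTop (𝓝 (T w))) :
    Tendsto (fun k => ∫ w : EE, |Wd w.2 - Wd (tang (h k) w).2|) atTop (𝓝 0) := by
  have hi : ∀ k, Integrable (fun w => Wd (tang (h k) w).2) := fun k =>
    ((hh k).1.mp.integrable_comp_emb (tang_emb (hh k))).2 integrable_W2
  have e : ∀ k, ∫ w : EE, |Wd w.2 - Wd (tang (h k) w).2| = ∫ w : EE, 2 * max (Wd w.2 - Wd (tang (h k) w).2) 0 := fun k => by
    have e1 : ∫ w : EE, (Wd w.2 - Wd (tang (h k) w).2) = 0 := by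
      rw [integral_sub integrable_W2 (hi k), (hh k).1.mp.integral_comp (tang_emb (hh k)) (fun w => Wd w.2), sub_self]
    have e2 : ∀ x : ℝ, |x| = 2 * max x 0 - x := fun x => by
      rcases le_total 0 x with hx | hx
      · rw [abs_of_nonneg hx, max_eq_left hx]; ring
      · rw [abs_of_nonpos hx, max_eq_right hx]; ring
    simp only [e2]
    have := integral_sub ((((integrable_W2.sub (hi k)).pos_part).const_mul 2)) (integrable_W2.sub (hi k))
    simp only [Pi.sub_apply] at this
    rw [this, e1, sub_zero]
  simp only [e]
  have := tendsto_integral_of_dominated_convergence (μ := (volume : Measure EE)) (F := fun k (w : EE) => 2 * max (Wd w.2 - Wd (tang (h k) w).2) 0)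
    (f := fun _ => 0) (fun w => 2 * Wd w.2) (fun k => ((((integrable_W2.sub (hi k)).pos_part).const_mul 2)).aestronglyMeasurable) (integrable_W2.const_mul 2)
    (fun k => ae_of_all _ fun w => by
      rw [Real.norm_of_nonneg (by positivity)]
      have h1 := Wd_nonneg w.2
      have h2 := Wd_nonneg (tang (h k) w).2
      have : max (Wd w.2 - Wd (tang (h k) w).2) 0 ≤ Wd w.2 := max_le (by linarith) h1
      linarith) ?_
  · simpa using this
  · filter_upwards [hT] with w hw
    have h1 : Tendsto (fun k => Wd (tang (h k) w).2) atTop (𝓝 (Wd w.2)) := by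
      rw [← hW w]
      exact (continuous_Wd.comp continuous_snd).continuousAt.tendsto.comp hw
    have h2 := ((tendsto_const_nhds (x := Wd w.2)).sub h1).max (tendsto_const_nhds (x := (0:ℝ)))
    have h3 := h2.const_mul 2
    simpa using h3

lemma Wd_Tn (q N w) : Wd (Tn q N w).2 = Wd w.2 := Wd_rotv _ _

/-- bounded convergence for products of characters -/
lemma char_lim {Ω : Type*} [MeasurableSpace Ω] {P : Measure Ω} [IsProbabilityMeasure P] {a b : ℕ → Ω → EE} {a' b' : Ω → EE}
    (ha : ∀ n, Measurable (a n)) (hb : ∀ n, Measurable (b n))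
    (h1 : ∀ᵐ x ∂P, Tendsto (fun n => a n x) atTop (𝓝 (a' x)) ∧ (a' x).2 ≠ 0)
    (h2 : ∀ᵐ x ∂P, Tendsto (fun n => b n x) atTop (𝓝 (b' x)) ∧ (b' x).2 ≠ 0) (c d : ℤ × ℤ × ℤ) :
    Tendsto (fun n => ∫ x, chi c (NQ (a n x)) * chi d (NQ (b n x)) ∂P) atTop (𝓝 (∫ x, chi c (NQ (a' x)) * chi d (NQ (b' x)) ∂P)) := by
  refine tendsto_integral_of_dominated_convergence (fun _ => 1) (fun n => ?_) (integrable_const _) (fun n => ae_of_all _ fun x => ?_) ?_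
  · exact (((chi c).continuous.measurable.comp (measurable_NQ.comp (ha n))).mul ((chi d).continuous.measurable.comp (measurable_NQ.comp (hb n)))).aestronglyMeasurable
  · rw [norm_mul, chi_norm, chi_norm, mul_one]
  · filter_upwards [h1, h2] with x hx hy
    exact (((chi c).continuous.tendsto _).comp ((continuousAt_NQ hx.2).tendsto.comp hx.1)).mul (((chi d).continuous.tendsto _).comp ((continuousAt_NQ hy.2).tendsto.comp hy.1))


lemma Cj_apply (H : Equiv.Perm (ℂ × ℂ)) (s z) : Cj H s z = H (RR s ((H⁻¹ : Equiv.Perm (ℂ × ℂ)) z)) := rfl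
lemma RR_fd (s : ℝ) (z) : HasFDerivAt (RR s) (ContinuousLinearMap.id ℂ (ℂ × ℂ)) z := by
  have : HasFDerivAt (fun z : ℂ × ℂ => z + ((s : ℂ), (0:ℂ))) (ContinuousLinearMap.id ℂ (ℂ × ℂ)) z := (hasFDerivAt_id z).add_const _
  refine this.congr_of_eventuallyEq (Eventually.of_forall fun z => ?_)
  rw [RR_apply]; ext <;> simp
lemma Cj_fd {H} (hH : H ∈ Gam) (s z) : fderiv ℂ (Cj H s) z =
    (fderiv ℂ H (RR s ((H⁻¹ : Equiv.Perm (ℂ × ℂ)) z))) ∘L (fderiv ℂ (H⁻¹ : Equiv.Perm (ℂ × ℂ)) z) := by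
  have h1 : HasFDerivAt (H⁻¹ : Equiv.Perm (ℂ × ℂ)) _ z := ((Gam.inv_mem hH).1.reg.diff z).hasFDerivAt
  have h2 := (RR_fd s _).comp z h1
  have h3 := (hH.1.reg.diff (RR s ((H⁻¹ : Equiv.Perm (ℂ × ℂ)) z))).hasFDerivAt.comp z h2
  exact h3.fderiv

lemma unif_cont {X E : Type*} [TopologicalSpace X] [NormedAddCommGroup E] {G : ℝ × X → E} (hG : Continuous G) {K : Set X} (hK : IsCompact K)
    (s : ℝ) {ε : ℝ} (hε : 0 < ε) : ∀ᶠ s' in 𝓝 s, ∀ z ∈ K, ‖G (s', z) - G (s, z)‖ ≤ ε := by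
  refine hK.eventually_forall_of_forall_eventually fun y hy => ?_
  have hc : Continuous fun p : ℝ × X => ‖G (p.1, p.2) - G (s, p.2)‖ := by fun_prop
  have := hc.continuousAt (x := (s, y))
  refine (this.eventually (p := fun x => x < ε) ?_).mono fun z hz => le_of_lt hz
  simp only [sub_self, norm_zero]
  exact eventually_lt_nhds hε

lemma Cj_close {H} (hH : H ∈ Gam) (s r : ℝ) {ε : ℝ} (hε : 0 < ε) : ∀ᶠ s' in 𝓝 s, ∀ z ∈ Metric.closedBall (0 : ℂ × ℂ) r,
    ‖Cj H s' z - Cj H s z‖ ≤ ε ∧ ‖fderiv ℂ (Cj H s') z - fderiv ℂ (Cj H s) z‖ ≤ ε := by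
  have c1 : Continuous H := hH.1.reg.diff.continuous
  have c2 : Continuous (H⁻¹ : Equiv.Perm (ℂ × ℂ)) := (Gam.inv_mem hH).1.reg.diff.continuous
  have c3 : Continuous fun p : ℝ × (ℂ × ℂ) => RR p.1 p.2 := by simp only [RR_apply]; fun_prop
  have c4 : Continuous (fderiv ℂ H) := hH.1.cd.continuous_fderiv (by norm_num)
  have c5 : Continuous (fderiv ℂ (H⁻¹ : Equiv.Perm (ℂ × ℂ))) := (Gam.inv_mem hH).1.cd.continuous_fderiv (by norm_num)
  have c6 : Continuous fun p : ℝ × (ℂ × ℂ) => RR p.1 ((H⁻¹ : Equiv.Perm (ℂ × ℂ)) p.2) := c3.comp (continuous_fst.prodMk (c2.comp continuous_snd))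
  have g1 : Continuous fun p : ℝ × (ℂ × ℂ) => Cj H p.1 p.2 := c1.comp c6
  have g2 : Continuous fun p : ℝ × (ℂ × ℂ) => fderiv ℂ (Cj H p.1) p.2 := by
    simp only [Cj_fd hH]
    exact (c4.comp c6).clm_comp (c5.comp continuous_snd)
  have hK := isCompact_closedBall (0 : ℂ × ℂ) r
  filter_upwards [unif_cont g1 hK s hε, unif_cont g2 hK s hε] with s' h1 h2 z hz
  exact ⟨h1 z hz, h2 z hz⟩

structure St where
  H : Equiv.Perm (ℂ × ℂ)
  p : ℕ
  q : ℕ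
  m : ℕ
  hH : H ∈ Gam
  hq : 2 ≤ q
def St.al (s : St) : ℝ := s.p / s.q

def bx (n : ℕ) : Set (ℤ × ℤ × ℤ) := {c | Encodable.encode c ≤ n}
lemma bx_fin (n) : (bx n).Finite := (finite_Iic n).preimage Encodable.encode_injective.injOn

structure RelS (n : ℕ) (s s' : St) : Prop where
  L1 : ∫ w, |KK s'.H w - KK s.H w| ≤ (1/2)^n
  mix : ∀ c ∈ bx n, ∀ d ∈ bx n, ‖corr s'.H s'.al c d s'.m - II s.H c * II s.H d‖ ≤ (1/2)^n
  lt : s.m < s'.m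
  cor : ∀ l ≤ s.m, ∀ c ∈ bx n, ∀ d ∈ bx n, ‖corr s'.H s'.al c d l - corr s.H s.al c d l‖ ≤ (1/2)^n
  cl : ∀ z ∈ Metric.closedBall (0 : ℂ × ℂ) n, ‖Cj s'.H s'.al z - Cj s.H s.al z‖ ≤ (1/2)^n ∧ ‖fderiv ℂ (Cj s'.H s'.al) z - fderiv ℂ (Cj s.H s.al) z‖ ≤ (1/2)^n
  cli : ∀ z ∈ Metric.closedBall (0 : ℂ × ℂ) n, ‖Cj s'.H (-s'.al) z - Cj s.H (-s.al) z‖ ≤ (1/2)^n ∧ ‖fderiv ℂ (Cj s'.H (-s'.al)) z - fderiv ℂ (Cj s.H (-s.al)) z‖ ≤ (1/2)^n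

lemma rot_add_nat (k : ℕ) (t : ℝ) (w) : rot (k + t) w = rot t w := by
  have h : ((k : ℝ) : T1) = 0 := by
    rw [AddCircle.coe_eq_zero_iff]; exact ⟨k, by simp⟩
  simp only [rot, AddCircle.coe_add, h, zero_add]
lemma rot_cont (w) : Continuous fun t => rot t w := by
  have hc : Continuous (fun x : ℝ => (x : T1)) := AddCircle.continuous_mk' 1
  unfold rot; fun_prop
lemma rot_mp (t) : MeasurePreserving (rot t) (volume : Measure EE) volume := by
  have := (RR_mem t).1.mp
  have e : tang (RR t) = rot t := funext (tang_RR t)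
  rwa [e] at this

lemma corr_cont {H} (hH : H ∈ Gam) {s : ℝ} {a : ℕ → ℝ} (ha : Tendsto a atTop (𝓝 s)) (c d l) :
    Tendsto (fun M => corr H (a M) c d l) atTop (𝓝 (corr H s c d l)) := by
  simp only [corr_eq hH]
  refine char_lim (P := P0) (a := fun M w => tang H (rot (l * a M) w)) (b := fun _ w => tang H w) (a' := fun w => tang H (rot (l * s) w)) (b' := fun w => tang H w)
    (fun M => (measurable_tang hH).comp (measurable_rot _)) (fun M => measurable_tang hH) ?_ ?_ c d
  · filter_upwards [P0_ne] with w hw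
    refine ⟨?_, fun h => hw ((tang_zero_iff hH (rot (l * s) w)).1 h)⟩
    exact ((tang_cont hH).tendsto _).comp (((rot_cont w).tendsto _).comp (ha.const_mul _))
  · filter_upwards [P0_ne] with w hw
    exact ⟨tendsto_const_nhds, fun h => hw ((tang_zero_iff hH _).1 h)⟩

def pullC {H : Equiv.Perm (ℂ × ℂ)} (hH : H ∈ Gam) (c : ℤ × ℤ × ℤ) : C(QQ, ℂ) := (chi c).comp ⟨HQ H, continuous_HQ hH⟩
lemma pullC_NQ {H : Equiv.Perm (ℂ × ℂ)} (hH : H ∈ Gam) (c) {w : EE} (hw : w.2 ≠ 0) : pullC hH c (NQ w) = chi c (NQ (tang H w)) := by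
  rw [HQ_NQ w hw]; rfl

lemma step_N {H : Equiv.Perm (ℂ × ℂ)} (hH : H ∈ Gam) {q : ℕ} (hq : 2 ≤ q) (c d) :
    Tendsto (fun N => ∫ w, chi c (NQ (tang H (Tn q N (rot (1 / (2 * q)) w)))) * chi d (NQ (tang H (Tn q N w))) ∂P0) atTop
      (𝓝 (II H c * II H d)) := by
  have := ideal_mix hq (pullC hH c) (pullC hH d)
  have e : ∀ c, ∫ w, pullC hH c (NQ w) ∂P0 = II H c := fun c => by
    rw [II_eq hH]; exact integral_congr_ae (P0_ne.mono fun w hw => pullC_NQ hH c hw)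
  rw [e, e] at this
  refine this.congr fun N => integral_congr_ae (P0_ne.mono fun w hw => ?_)
  have h1 : (Tn q N (rot (1 / (2 * q)) w)).2 ≠ 0 := rotv_ne _ hw
  have h2 : (Tn q N w).2 ≠ 0 := rotv_ne _ hw
  simp only [pullC_NQ hH _ h1, pullC_NQ hH _ h2]

lemma fin_ev {l : Filter ℕ} {n : ℕ} {F : (ℤ × ℤ × ℤ) → (ℤ × ℤ × ℤ) → ℕ → ℂ} {L : (ℤ × ℤ × ℤ) → (ℤ × ℤ × ℤ) → ℂ} (h : ∀ c d, Tendsto (F c d) l (𝓝 (L c d)))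
    {ε : ℝ} (hε : 0 < ε) : ∀ᶠ N in l, ∀ c ∈ bx n, ∀ d ∈ bx n, ‖F c d N - L c d‖ ≤ ε := by
  rw [eventually_all_finite (bx_fin n)]
  intro c _
  rw [eventually_all_finite (bx_fin n)]
  intro d _
  have := (tendsto_iff_norm_sub_tendsto_zero.1 (h c d)).eventually (eventually_lt_nhds hε)
  exact this.mono fun N hN => le_of_lt hN

lemma step (n : ℕ) (s : St) : ∃ s' : St, RelS n s s' := by
  obtain ⟨H, p, q, m, hH, hq⟩ := s
  have hε : (0:ℝ) < (1/2)^n := by positivity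
  set ε : ℝ := (1/2)^n with hεd
  have hq0 : (0:ℝ) < q := by norm_cast; omega
  obtain ⟨N, hN, hN0⟩ := ((fin_ev (n := n) (step_N hH hq) (half_pos hε)).and (eventually_gt_atTop 0)).exists
  obtain ⟨h, hh, hlim⟩ := Appr_Tn hq hN0
  have hlim2 : ∀ᵐ w, Tendsto (fun k => tang (h k) (rot (1 / (2 * q)) w)) atTop (𝓝 (Tn q N (rot (1 / (2 * q)) w))) :=
    (rot_mp (1 / (2 * q))).quasiMeasurePreserving.ae hlim
  have k1 := fun c d => char_lim (P := P0) (a := fun k w => tang H (tang (h k) (rot (1 / (2 * q)) w))) (b := fun k w => tang H (tang (h k) w))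
    (a' := fun w => tang H (Tn q N (rot (1 / (2 * q)) w))) (b' := fun w => tang H (Tn q N w))
    (fun k => (measurable_tang hH).comp ((measurable_tang (hh k).1).comp (measurable_rot _))) (fun k => (measurable_tang hH).comp (measurable_tang (hh k).1))
    (by
      filter_upwards [P0_ac.ae_le hlim2, P0_ne] with w hw hw0
      exact ⟨((tang_cont hH).tendsto _).comp hw, by rw [Ne, tang_zero_iff hH]; exact rotv_ne _ hw0⟩)
    (by
      filter_upwards [P0_ac.ae_le hlim, P0_ne] with w hw hw0
      exact ⟨((tang_cont hH).tendsto _).comp hw, by rw [Ne, tang_zero_iff hH]; exact rotv_ne _ hw0⟩) c d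
  have k2 := (L1_lim (fun k => (hh k).1) (Wd_Tn q N) hlim).eventually (eventually_lt_nhds (half_pos hε))
  obtain ⟨k, hk1, hk2⟩ := ((fin_ev (n := n) k1 (half_pos hε)).and k2).exists
  obtain ⟨hg, hcom⟩ := hh k
  set g := h k with hgd
  have hHg := Gam.mul_mem hH hg
  have hcom' : ∀ j : ℕ, Commute g (RR (j * (1 / q))) := fun j => by rw [RR_nat]; exact hcom.pow_right j
  have hcp : Commute g (RR (p / q)) := by have := hcom' p; rwa [mul_one_div] at this
  have hcpi : Commute g (RR (-(p / q))) := by rw [RR_neg]; exact hcp.inv_right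
  let a : ℕ → ℝ := fun M => p / q + 1 / (2 * q ^ 2) * (1 / ((M:ℝ) + 1))
  have ha : Tendsto a atTop (𝓝 (p / q)) := by
    have := (tendsto_one_div_add_atTop_nhds_zero_nat (𝕜 := ℝ)).const_mul (1 / (2 * (q:ℝ) ^ 2))
    rw [mul_zero] at this
    have := this.const_add ((p:ℝ) / q)
    rwa [add_zero] at this
  have c1 : ∀ᶠ M in atTop, ∀ l ∈ Iic m, ∀ c ∈ bx n, ∀ d ∈ bx n, ‖corr (H * g) (a M) c d l - corr (H * g) (p / q) c d l‖ ≤ ε / 2 := by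
    rw [eventually_all_finite (finite_Iic m)]
    intro l _
    exact fin_ev (n := n) (fun c d => corr_cont hHg ha c d l) (half_pos hε)
  have c2 := ha.eventually (Cj_close hHg (p / q) n hε)
  have c3 := ha.neg.eventually (Cj_close hHg (-(p / q)) n hε)
  obtain ⟨M, h1, h2, h3, h4⟩ := (c1.and (c2.and (c3.and (eventually_ge_atTop m)))).exists
  have hal : ((2 * q * (M + 1) * p + 1 : ℕ) : ℝ) / ((2 * q ^ 2 * (M + 1) : ℕ) : ℝ) = a M := by
    simp only [a]; push_cast; field_simp
  refine ⟨⟨H * g, 2 * q * (M + 1) * p + 1, 2 * q ^ 2 * (M + 1), q * (M + 1), hHg, by nlinarith⟩, ?_⟩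
  have hL1 : ∫ w : EE, |Wd w.2 - Wd (tang g w).2| ≤ ε / 2 := hk2.le
  constructor
  · simp only; rw [KK_L1 hH hg]; linarith
  · intro c hc d hd
    simp only [St.al, hal]
    have e : corr (H * g) (a M) c d (q * (M + 1)) = ∫ w, chi c (NQ (tang H (tang g (rot (1 / (2 * q)) w)))) * chi d (NQ (tang H (tang g w))) ∂P0 := by
      rw [corr_eq hHg]
      have e1 : ((q * (M + 1) : ℕ) : ℝ) * a M = ((M + 1) * p : ℕ) + 1 / (2 * q) := by
        simp only [a]; push_cast; field_simp
      simp only [e1, rot_add_nat, tang_mul hH hg]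
    rw [e]
    have a1 := hk1 c hc d hd
    have a2 := hN c hc d hd
    calc _ ≤ _ := norm_sub_le_norm_sub_add_norm_sub _ _ _
      _ ≤ ε / 2 + ε / 2 := add_le_add a1 a2
      _ = ε := by ring
  · simp only; nlinarith
  · intro l hl c hc d hd
    simp only [St.al, hal]
    calc _ ≤ _ := norm_sub_le_norm_sub_add_norm_sub _ (corr (H * g) (p / q) c d l) _
      _ ≤ ε / 2 + ε / 2 := add_le_add (h1 l hl c hc d hd) ((corr_L1 hH hg hcp c d l).trans hL1)
      _ = ε := by ring
  · intro z hz
    simp only [St.al, hal]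
    rw [← Cj_eq (H := H) hcp]; exact h2 z hz
  · intro z hz
    simp only [St.al, hal]
    rw [← Cj_eq (H := H) hcpi]; exact h3 z hz

def St0 : St := ⟨1, 0, 2, 0, Gam.one_mem, le_refl _⟩
lemma seq_ex : ∃ S : ℕ → St, ∀ n, RelS n (S n) (S (n+1)) := by
  choose f hf using step
  exact ⟨fun n => Nat.rec St0 (fun n s => f n s) n, fun n => hf n _⟩


section
variable {E : Type*} [NormedAddCommGroup E]
lemma tail_bd {u : ℕ → E} {a : E} {N : ℕ} (h : ∀ n, N ≤ n → ‖u (n+1) - u n‖ ≤ (1/2)^n) (ha : Tendsto u atTop (𝓝 a)) {n : ℕ} (hn : N ≤ n) :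
    ‖u n - a‖ ≤ 2 * (1/2)^n := by
  have := dist_le_of_le_geometric_of_tendsto (1/2) ((1/2)^n) (f := fun k => u (k + n)) (by norm_num) (fun k => by
    rw [dist_comm, dist_eq_norm, ← pow_add, add_comm n k, add_right_comm]
    exact h (k + n) (by omega)) ((tendsto_add_atTop_iff_nat n).2 ha) 0
  rw [dist_eq_norm] at this
  simp only [zero_add, pow_zero, mul_one] at this
  have e : (1/2:ℝ)^n / (1 - 1/2) = 2 * (1/2)^n := by ring
  rwa [e] at this
lemma tail_ex [CompleteSpace E] {u : ℕ → E} {N : ℕ} (h : ∀ n, N ≤ n → ‖u (n+1) - u n‖ ≤ (1/2)^n) : ∃ a, Tendsto u atTop (𝓝 a) := by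
  have := cauchySeq_of_le_geometric (1/2) ((1/2)^N) (f := fun k => u (k + N)) (by norm_num) (fun k => by
    rw [dist_comm, dist_eq_norm, ← pow_add, add_comm N k, add_right_comm]
    exact h (k + N) (by omega))
  obtain ⟨a, ha⟩ := cauchySeq_tendsto_of_complete this
  exact ⟨a, (tendsto_add_atTop_iff_nat N).1 ha⟩

lemma loc_lim {X : Type*} [NormedAddCommGroup X] [CompleteSpace E] {g : ℕ → X → E}
    (h : ∀ n : ℕ, ∀ z ∈ Metric.closedBall (0:X) (n:ℝ), ‖g (n+1) z - g n z‖ ≤ (1/2)^n) : ∃ G, TendstoLocallyUniformly g G atTop := by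
  have hz : ∀ z n, ⌈‖z‖⌉₊ ≤ n → ‖g (n+1) z - g n z‖ ≤ (1/2)^n := fun z n hn => h n z (by
    rw [mem_closedBall_zero_iff]; exact (Nat.le_ceil _).trans (by exact_mod_cast hn))
  choose G hG using fun z => tail_ex (u := fun n => g n z) (hz z)
  refine ⟨G, ?_⟩
  rw [Metric.tendstoLocallyUniformly_iff]
  intro ε hε z
  refine ⟨Metric.ball 0 (‖z‖ + 1), Metric.isOpen_ball.mem_nhds (by simp), ?_⟩
  have hp : Tendsto (fun k : ℕ => 2 * (1/2 : ℝ)^k) atTop (𝓝 (2 * 0)) := (tendsto_pow_atTop_nhds_zero_of_lt_one (by norm_num) (by norm_num)).const_mul 2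
  rw [mul_zero] at hp
  filter_upwards [hp.eventually (eventually_lt_nhds hε), eventually_ge_atTop (⌈‖z‖ + 1⌉₊)] with n h1 h2 y hy
  rw [dist_comm, dist_eq_norm]
  refine (tail_bd (u := fun n => g n y) (hz y) (hG y) ?_).trans_lt h1
  refine le_trans (Nat.ceil_mono ?_) h2
  rw [mem_ball_zero_iff] at hy; exact hy.le
end

structure Conv (φ : ℕ → ℂ × ℂ → ℂ × ℂ) (Φ : ℂ × ℂ → ℂ × ℂ) : Prop where
  reg : Reg Φ
  cd : ContDiff ℂ 1 Φ
  lim : TendstoLocallyUniformly φ Φ atTop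
  dlim : TendstoLocallyUniformly (fun n => fderiv ℂ (φ n)) (fderiv ℂ Φ) atTop

lemma conv_ex {φ : ℕ → ℂ × ℂ → ℂ × ℂ} (hr : ∀ n, Reg (φ n)) (hc : ∀ n, ContDiff ℂ 1 (φ n))
    (h : ∀ n : ℕ, ∀ z ∈ Metric.closedBall (0 : ℂ × ℂ) (n:ℝ), ‖φ (n+1) z - φ n z‖ ≤ (1/2)^n ∧ ‖fderiv ℂ (φ (n+1)) z - fderiv ℂ (φ n) z‖ ≤ (1/2)^n) :
    ∃ Φ, Conv φ Φ := by
  obtain ⟨Φ, hΦ⟩ := loc_lim (g := φ) fun n z hz => (h n z hz).1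
  obtain ⟨D, hD⟩ := loc_lim (g := fun n => fderiv ℂ (φ n)) fun n z hz => (h n z hz).2
  have hpt : ∀ z, Tendsto (fun n => φ n z) atTop (𝓝 (Φ z)) := fun z => by
    have := (tendstoLocallyUniformlyOn_univ.2 hΦ).tendsto_at (mem_univ z)
    exact this
  have hder : ∀ z, HasFDerivAt Φ (D z) z := fun z =>
    hasFDerivAt_of_tendstoLocallyUniformlyOn isOpen_univ (tendstoLocallyUniformlyOn_univ.2 hD)
      (fun n x _ => ((hr n).diff x).hasFDerivAt) (fun x _ => hpt x) (mem_univ z)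
  have hDe : fderiv ℂ Φ = D := funext fun z => (hder z).fderiv
  have hcD : Continuous D := hD.continuous (Frequently.of_forall fun n => (hc n).continuous_fderiv (by norm_num))
  have hdiff : Differentiable ℂ Φ := fun z => (hder z).differentiableAt
  refine ⟨Φ, ⟨hdiff, fun x => ?_, fun z m => ?_⟩, ?_, hΦ, by rw [hDe]; exact hD⟩
  · refine tendsto_nhds_unique (hpt (cxL x)) ?_
    simp only [(hr _).real x]
    exact (cxL.continuous.tendsto _).comp ((rpL.continuous.tendsto _).comp (hpt (cxL x)))
  · refine tendsto_nhds_unique (hpt _) ?_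
    simp only [(hr _).per]
    exact (hpt z).add_const _
  · rw [contDiff_one_iff_fderiv]; exact ⟨hdiff, by rw [hDe]; exact hcD⟩

lemma Conv.TL_lim {φ Φ} (h : Conv φ Φ) {p : ℕ → (ℝ × ℝ) × (ℝ × ℝ)} {p'} (hp : Tendsto p atTop (𝓝 p')) :
    Tendsto (fun n => TL (φ n) (p n)) atTop (𝓝 (TL Φ p')) := by
  have h1 : Tendsto (fun n => cxL (p n).1) atTop (𝓝 (cxL p'.1)) := ((cxL.continuous.comp continuous_fst).tendsto _).comp hp
  have h2 : Tendsto (fun n => cxL (p n).2) atTop (𝓝 (cxL p'.2)) := ((cxL.continuous.comp continuous_snd).tendsto _).comp hp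
  refine Tendsto.prodMk_nhds ?_ ?_
  · exact (rpL.continuous.tendsto _).comp (h.lim.tendsto_comp h.reg.diff.continuous.continuousAt h1)
  · simp only [dr_apply]
    have h3 := h.dlim.tendsto_comp (h.cd.continuous_fderiv (by norm_num)).continuousAt h1
    exact (rpL.continuous.tendsto _).comp (((continuous_fst.clm_apply continuous_snd).tendsto (fderiv ℂ Φ (cxL p'.1), cxL p'.2)).comp (h3.prodMk_nhds h2))

lemma Conv.iter {φ Φ} (h : Conv φ Φ) (hr : ∀ n, Reg (φ n)) (l : ℕ) (w : EE) :
    Tendsto (fun n => (tang (φ n))^[l] w) atTop (𝓝 ((tang Φ)^[l] w)) := by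
  obtain ⟨p, rfl⟩ := isOpenQuotientMap_Pj.surjective w
  have e : ∀ {Φ}, Reg Φ → ∀ l, (tang Φ)^[l] (Pj p) = Pj ((TL Φ)^[l] p) := fun {Φ} hΦ l => by
    induction l with
    | zero => rfl
    | succ l ih => rw [Function.iterate_succ_apply', ih, hΦ.tang_Pj, Function.iterate_succ_apply']
  simp only [e (hr _), e h.reg]
  refine (isOpenQuotientMap_Pj.continuous.tendsto _).comp ?_
  induction l with
  | zero => exact tendsto_const_nhds
  | succ l ih =>
    simp only [Function.iterate_succ_apply']
    exact h.TL_lim ih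

lemma Conv.inv {φ ψ Φ Ψ} (h : Conv φ Φ) (h' : Conv ψ Ψ) (hi : ∀ n z, φ n (ψ n z) = z) (z) : Φ (Ψ z) = z := by
  have h1 : Tendsto (fun n => ψ n z) atTop (𝓝 (Ψ z)) := h'.lim.tendsto_comp h'.reg.diff.continuous.continuousAt tendsto_const_nhds
  have h2 := h.lim.tendsto_comp h.reg.diff.continuous.continuousAt h1
  simp only [hi] at h2
  exact tendsto_nhds_unique h2 tendsto_const_nhds

/-- L1 limits -/
lemma L1_ex {k : ℕ → EE → ℝ} (hk : ∀ n, Integrable (k n)) (hk0 : ∀ n w, 0 ≤ k n w) (h : ∀ n, ∫ w, |k (n+1) w - k n w| ≤ (1/2)^n) :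
    ∃ K : EE → ℝ, Measurable K ∧ (∀ w, 0 ≤ K w) ∧ Integrable K ∧ Tendsto (fun n => ∫ w, |k n w - K w|) atTop (𝓝 0) := by
  let u : ℕ → Lp ℝ 1 (volume : Measure EE) := fun n => (hk n).toL1
  obtain ⟨F, hF⟩ := tail_ex (u := u) (N := 0) (fun n _ => by
    simp only [u]
    rw [← Integrable.toL1_sub, L1.norm_of_fun_eq_integral_norm]
    exact h n)
  have hFi : Integrable F := L1.integrable_coeFn F
  have hFm : Measurable F := (Lp.stronglyMeasurable F).measurable
  refine ⟨fun w => max (F w) 0, hFm.max measurable_const, fun w => le_max_right _ _, hFi.pos_part, ?_⟩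
  have h1 := tendsto_iff_norm_sub_tendsto_zero.1 hF
  refine squeeze_zero (fun n => integral_nonneg fun w => abs_nonneg _) (fun n => ?_) h1
  have e : u n - F = (((hk n).sub hFi).toL1) := by
    rw [Integrable.toL1_sub _ _ (hk n) hFi, Integrable.toL1_coeFn]
  rw [e, L1.norm_of_fun_eq_integral_norm]
  refine integral_mono ((hk n).sub hFi.pos_part).abs ((hk n).sub hFi).norm fun w => ?_
  simp only [Pi.sub_apply, Real.norm_eq_abs]
  have h2 := hk0 n w
  have := abs_max_sub_max_le_abs (k n w) (F w) 0
  rwa [max_eq_left h2] at this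

section
variable {E : Type*} [NormedAddCommGroup E] [NormedSpace ℝ E] [MeasurableSpace E] [BorelSpace E] [SecondCountableTopology E]
lemma wlim {k : ℕ → EE → ℝ} {K : EE → ℝ} (hk : ∀ n, Integrable (k n)) (hK : Integrable K)
    (hlim : Tendsto (fun n => ∫ w, |k n w - K w|) atTop (𝓝 0)) {g : ℕ → EE → E} {g' : EE → E} {C : ℝ} (hg : ∀ n, Measurable (g n))
    (hb : ∀ n w, ‖g n w‖ ≤ C) (hl : ∀ᵐ w, Tendsto (fun n => g n w) atTop (𝓝 (g' w))) :
    Tendsto (fun n => ∫ w, k n w • g n w) atTop (𝓝 (∫ w, K w • g' w)) := by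
  have i1 : ∀ {k : EE → ℝ} n, Integrable k → Integrable (fun w => k w • g n w) := fun {k} n hk =>
    hk.smul_bdd C (hg n).aestronglyMeasurable (ae_of_all _ (hb n))
  have h1 : Tendsto (fun n => ∫ w, K w • g n w) atTop (𝓝 (∫ w, K w • g' w)) := by
    refine tendsto_integral_of_dominated_convergence (fun w => ‖K w‖ * C) (fun n => (i1 n hK).aestronglyMeasurable) (hK.norm.mul_const C)
      (fun n => ae_of_all _ fun w => ?_) ?_
    · rw [norm_smul]; gcongr; exact hb n w
    · filter_upwards [hl] with w hw
      exact hw.const_smul _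
  have h2 : Tendsto (fun n => (∫ w, k n w • g n w) - ∫ w, K w • g n w) atTop (𝓝 0) := by
    have h3 := hlim.mul_const C
    rw [zero_mul] at h3
    refine squeeze_zero_norm (fun n => ?_) h3
    rw [← integral_sub (i1 n (hk n)) (i1 n hK), ← integral_mul_const]
    refine norm_integral_le_of_norm_le (((hk n).sub hK).abs.mul_const C) (ae_of_all _ fun w => ?_)
    rw [← sub_smul, norm_smul]
    exact mul_le_mul_of_nonneg_left (hb n w) (norm_nonneg _)
  have := h2.add h1
  simpa using this
end


def nt (K : EE → ℝ) : Measure EE := volume.withDensity fun w => ENNReal.ofReal (K w)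
lemma int_nt {E : Type*} [NormedAddCommGroup E] [NormedSpace ℝ E] {K : EE → ℝ} (hm : Measurable K) (h0 : ∀ w, 0 ≤ K w) (g : EE → E) :
    ∫ w, g w ∂(nt K) = ∫ w, K w • g w := by
  rw [nt, integral_withDensity_eq_integral_toReal_smul]
  · simp only [ENNReal.toReal_ofReal (h0 _)]
  · exact hm.ennreal_ofReal
  · exact ae_of_all _ fun w => ENNReal.ofReal_lt_top

structure Core (Φ Ψ : ℂ × ℂ → ℂ × ℂ) (K : EE → ℝ) (s : ℕ → ℕ) : Prop where
  r1 : Reg Φ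
  r2 : Reg Ψ
  c1 : ContDiff ℂ 1 Φ
  c2 : ContDiff ℂ 1 Ψ
  i1 : ∀ z, Φ (Ψ z) = z
  i2 : ∀ z, Ψ (Φ z) = z
  hm : Measurable K
  h0 : ∀ w, 0 ≤ K w
  hi : Integrable K
  pr : IsProbabilityMeasure (nt K)
  mp : MeasurePreserving (tang Φ) (nt K) (nt K)
  mg : (nt K).map Prod.fst = (volume : Measure T2)
  sm : StrictMono s
  mix : ∀ c d, Tendsto (fun n => ∫ w, chi c (NQ ((tang Φ)^[s n] w)) * chi d (NQ w) ∂(nt K)) atTop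
    (𝓝 ((∫ w, chi c (NQ w) ∂(nt K)) * ∫ w, chi d (NQ w) ∂(nt K)))

lemma tang_zero {Φ Ψ} (r1 : Reg Φ) (r2 : Reg Ψ) (i : ∀ z, Ψ (Φ z) = z) (w : EE) (hw : w.2 ≠ 0) : (tang Φ w).2 ≠ 0 := fun h => by
  have h1 := r2.tang_comp r1 w
  have e : Ψ ∘ Φ = id := funext i
  rw [e, tang_id] at h1
  apply hw
  rw [h1, tang_snd, h, map_zero]
lemma tang_iter_zero {Φ Ψ} (r1 : Reg Φ) (r2 : Reg Ψ) (i : ∀ z, Ψ (Φ z) = z) (w : EE) (hw : w.2 ≠ 0) (l : ℕ) : ((tang Φ)^[l] w).2 ≠ 0 := by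
  induction l with
  | zero => exact hw
  | succ l ih => rw [Function.iterate_succ_apply']; exact tang_zero r1 r2 i _ ih

lemma P0_fst : P0.map Prod.fst = (volume : Measure T2) := by
  rw [P0]; exact Measure.map_fst_prod.trans (by simp)
lemma P0_rot (t) : MeasurePreserving (rot t) P0 P0 := by
  have h := rot_mp t
  refine ⟨measurable_rot t, ?_⟩
  refine ext_of_forall_integral_eq_of_IsFiniteMeasure fun f => ?_
  rw [integral_map (measurable_rot t).aemeasurable f.continuous.measurable.aestronglyMeasurable, int_P0, int_P0]
  have e : MeasurableEmbedding (rot t) := by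
    have := tang_emb (RR_mem t)
    rwa [show tang (RR t) = rot t from funext (tang_RR t)] at this
  exact h.integral_comp e (fun w => Wd w.2 • f w)

theorem core_ex : ∃ Φ Ψ K s, Core Φ Ψ K s := by
  obtain ⟨S, hS⟩ := seq_ex
  have mem := fun n t => Cj_mem (S n).hH t
  obtain ⟨Φ, hΦ⟩ := conv_ex (φ := fun n => Cj (S n).H (S n).al) (fun n => (mem n _).1.reg) (fun n => (mem n _).1.cd) (fun n z hz => (hS n).cl z hz)
  obtain ⟨Ψ, hΨ⟩ := conv_ex (φ := fun n => Cj (S n).H (-(S n).al)) (fun n => (mem n _).1.reg) (fun n => (mem n _).1.cd) (fun n z hz => (hS n).cli z hz)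
  have i1 : ∀ z, Φ (Ψ z) = z := hΦ.inv hΨ fun n z => by
    rw [← Cj_inv]; exact Equiv.apply_symm_apply _ _
  have i2 : ∀ z, Ψ (Φ z) = z := hΨ.inv hΦ fun n z => by
    rw [← Cj_inv]; exact Equiv.symm_apply_apply _ _
  have hk := fun n => integrable_KK (S n).hH
  obtain ⟨K, hm, h0, hi, hlim⟩ := L1_ex (k := fun n => KK (S n).H) hk (fun n => KK_nonneg _) (fun n => (hS n).L1)
  have hIt := fun l w => hΦ.iter (fun n => (mem n _).1.reg) l w
  have hcont : Continuous (tang Φ) := hΦ.reg.continuous_tang hΦ.cd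
  have pr1 : ∫ w, K w = 1 := by
    have h1 := wlim (g := fun _ _ => (1:ℝ)) (g' := fun _ => 1) (C := 1) hk hi hlim (fun _ => measurable_const) (by simp) (by simp)
    have h2 : ∀ n, ∫ w, KK (S n).H w • (1:ℝ) = 1 := fun n => by
      rw [int_KK (S n).hH (g := fun _ => (1:ℝ))]; simp
    simp only [h2] at h1
    have := tendsto_nhds_unique h1 tendsto_const_nhds
    simpa using this
  have pr : IsProbabilityMeasure (nt K) := by
    constructor
    rw [nt, withDensity_apply _ MeasurableSet.univ, Measure.restrict_univ, ← ofReal_integral_eq_lintegral_ofReal hi (ae_of_all _ h0), pr1]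
    simp
  have bnd : ∀ (f : BoundedContinuousFunction EE ℝ) w, ‖f w‖ ≤ ‖f‖ := fun f => f.norm_coe_le_norm
  refine ⟨Φ, Ψ, K, fun n => (S (n+1)).m, hΦ.reg, hΨ.reg, hΦ.cd, hΨ.cd, i1, i2, hm, h0, hi, pr, ⟨hcont.measurable, ?_⟩, ?_, strictMono_nat_of_lt_succ fun n => (hS (n+1)).lt, ?_⟩
  · have : IsProbabilityMeasure ((nt K).map (tang Φ)) := Measure.isProbabilityMeasure_map hcont.measurable.aemeasurable
    refine ext_of_forall_integral_eq_of_IsFiniteMeasure fun f => ?_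
    rw [integral_map hcont.measurable.aemeasurable f.continuous.measurable.aestronglyMeasurable, int_nt hm h0, int_nt hm h0]
    have h1 := wlim (g := fun n w => f (tang (Cj (S n).H (S n).al) w)) (g' := fun w => f (tang Φ w)) hk hi hlim
      (fun n => f.continuous.measurable.comp (measurable_tang (mem n _))) (fun n w => bnd f _)
      (ae_of_all _ fun w => (f.continuous.tendsto _).comp (hIt 1 w))
    have h2 := wlim (g := fun n w => f w) (g' := fun w => f w) hk hi hlim
      (fun n => f.continuous.measurable) (fun n w => bnd f _)
      (ae_of_all _ fun w => tendsto_const_nhds)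
    refine tendsto_nhds_unique h1 (h2.congr fun n => ?_)
    rw [int_KK (S n).hH (g := fun w => f w), int_KK (S n).hH (g := fun w => f (tang (Cj (S n).H (S n).al) w))]
    have e : ∀ w, tang (Cj (S n).H (S n).al) (tang (S n).H w) = tang (S n).H (rot (S n).al w) := fun w => by
      rw [← tang_RR, ← tang_mul (mem n _) (S n).hH, ← tang_mul (S n).hH (RR_mem _)]
      congr 1; simp [Cj]
    simp only [e]
    have h3 := integral_map (μ := P0) (measurable_rot (S n).al).aemeasurable (f := fun w => f (tang (S n).H w)) (f.continuous.measurable.comp (measurable_tang (S n).hH)).aestronglyMeasurable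
    rw [(P0_rot _).map_eq] at h3
    exact h3
  · have : IsProbabilityMeasure ((nt K).map (Prod.fst : EE → T2)) := Measure.isProbabilityMeasure_map measurable_fst.aemeasurable
    refine ext_of_forall_integral_eq_of_IsFiniteMeasure fun f => ?_
    rw [integral_map measurable_fst.aemeasurable f.continuous.measurable.aestronglyMeasurable, int_nt hm h0]
    have h2 := wlim (g := fun n w => f w.1) (g' := fun w => f w.1) hk hi hlim
      (fun n => f.continuous.measurable.comp measurable_fst) (fun n w => f.norm_coe_le_norm _)
      (ae_of_all _ fun w => tendsto_const_nhds)
    refine tendsto_nhds_unique h2 (tendsto_const_nhds.congr fun n => ?_)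
    rw [int_KK (S n).hH (g := fun w => f w.1)]
    simp only [tang_fst]
    have hmt := (S n).hH.1.mpt
    have h3 := integral_map (μ := P0) (measurable_fst).aemeasurable (f := fun z : T2 => f (tor (S n).H z)) (f.continuous.measurable.comp hmt.measurable).aestronglyMeasurable
    rw [P0_fst] at h3
    have h4 := integral_map (μ := volume) hmt.measurable.aemeasurable (f := fun z : T2 => f z) (f.continuous.measurable).aestronglyMeasurable
    rw [hmt.map_eq] at h4
    exact h4.trans h3
  · intro c d
    have ne0 := vol_ne
    have cm : ∀ c : ℤ × ℤ × ℤ, Measurable fun w => chi c (NQ w) := fun c => (chi c).continuous.measurable.comp measurable_NQ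
    have lII : ∀ c, Tendsto (fun n => II (S n).H c) atTop (𝓝 (∫ w, chi c (NQ w) ∂(nt K))) := fun c => by
      rw [int_nt hm h0]
      exact wlim (g := fun n w => chi c (NQ w)) (C := 1) hk hi hlim (fun n => cm c) (fun n w => (chi_norm _ _).le) (ae_of_all _ fun w => tendsto_const_nhds)
    have lco : ∀ l, Tendsto (fun n => corr (S n).H (S n).al c d l) atTop (𝓝 (∫ w, chi c (NQ ((tang Φ)^[l] w)) * chi d (NQ w) ∂(nt K))) := fun l => by
      rw [int_nt hm h0]
      refine wlim (g := fun n w => chi c (NQ ((tang (Cj (S n).H (S n).al))^[l] w)) * chi d (NQ w)) (C := 1) hk hi hlim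
        (fun n => ((cm c).comp ((measurable_tang (mem n _)).iterate l)).mul (cm d)) (fun n w => by rw [norm_mul, chi_norm, chi_norm]; simp) ?_
      filter_upwards [ne0] with w hw
      have := (continuousAt_NQ (tang_iter_zero hΦ.reg hΨ.reg i2 w hw l)).tendsto.comp (hIt l w)
      exact (((chi c).continuous.tendsto _).comp this).mul_const _
    have mono : Monotone fun n => (S n).m := monotone_nat_of_le_succ fun n => (hS n).lt.le
    have hp : Tendsto (fun k : ℕ => 2 * (1/2 : ℝ)^(k+1) + (1/2)^k) atTop (𝓝 0) := by
      have h1 : Tendsto (fun k : ℕ => (1/2 : ℝ)^k) atTop (𝓝 0) := tendsto_pow_atTop_nhds_zero_of_lt_one (by norm_num) (by norm_num)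
      have := (((tendsto_add_atTop_iff_nat 1).2 h1).const_mul 2).add h1
      simpa using this
    have key : Tendsto (fun n => (∫ w, chi c (NQ ((tang Φ)^[(S (n+1)).m] w)) * chi d (NQ w) ∂(nt K)) - II (S n).H c * II (S n).H d) atTop (𝓝 0) := by
      refine squeeze_zero_norm' ?_ hp
      filter_upwards [eventually_ge_atTop (max (Encodable.encode c) (Encodable.encode d))] with n hn
      have hc : ∀ k, n ≤ k → c ∈ bx k := fun k hk => ((le_max_left _ _).trans hn).trans hk
      have hd : ∀ k, n ≤ k → d ∈ bx k := fun k hk => ((le_max_right _ _).trans hn).trans hk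
      have t1 := tail_bd (N := n + 1) (fun k hk => (hS k).cor _ (mono hk) c (hc k (by omega)) d (hd k (by omega))) (lco (S (n+1)).m) le_rfl
      have t2 := (hS n).mix c (hc n le_rfl) d (hd n le_rfl)
      rw [norm_sub_rev] at t1
      calc _ = ‖((∫ w, chi c (NQ ((tang Φ)^[(S (n+1)).m] w)) * chi d (NQ w) ∂(nt K)) - corr (S (n+1)).H (S (n+1)).al c d (S (n+1)).m) + (corr (S (n+1)).H (S (n+1)).al c d (S (n+1)).m - II (S n).H c * II (S n).H d)‖ := by congr 1; ring
        _ ≤ _ := (norm_add_le _ _).trans (add_le_add t1 t2)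
    have := key.add ((lII c).mul (lII d))
    simpa using this


lemma clamp_ex (m : Measure QQ) [IsProbabilityMeasure m] {A : Set QQ} (hA : MeasurableSet A) {ε : ℝ} (hε : 0 < ε) :
    ∃ φ : C(QQ, ℝ), (∀ p, |φ p| ≤ 1) ∧ ∫ p, |A.indicator 1 p - φ p| ∂m ≤ ε := by
  have hi : Integrable (A.indicator (1 : QQ → ℝ)) m := (integrable_const (1:ℝ)).indicator hA
  obtain ⟨g, hg, hgi⟩ := hi.exists_boundedContinuous_integral_sub_le hε
  have hc : Continuous fun p => max 0 (min (g p) 1) := continuous_const.max (g.continuous.min continuous_const)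
  refine ⟨⟨fun p => max 0 (min (g p) 1), hc⟩, fun p => ?_, le_trans ?_ hg⟩
  · simp only [ContinuousMap.coe_mk]
    rw [abs_of_nonneg (le_max_left _ _)]
    exact max_le zero_le_one (min_le_right _ _)
  · refine integral_mono ?_ (hi.sub hgi).norm fun p => ?_
    · refine Integrable.abs (hi.sub (Integrable.of_bound hc.measurable.aestronglyMeasurable 1 (ae_of_all _ fun p => ?_)))
      rw [Real.norm_eq_abs, abs_of_nonneg (le_max_left _ _)]
      exact max_le zero_le_one (min_le_right _ _)
    · simp only [ContinuousMap.coe_mk, Real.norm_eq_abs]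
      have key : ∀ x y : ℝ, (x = 0 ∨ x = 1) → |x - max 0 (min y 1)| ≤ |x - y| := fun x y hx => by
        rcases hx with rfl | rfl
        · rw [zero_sub, zero_sub, abs_neg, abs_neg]
          rcases le_total y 0 with h | h
          · rw [max_eq_left ((min_le_left _ _).trans h)]; simp
          · rw [max_eq_right (le_min h zero_le_one), abs_of_nonneg (le_min h zero_le_one), abs_of_nonneg h]; exact min_le_left _ _
        · rcases le_total y 1 with h | h
          · rw [min_eq_left h]
            rcases le_total y 0 with h' | h'
            · rw [max_eq_left h', abs_of_nonneg, abs_of_nonneg] <;> linarith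
            · rw [max_eq_right h']
          · rw [min_eq_right h, max_eq_right zero_le_one]; simp
      apply key
      by_cases h : p ∈ A <;> simp [h]

lemma joint_bd {m : Measure QQ} [IsProbabilityMeasure m] {γ : Measure (QQ × QQ)} [IsProbabilityMeasure γ]
    (h1 : γ.map Prod.fst = m) (h2 : γ.map Prod.snd = m) {A B : Set QQ} (hA : MeasurableSet A) (hB : MeasurableSet B)
    {φ ψ : C(QQ, ℝ)} (b1 : ∀ p, |φ p| ≤ 1) (b2 : ∀ p, |ψ p| ≤ 1) {ε : ℝ}
    (e1 : ∫ p, |A.indicator 1 p - φ p| ∂m ≤ ε) (e2 : ∫ p, |B.indicator 1 p - ψ p| ∂m ≤ ε) :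
    |γ.real (A ×ˢ B) - ∫ p, φ p.1 * ψ p.2 ∂γ| ≤ 2 * ε := by
  have ib : ∀ {g : QQ × QQ → ℝ} {C : ℝ}, Measurable g → (∀ p, |g p| ≤ C) → Integrable g γ := fun hg hb =>
    Integrable.of_bound hg.aestronglyMeasurable _ (ae_of_all _ hb)
  have mA : Measurable (A.indicator (1 : QQ → ℝ)) := measurable_one.indicator hA
  have mB : Measurable (B.indicator (1 : QQ → ℝ)) := measurable_one.indicator hB
  have mφ := φ.continuous.measurable
  have mψ := ψ.continuous.measurable
  have bi : ∀ (A : Set QQ) p, |A.indicator (1 : QQ → ℝ) p| ≤ 1 := fun A p => by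
    by_cases h : p ∈ A <;> simp [h]
  have e : γ.real (A ×ˢ B) = ∫ p, A.indicator (1 : QQ → ℝ) p.1 * B.indicator (1 : QQ → ℝ) p.2 ∂γ := by
    rw [← integral_indicator_one (hA.prod hB)]
    congr 1; ext p
    by_cases h : p.1 ∈ A <;> by_cases h' : p.2 ∈ B <;> simp [indicator, h, h']
  have i1 : Integrable (fun p : QQ × QQ => A.indicator (1 : QQ → ℝ) p.1 * B.indicator (1 : QQ → ℝ) p.2) γ := by
    refine ib (C := 1) ((mA.comp measurable_fst).mul (mB.comp measurable_snd)) fun p => ?_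
    rw [abs_mul]; exact mul_le_one₀ (bi _ _) (abs_nonneg _) (bi _ _)
  have i2 : Integrable (fun p : QQ × QQ => φ p.1 * ψ p.2) γ := by
    refine ib (C := 1) ((mφ.comp measurable_fst).mul (mψ.comp measurable_snd)) fun p => ?_
    rw [abs_mul]; exact mul_le_one₀ (b1 _) (abs_nonneg _) (b2 _)
  have d1 : Measurable fun p => |A.indicator (1 : QQ → ℝ) p - φ p| := (mA.sub mφ).norm
  have d2 : Measurable fun p => |B.indicator (1 : QQ → ℝ) p - ψ p| := (mB.sub mψ).norm
  have s1 : ∫ p : QQ × QQ, |A.indicator (1 : QQ → ℝ) p.1 - φ p.1| ∂γ ≤ ε := by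
    rw [← h1, integral_map measurable_fst.aemeasurable d1.aestronglyMeasurable] at e1; exact e1
  have s2 : ∫ p : QQ × QQ, |B.indicator (1 : QQ → ℝ) p.2 - ψ p.2| ∂γ ≤ ε := by
    rw [← h2, integral_map measurable_snd.aemeasurable d2.aestronglyMeasurable] at e2; exact e2
  have bd : ∀ x y : ℝ, |x| ≤ 1 → |y| ≤ 1 → |(|x - y|)| ≤ 2 := fun x y hx hy => by
    rw [abs_abs]; exact (abs_sub _ _).trans (by linarith)
  rw [e, ← integral_sub i1 i2]
  have j1 : Integrable (fun p : QQ × QQ => |A.indicator (1 : QQ → ℝ) p.1 - φ p.1|) γ := ib (C := 2) (d1.comp measurable_fst) fun p => bd _ _ (bi A p.1) (b1 p.1)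
  have j2 : Integrable (fun p : QQ × QQ => |B.indicator (1 : QQ → ℝ) p.2 - ψ p.2|) γ := ib (C := 2) (d2.comp measurable_snd) fun p => bd _ _ (bi B p.2) (b2 p.2)
  calc _ ≤ ∫ p : QQ × QQ, (|A.indicator (1 : QQ → ℝ) p.1 - φ p.1| + |B.indicator (1 : QQ → ℝ) p.2 - ψ p.2|) ∂γ := by
        rw [← Real.norm_eq_abs]
        refine norm_integral_le_of_norm_le (j1.add j2) (ae_of_all _ fun p => ?_)
        rw [Real.norm_eq_abs]
        have : A.indicator (1 : QQ → ℝ) p.1 * B.indicator (1 : QQ → ℝ) p.2 - φ p.1 * ψ p.2 =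
          (A.indicator (1 : QQ → ℝ) p.1 - φ p.1) * B.indicator (1 : QQ → ℝ) p.2 + φ p.1 * (B.indicator (1 : QQ → ℝ) p.2 - ψ p.2) := by ring
        rw [this]
        refine (abs_add_le _ _).trans ?_
        rw [abs_mul, abs_mul]
        exact add_le_add (mul_le_of_le_one_right (abs_nonneg _) (bi _ _)) (mul_le_of_le_one_left (abs_nonneg _) (b1 _))
    _ ≤ _ := by rw [integral_add j1 j2]; linarith

lemma set_mix {m : Measure QQ} [IsProbabilityMeasure m] {γ : ℕ → Measure (QQ × QQ)} [∀ n, IsProbabilityMeasure (γ n)]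
    (h1 : ∀ n, (γ n).map Prod.fst = m) (h2 : ∀ n, (γ n).map Prod.snd = m)
    (H : ∀ φ ψ : C(QQ, ℝ), Tendsto (fun n => ∫ p, φ p.1 * ψ p.2 ∂(γ n)) atTop (𝓝 ((∫ p, φ p ∂m) * ∫ p, ψ p ∂m)))
    {A B : Set QQ} (hA : MeasurableSet A) (hB : MeasurableSet B) :
    Tendsto (fun n => γ n (A ×ˢ B)) atTop (𝓝 (m A * m B)) := by
  have : m A * m B = (m.prod m) (A ×ˢ B) := (Measure.prod_prod _ _).symm
  rw [this, ← ENNReal.tendsto_toReal_iff (fun n => measure_ne_top _ _) (measure_ne_top _ _)]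
  change Tendsto (fun n => (γ n).real (A ×ˢ B)) atTop (𝓝 ((m.prod m).real (A ×ˢ B)))
  rw [Metric.tendsto_atTop']
  intro ε hε
  obtain ⟨φ, b1, e1⟩ := clamp_ex m hA (ε := ε / 6) (by positivity)
  obtain ⟨ψ, b2, e2⟩ := clamp_ex m hB (ε := ε / 6) (by positivity)
  have hH := H φ ψ
  have hp : ∫ p, φ p.1 * ψ p.2 ∂(m.prod m) = (∫ p, φ p ∂m) * ∫ p, ψ p ∂m := integral_prod_mul _ _
  rw [← hp, Metric.tendsto_atTop'] at hH
  obtain ⟨N, hN⟩ := hH (ε / 3) (by positivity)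
  refine ⟨N, fun n hn => ?_⟩
  have k1 := joint_bd (h1 n) (h2 n) hA hB b1 b2 e1 e2
  have k2 := joint_bd (m := m) (γ := m.prod m) (Measure.map_fst_prod.trans (by simp)) (Measure.map_snd_prod.trans (by simp)) hA hB b1 b2 e1 e2
  have k3 := hN n hn
  rw [Real.dist_eq] at *
  rw [abs_le] at k1 k2
  rw [abs_lt] at *
  constructor <;> linarith

/-- set mixing for the limit -/
lemma Core.sets {Φ Ψ K s} (h : Core Φ Ψ K s) {A B : Set QQ} (hA : MeasurableSet A) (hB : MeasurableSet B) :
    Tendsto (fun n => nt K (NQ ⁻¹' B ∩ ((tang Φ)^[s n]) ⁻¹' (NQ ⁻¹' A))) atTop (𝓝 (nt K (NQ ⁻¹' A) * nt K (NQ ⁻¹' B))) := by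
  have := h.pr
  have pm : IsProbabilityMeasure ((nt K).map NQ) := Measure.isProbabilityMeasure_map measurable_NQ.aemeasurable
  have mt : ∀ l, MeasurePreserving ((tang Φ)^[l]) (nt K) (nt K) := fun l => h.mp.iterate l
  have ma : ∀ n, Measurable fun w => NQ ((tang Φ)^[s n] w) := fun n => measurable_NQ.comp (mt _).measurable
  have mg : ∀ n, Measurable fun w => (NQ ((tang Φ)^[s n] w), NQ w) := fun n => (ma n).prodMk measurable_NQ
  have hC := bil2 (P := nt K) (m := (nt K).map NQ) (a := fun n w => NQ ((tang Φ)^[s n] w)) (b := fun n w => NQ w) ma (fun n => measurable_NQ) (fun c d => by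
    rw [map_NQ, map_NQ]; exact h.mix c d)
  have pγ : ∀ n, IsProbabilityMeasure ((nt K).map fun w => (NQ ((tang Φ)^[s n] w), NQ w)) := fun n => Measure.isProbabilityMeasure_map (mg n).aemeasurable
  have key := set_mix (m := (nt K).map NQ) (γ := fun n => (nt K).map fun w => (NQ ((tang Φ)^[s n] w), NQ w)) (fun n => by
      rw [Measure.map_map measurable_fst (mg n)]
      change Measure.map (NQ ∘ ((tang Φ)^[s n])) _ = _
      rw [← Measure.map_map measurable_NQ (mt _).measurable, (mt _).map_eq]) (fun n => by
      rw [Measure.map_map measurable_snd (mg n)]; rfl) (fun φ ψ => by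
      have := hC ⟨fun p => ((φ p : ℝ) : ℂ), Complex.continuous_ofReal.comp φ.continuous⟩ ⟨fun p => ((ψ p : ℝ) : ℂ), Complex.continuous_ofReal.comp ψ.continuous⟩
      simp only [ContinuousMap.coe_mk, ← Complex.ofReal_mul, integral_complex_ofReal] at this
      have h2 := (Complex.continuous_re.tendsto _).comp this
      rw [Complex.ofReal_re] at h2
      refine h2.congr fun n => ?_
      rw [integral_map (mg n).aemeasurable (f := fun p : QQ × QQ => φ p.1 * ψ p.2) ((φ.continuous.measurable.comp measurable_fst).mul (ψ.continuous.measurable.comp measurable_snd)).aestronglyMeasurable]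
      simp) hA hB
  rw [Measure.map_apply measurable_NQ hA, Measure.map_apply measurable_NQ hB] at key
  refine key.congr fun n => ?_
  rw [Measure.map_apply (mg n) (hA.prod hB)]
  congr 1; ext w; simp only [mem_preimage, mem_prod, mem_inter_iff]; tauto


instance : BorelSpace PP := ⟨rfl⟩

lemma continuous_mkP : Continuous fun v : {v : ℝ × ℝ // v ≠ 0} => Projectivization.mk ℝ v.1 v.2 :=
  continuous_quotient_mk'

def bt (v : ℝ × ℝ) : PP := Projectivization.mk ℝ (ev (nrm v)) (ev_ne _)
lemma bt_eq {v : ℝ × ℝ} (hv : v ≠ 0) : bt v = Projectivization.mk ℝ v hv := by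
  rw [bt, Projectivization.mk_eq_mk_iff']
  exact ⟨_, (ev_nrm hv).symm⟩
lemma bt_smul {v : ℝ × ℝ} (hv : v ≠ 0) {t : ℝ} (ht : t ≠ 0) : bt (t • v) = bt v := by
  rw [bt_eq hv, bt_eq (smul_ne_zero ht hv), Projectivization.mk_eq_mk_iff']
  exact ⟨t, rfl⟩
lemma measurable_bt : Measurable bt := by
  have h : Continuous fun u : T1 => Projectivization.mk ℝ (ev u) (ev_ne u) :=
    continuous_mkP.comp (continuous_ev.subtype_mk ev_ne)
  exact h.measurable.comp measurable_nrm

def kpQ (p : QQ) : T2 × PP := (p.1, Projectivization.mk ℝ (ev p.2) (ev_ne _))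
lemma measurable_kpQ : Measurable kpQ := by
  have h : Continuous fun u : T1 => Projectivization.mk ℝ (ev u) (ev_ne u) :=
    continuous_mkP.comp (continuous_ev.subtype_mk ev_ne)
  exact measurable_fst.prodMk (h.measurable.comp measurable_snd)
def kp (w : EE) : T2 × PP := (w.1, bt w.2)
lemma kp_eq (w) : kp w = kpQ (NQ w) := rfl
lemma measurable_kp : Measurable kp := measurable_kpQ.comp measurable_NQ

def GS (L : PP) : ℝ × ℝ := Projectivization.lift (fun v : {v : ℝ × ℝ // v ≠ 0} => (v.1.1 ^ 2 / (v.1.1 ^ 2 + v.1.2 ^ 2), v.1.1 * v.1.2 / (v.1.1 ^ 2 + v.1.2 ^ 2))) (by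
  rintro ⟨a, ha⟩ ⟨b, hb⟩ t h
  simp only at h
  have ht : t ≠ 0 := by rintro rfl; rw [zero_smul] at h; exact ha h
  subst h
  simp only [Prod.smul_fst, Prod.smul_snd, smul_eq_mul]
  have e : (t * b.1) ^ 2 + (t * b.2) ^ 2 = t ^ 2 * (b.1 ^ 2 + b.2 ^ 2) := by ring
  have e1 : (t * b.1) ^ 2 = t ^ 2 * (b.1 ^ 2) := by ring
  have e2 : (t * b.1) * (t * b.2) = t ^ 2 * (b.1 * b.2) := by ring
  rw [e, e1, e2, mul_div_mul_left _ _ (pow_ne_zero 2 ht), mul_div_mul_left _ _ (pow_ne_zero 2 ht)]) L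
lemma sq_ne {v : ℝ × ℝ} (hv : v ≠ 0) : v.1 ^ 2 + v.2 ^ 2 ≠ 0 := fun h => hv (by
  have h1 : v.1 = 0 := by nlinarith [sq_nonneg v.1, sq_nonneg v.2]
  have h2 : v.2 = 0 := by nlinarith [sq_nonneg v.1, sq_nonneg v.2]
  exact Prod.ext h1 h2)
lemma GS_mk {v : ℝ × ℝ} (hv : v ≠ 0) : GS (Projectivization.mk ℝ v hv) = (v.1 ^ 2 / (v.1 ^ 2 + v.2 ^ 2), v.1 * v.2 / (v.1 ^ 2 + v.2 ^ 2)) := rfl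
lemma continuous_GS : Continuous GS := by
  refine Continuous.quotient_lift ?_ _
  have h : ∀ v : {v : ℝ × ℝ // v ≠ 0}, v.1.1 ^ 2 + v.1.2 ^ 2 ≠ 0 := fun v => sq_ne v.2
  exact (Continuous.div (by fun_prop) (by fun_prop) h).prodMk (Continuous.div (by fun_prop) (by fun_prop) h)

def sg (L : PP) : ℝ × ℝ := if (GS L).1 = 0 then (0, 1) else GS L
lemma measurable_sg : Measurable sg :=
  Measurable.ite ((measurable_fst.comp continuous_GS.measurable) (measurableSet_singleton 0)) measurable_const continuous_GS.measurable
lemma sg_mk {v : ℝ × ℝ} (hv : v ≠ 0) : ∃ t : ℝ, t ≠ 0 ∧ sg (Projectivization.mk ℝ v hv) = t • v := by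
  have hs := sq_ne hv
  rw [sg, GS_mk]
  by_cases h : v.1 = 0
  · have h2 : v.2 ≠ 0 := fun h2 => hv (Prod.ext h h2)
    refine ⟨v.2⁻¹, inv_ne_zero h2, ?_⟩
    rw [if_pos (by simp [h])]
    ext <;> simp [h, h2]
  · refine ⟨v.1 / (v.1 ^ 2 + v.2 ^ 2), div_ne_zero h hs, ?_⟩
    rw [if_neg (by simp only; exact div_ne_zero (pow_ne_zero 2 h) hs)]
    ext <;> simp <;> ring

def DF (Φ : ℂ × ℂ → ℂ × ℂ) (p : T2 × PP) : T2 × PP := kp (tang Φ (p.1, sg p.2))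

section
variable {Φ Ψ : ℂ × ℂ → ℂ × ℂ} {K : EE → ℝ} {s : ℕ → ℕ} (h : Core Φ Ψ K s)
include h
lemma Core.meas_DF : Measurable (DF Φ) :=
  measurable_kp.comp ((h.r1.continuous_tang h.c1).measurable.comp (measurable_fst.prodMk (measurable_sg.comp measurable_snd)))
lemma Core.DF_kp (w : EE) (hw : w.2 ≠ 0) : DF Φ (kp w) = kp (tang Φ w) := by
  obtain ⟨t, ht, e⟩ := sg_mk hw
  have h1 : dr Φ (rep w.1) w.2 ≠ 0 := tang_zero h.r1 h.r2 h.i2 w hw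
  rw [DF]
  simp only [kp, bt_eq hw, e]
  refine Prod.ext rfl ?_
  change bt (dr Φ (rep w.1) (t • w.2)) = bt (dr Φ (rep w.1) w.2)
  rw [map_smul, bt_smul h1 ht]
lemma Core.DF_iter (w : EE) (hw : w.2 ≠ 0) (l : ℕ) : (DF Φ)^[l] (kp w) = kp ((tang Φ)^[l] w) := by
  induction l with
  | zero => rfl
  | succ l ih => rw [Function.iterate_succ_apply', ih, h.DF_kp _ (tang_iter_zero h.r1 h.r2 h.i2 w hw l), Function.iterate_succ_apply']
lemma Core.ne : ∀ᵐ w ∂(nt K), w.2 ≠ 0 := (withDensity_absolutelyContinuous _ _).ae_le vol_ne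
lemma Core.mpDF : MeasurePreserving (DF Φ) ((nt K).map kp) ((nt K).map kp) := by
  refine ⟨h.meas_DF, ?_⟩
  rw [Measure.map_map h.meas_DF measurable_kp, Measure.map_congr (g := kp ∘ tang Φ) (by filter_upwards [h.ne] with w hw using h.DF_kp w hw),
    ← Measure.map_map measurable_kp h.mp.measurable, h.mp.map_eq]
lemma Core.wm : WeakMixing ((nt K).map kp) (DF Φ) := by
  refine ⟨s, h.sm, fun A B hA hB => ?_⟩
  have := h.sets (measurable_kpQ hA) (measurable_kpQ hB)
  rw [Measure.map_apply measurable_kp hA, Measure.map_apply measurable_kp hB]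
  refine this.congr fun n => ?_
  rw [Measure.map_apply measurable_kp (hB.inter (h.meas_DF.iterate _ hA))]
  refine measure_congr ?_
  filter_upwards [h.ne] with w hw
  apply propext
  change (kp w ∈ B ∧ kp ((tang Φ)^[s n] w) ∈ A) ↔ (kp w ∈ B ∧ (DF Φ)^[s n] (kp w) ∈ A)
  rw [h.DF_iter w hw]
lemma Core.pde : IsProjDerivExt (rl Φ) (tor Φ) (DF Φ) := by
  intro a v hv hw
  have e := (h.r1.hasFDerivAt_rl a).fderiv
  obtain ⟨t, ht, et⟩ := sg_mk hv
  have e1 : DF Φ (pro a, Projectivization.mk ℝ v hv) = kp (Pj (TL Φ (a, t • v))) := by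
    rw [DF, ← h.r1.tang_Pj]; simp only [et, Pj]
  rw [e1, h.r1.tor_pro]
  refine Prod.ext rfl ?_
  change bt (dr Φ a (t • v)) = _
  have hw' : dr Φ a v ≠ 0 := by rw [← e]; exact hw
  rw [map_smul, bt_smul hw' ht, bt_eq hw']
  congr 1; rw [e]
lemma Core.tor_mp : MeasurePreserving (tor Φ) (volume : Measure T2) volume := by
  have hm : Measurable (tor Φ) := measurable_fst.comp ((h.r1.continuous_tang h.c1).measurable.comp (measurable_id.prodMk (measurable_const (a := (0 : ℝ × ℝ)))))
  refine ⟨hm, ?_⟩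
  conv_lhs => rw [← h.mg]
  rw [Measure.map_map hm measurable_fst]
  change Measure.map (Prod.fst ∘ tang Φ) (nt K) = _
  rw [← Measure.map_map measurable_fst h.mp.measurable, h.mp.map_eq, h.mg]
end
lemma tor_inv {Φ Ψ} (r1 : Reg Φ) (r2 : Reg Ψ) (i : ∀ z, Φ (Ψ z) = z) (z) : tor Φ (tor Ψ z) = z := by
  rw [← r1.tor_comp r2, show Φ ∘ Ψ = id from funext i]
  exact congrArg Prod.fst (tang_id (z, 0))


lemma circDir_eq (t) : circDir t = bt (Real.cos t, Real.sin t) := by rw [bt_eq]; rfl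
lemma cs_ne (t : ℝ) : ((Real.cos t, Real.sin t) : ℝ × ℝ) ≠ 0 := fun h => by
  have h1 : Real.cos t = 0 := congrArg Prod.fst h
  have h2 : Real.sin t = 0 := congrArg Prod.snd h
  have h3 := Real.sin_sq_add_cos_sq t
  rw [h1, h2] at h3
  norm_num at h3
lemma measurable_circDir : Measurable circDir := by
  have : circDir = bt ∘ fun t => (Real.cos t, Real.sin t) := funext circDir_eq
  rw [this]; exact measurable_bt.comp (by fun_prop)
lemma bt_ac : (volume : Measure (ℝ × ℝ)).map bt ≪ circMeasure := by
  refine Measure.AbsolutelyContinuous.mk fun N hN h0 => ?_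
  have hS : MeasurableSet (circDir ⁻¹' N) := measurable_circDir hN
  rw [circMeasure, Measure.map_apply measurable_circDir hN, Measure.restrict_apply hS] at h0
  set S := circDir ⁻¹' N with hSd
  have h1 : volume (S ∩ Ioo (-Real.pi) Real.pi) = 0 := by
    have h2 : volume ((fun t => t + 2 * Real.pi) ⁻¹' (S ∩ Ico 0 (2 * Real.pi))) = 0 := by
      rw [measure_preimage_add_right]; exact h0
    refine measure_mono_null ?_ (measure_union_null h0 h2)
    rintro t ⟨ht, ht1, ht2⟩
    have hp := Real.pi_pos
    rcases le_or_gt 0 t with h | h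
    · exact Or.inl ⟨ht, h, by linarith⟩
    · refine Or.inr ⟨?_, by simp only; linarith, by simp only; linarith⟩
      simp only [hSd, mem_preimage] at ht ⊢
      rw [circDir_eq, Real.cos_add_two_pi, Real.sin_add_two_pi, ← circDir_eq]; exact ht
  rw [Measure.map_apply measurable_bt hN, ← lintegral_indicator_one (measurable_bt hN), ← lintegral_comp_polarCoord_symm]
  have h3 : volume (univ ×ˢ (S ∩ Ioo (-Real.pi) Real.pi) : Set (ℝ × ℝ)) = 0 := by
    rw [Measure.volume_eq_prod, Measure.prod_prod, h1, mul_zero]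
  rw [lintegral_eq_zero_iff' ?_]
  · rw [Filter.EventuallyEq, ae_restrict_iff' polarCoord.open_target.measurableSet]
    filter_upwards [compl_mem_ae_iff.2 h3] with p hp ht
    have hr : 0 < p.1 := ht.1
    have e : bt (polarCoord.symm p) = circDir p.2 := by
      rw [circDir_eq, ← bt_smul (cs_ne p.2) hr.ne']; simp
    have : polarCoord.symm p ∉ bt ⁻¹' N := fun h => hp ⟨mem_univ _, by
      rw [mem_preimage, e] at h; exact h, ht.2⟩
    rw [indicator_of_notMem this, smul_zero]; rfl
  · have h4 : Measurable (polarCoord.symm : ℝ × ℝ → ℝ × ℝ) := continuous_polarCoord_symm.measurable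
    have h5 : Measurable ((bt ⁻¹' N).indicator (1 : ℝ × ℝ → ENNReal)) := measurable_one.indicator (measurable_bt hN)
    exact ((measurable_fst.ennreal_ofReal).smul (h5.comp h4)).aemeasurable

section
variable {Φ Ψ : ℂ × ℂ → ℂ × ℂ} {K : EE → ℝ} {s : ℕ → ℕ} (h : Core Φ Ψ K s)
include h
lemma Core.prodset {A : Set T2} {B : Set (ℝ × ℝ)} (hA : MeasurableSet A) (hB : MeasurableSet B) :
    nt K (A ×ˢ B) = ∫⁻ x in A, (volume.withDensity fun v => ENNReal.ofReal (K (x, v))) B := by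
  rw [nt, withDensity_apply _ (hA.prod hB), Measure.volume_eq_prod, ← Measure.prod_restrict, lintegral_prod _ h.hm.ennreal_ofReal.aemeasurable]
  congr 1; ext x
  rw [withDensity_apply _ hB]
lemma Core.marg : MarginalMuAbsCtsFibers ((nt K).map kp) := by
  classical
  refine ⟨?_, ?_⟩
  · rw [Measure.map_map measurable_fst measurable_kp]; exact h.mg
  let D : T2 → Measure (ℝ × ℝ) := fun x => volume.withDensity fun v => ENNReal.ofReal (K (x, v))
  have hD : ∀ x, D x ≪ volume := fun x => withDensity_absolutelyContinuous _ _
  have M1 : ∀ᵐ x, D x univ = 1 := by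
    have hm : Measurable fun x => D x univ := by
      have : (fun x => D x univ) = fun x => ∫⁻ v, ENNReal.ofReal (K (x, v)) := by
        ext x; simp only [D]; rw [withDensity_apply _ MeasurableSet.univ, Measure.restrict_univ]
      rw [this]
      exact h.hm.ennreal_ofReal.lintegral_prod_right'
    refine ae_eq_of_forall_setLIntegral_eq_of_sigmaFinite hm measurable_const fun A hA _ => ?_
    rw [← h.prodset hA MeasurableSet.univ, setLIntegral_const, one_mul, ← h.mg, Measure.map_apply measurable_fst hA]
    congr 1; ext; simp
  let x0 : PP := bt 0
  refine ⟨fun x => if D x univ = 1 then (D x).map bt else Measure.dirac x0, fun x => ?_, fun A B hA hB => ?_, ?_⟩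
  · by_cases hx : D x univ = 1
    · simp only [hx, if_true]
      have : IsProbabilityMeasure (D x) := ⟨hx⟩
      exact Measure.isProbabilityMeasure_map measurable_bt.aemeasurable
    · simp only [hx, if_false]; infer_instance
  · rw [Measure.map_apply measurable_kp (hA.prod hB)]
    have e : kp ⁻¹' (A ×ˢ B) = A ×ˢ (bt ⁻¹' B) := rfl
    rw [e, h.prodset hA (measurable_bt hB)]
    refine lintegral_congr_ae (ae_restrict_of_ae ?_)
    filter_upwards [M1] with x hx
    simp only [hx, if_true]
    rw [Measure.map_apply measurable_bt hB]
  · filter_upwards [M1] with x hx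
    simp only [hx, if_true]
    exact ((hD x).map measurable_bt).trans bt_ac
end
lemma ext_rl {Φ} (r : Reg Φ) : IsEntireExtension (rl Φ) Φ := ⟨r.diff, fun x => r.real x⟩
lemma zper_rl {Φ} (r : Reg Φ) : Zper (rl Φ) := fun x m => r.rl_per x m

/-- Theorem 1.2. There exist a measure-preserving bijection `f̂` of
`T²` whose lift (and the lift of its inverse) extends to an entire holomorphic map
`ℂ² → ℂ²`, and a Borel probability measure `ν` on `T² × ℙ(ℝ²)` with marginal `μ` and
absolutely continuous fibers, invariant under the projectivized derivative extension
`(f̂, df̂)`, such that `(f̂, df̂)` is weakly mixing w.r.t. `ν`. -/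
theorem statement1 :
    ∃ (f fi : T2 → T2) (F Fi : ℝ × ℝ → ℝ × ℝ) (Φ Φi : ℂ × ℂ → ℂ × ℂ)
      (ν : Measure (T2 × PP)) (Df : T2 × PP → T2 × PP),
      Function.LeftInverse fi f ∧ Function.RightInverse fi f ∧
      MeasurePreserving f (volume : Measure T2) volume ∧
      Zper F ∧ Zper Fi ∧
      (∀ x : ℝ × ℝ, pro (F x) = f (pro x)) ∧
      (∀ x : ℝ × ℝ, pro (Fi x) = fi (pro x)) ∧
      IsEntireExtension F Φ ∧ IsEntireExtension Fi Φi ∧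
      IsProbabilityMeasure ν ∧
      MarginalMuAbsCtsFibers ν ∧
      IsProjDerivExt F f Df ∧
      MeasurePreserving Df ν ν ∧
      WeakMixing ν Df := by
  obtain ⟨Φ, Ψ, K, s, h⟩ := core_ex
  have := h.pr
  exact ⟨tor Φ, tor Ψ, rl Φ, rl Ψ, Φ, Ψ, (nt K).map kp, DF Φ, tor_inv h.r2 h.r1 h.i2, tor_inv h.r1 h.r2 h.i1,
    h.tor_mp, zper_rl h.r1, zper_rl h.r2, fun x => (h.r1.tor_pro x).symm, fun x => (h.r2.tor_pro x).symm,
    ext_rl h.r1, ext_rl h.r2, Measure.isProbabilityMeasure_map measurable_kp.aemeasurable, h.marg, h.pde, h.mpDF, h.wm⟩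
end
end

section
/- Let p, q, Q be positive integers with gcd(p, Q) = 1 and q ≤ Q. Then there exist m ∈ {1, …, Q} and k ∈ ℤ such that |m·q·p/Q − 1/2 + k| ≤ q/Q; consequently there is an integer j with |m·p/Q − 1/(2q) + j/q| ≤ 1/Q. -/
/-- the arithmetic fact behind the choice of the mixing sequence.
For positive integers `p, q, Q` with `gcd(p, Q) = 1` and `q ≤ Q`, there are
`m ∈ {1, …, Q}` and `k ∈ ℤ` with `|m·q·p/Q − 1/2 + k| ≤ q/Q`; consequently there is
`j ∈ ℤ` with `|m·p/Q − 1/(2q) + j/q| ≤ 1/Q`. -/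
theorem statement8 (p q Q : ℕ) (hp : 0 < p) (hq : 0 < q) (hQ : 0 < Q)
    (hgcd : Nat.gcd p Q = 1) (hqQ : q ≤ Q) :
    ∃ m : ℕ, 1 ≤ m ∧ m ≤ Q ∧
      (∃ k : ℤ, |(m : ℝ) * q * p / Q - 1 / 2 + (k : ℝ)| ≤ (q : ℝ) / Q) ∧
      (∃ j : ℤ, |(m : ℝ) * p / Q - 1 / (2 * (q : ℝ)) + (j : ℝ) / q| ≤ 1 / (Q : ℝ)) := by
  have hbez := Nat.gcd_eq_gcd_ab p Q
  rw [hgcd] at hbez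
  obtain ⟨t, ht⟩ : ∃ t : ℕ, t = Q / (2 * q) := ⟨_, rfl⟩
  have h1 : 2 * q * t ≤ Q := by rw [ht]; exact Nat.mul_div_le Q (2 * q)
  have h2 : Q < 2 * q * (t + 1) := by
    rw [ht]; exact Nat.lt_mul_div_succ Q (by positivity)
  have hQz : (0 : ℤ) < Q := by exact_mod_cast hQ
  obtain ⟨m, s, hm1, hm2, hms⟩ : ∃ (m : ℕ) (s : ℤ), 1 ≤ m ∧ m ≤ Q ∧
      (m : ℤ) * p = t + Q * s := by
    generalize Nat.gcdA p Q = a at hbez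
    generalize Nat.gcdB p Q = b at hbez
    have e := Int.emod_add_mul_ediv ((t : ℤ) * a - 1) Q
    have e0 := Int.emod_nonneg ((t : ℤ) * a - 1) hQz.ne'
    have e1 := Int.emod_lt_of_pos ((t : ℤ) * a - 1) hQz
    generalize ((t : ℤ) * a - 1) / Q = d at e
    generalize ((t : ℤ) * a - 1) % Q = r at e e0 e1
    lift r to ℕ using e0
    refine ⟨r + 1, -t * b - d * p, by omega, by omega, ?_⟩
    push_cast at hbez ⊢
    linear_combination (p : ℤ) * e - t * hbez
  have hqr : (0 : ℝ) < q := by exact_mod_cast hq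
  have hQr : (0 : ℝ) < Q := by exact_mod_cast hQ
  have h1r : 2 * (q : ℝ) * t ≤ Q := by exact_mod_cast h1
  have h2r : (Q : ℝ) < 2 * q * (t + 1) := by exact_mod_cast h2
  have hmr : (m : ℝ) * p = t + Q * s := by exact_mod_cast hms
  have key : |(m : ℝ) * q * p / Q - 1 / 2 + ((-(q * s) : ℤ) : ℝ)| ≤ (q : ℝ) / Q := by
    have : (m : ℝ) * q * p / Q - 1 / 2 + ((-(q * s) : ℤ) : ℝ) = (2 * q * t - Q) / 2 / Q := by
      push_cast
      field_simp
      linear_combination 2 * (q : ℝ) * hmr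
    rw [this, abs_div, abs_of_pos hQr]
    gcongr
    rw [abs_le]
    constructor <;> linarith
  refine ⟨m, hm1, hm2, ⟨_, key⟩, ⟨-(q * s), ?_⟩⟩
  have : (m : ℝ) * p / Q - 1 / (2 * (q : ℝ)) + ((-(q * s) : ℤ) : ℝ) / q
      = ((m : ℝ) * q * p / Q - 1 / 2 + ((-(q * s) : ℤ) : ℝ)) / q := by
    field_simp
  rw [this, abs_div, abs_of_pos hqr, div_le_iff₀ hqr]
  calc _ ≤ _ := key
    _ = _ := by ring
end

section
/- Let (X, 𝒜, μ) be a measure space, let N ≥ 3, and let A_1, …, A_N ∈ 𝒜 have finite measure. Let δ_1, …, δ_{N−1} be nonnegative reals and assume μ(A_i △ A_{i+1}) ≤ δ_i · μ(A_i) for all 1 ≤ i ≤ N−1. Then μ(A_1 ∩ A_2 ∩ ⋯ ∩ A_N) ≥ (1 − Σ_{u=1}^{N−2} (Π_{j=u+1}^{N−1} (1+δ_j)) · δ_u − δ_{N−1}) · μ(A_1). -/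
open MeasureTheory

lemma aux_sum (δ : ℕ → ℝ) (n : ℕ) :
    ∑ u ∈ Finset.Icc 1 n, (∏ j ∈ Finset.Icc (u + 1) n, (1 + δ j)) * δ u
      = ∏ j ∈ Finset.Icc 1 n, (1 + δ j) - 1 := by
  induction n with
  | zero => simp
  | succ n ih =>
    rw [Finset.sum_Icc_succ_top (by omega), Finset.prod_Icc_succ_top (show 1 ≤ n + 1 by omega)]
    have : ∑ u ∈ Finset.Icc 1 n, (∏ j ∈ Finset.Icc (u + 1) (n + 1), (1 + δ j)) * δ u
        = (∑ u ∈ Finset.Icc 1 n, (∏ j ∈ Finset.Icc (u + 1) n, (1 + δ j)) * δ u)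
          * (1 + δ (n + 1)) := by
      rw [Finset.sum_mul]
      refine Finset.sum_congr rfl fun u hu => ?_
      rw [Finset.mem_Icc] at hu
      rw [Finset.prod_Icc_succ_top (by omega)]
      ring
    rw [this, ih]
    simp
    ring

/-- estimate (10) on the intersection along a chain of sets.
If `μ(A_i △ A_{i+1}) ≤ δ_i · μ(A_i)` for `1 ≤ i ≤ N−1`, then
`μ(A_1 ∩ ⋯ ∩ A_N) ≥ (1 − Σ_{u=1}^{N−2} (Π_{j=u+1}^{N−1} (1+δ_j)) δ_u − δ_{N−1}) · μ(A_1)`. -/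
theorem statement10 {X : Type*} [MeasurableSpace X] (μ : Measure X) (N : ℕ) (hN : 3 ≤ N)
    (A : ℕ → Set X) (δ : ℕ → ℝ)
    (hmeas : ∀ i ∈ Finset.Icc 1 N, MeasurableSet (A i))
    (hfin : ∀ i ∈ Finset.Icc 1 N, μ (A i) ≠ ⊤)
    (hδ : ∀ i ∈ Finset.Icc 1 (N - 1), 0 ≤ δ i)
    (hclose : ∀ i ∈ Finset.Icc 1 (N - 1),
      μ (symmDiff (A i) (A (i + 1))) ≤ ENNReal.ofReal (δ i) * μ (A i)) :
    ENNReal.ofReal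
        (1 - (∑ u ∈ Finset.Icc 1 (N - 2), (∏ j ∈ Finset.Icc (u + 1) (N - 1), (1 + δ j)) * δ u)
          - δ (N - 1)) * μ (A 1)
      ≤ μ (⋂ i ∈ Finset.Icc 1 N, A i) := by
  obtain ⟨M, rfl⟩ : ∃ M, N = M + 2 := ⟨N - 2, by omega⟩
  have e1 : M + 2 - 1 = M + 1 := by omega
  have e2 : M + 2 - 2 = M := by omega
  rw [e1] at hδ hclose
  rw [e1, e2]
  have hS := aux_sum δ (M + 1)
  rw [Finset.sum_Icc_succ_top (by omega)] at hS
  simp at hS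
  have key : ∀ n, n ≤ M + 1 →
      μ.real (A (n + 1)) ≤ (∏ j ∈ Finset.Icc 1 n, (1 + δ j)) * μ.real (A 1) ∧
      μ.real (A 1) ≤ μ.real (⋂ i ∈ Finset.Icc 1 (n + 1), A i)
        + (∏ j ∈ Finset.Icc 1 n, (1 + δ j) - 1) * μ.real (A 1) := by
    intro n
    induction n with
    | zero => intro _; simp
    | succ n ih =>
      intro hn
      obtain ⟨h1, h2⟩ := ih (by omega)
      have hmem : n + 1 ∈ Finset.Icc 1 (M + 1) := Finset.mem_Icc.2 ⟨by omega, hn⟩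
      have hd := hδ _ hmem
      have hc := hclose _ hmem
      have hf : μ (A (n + 1)) ≠ ⊤ := hfin _ (Finset.mem_Icc.2 ⟨by omega, by omega⟩)
      have hf1 : μ (A 1) ≠ ⊤ := hfin _ (Finset.mem_Icc.2 ⟨by omega, by omega⟩)
      have hfR : ENNReal.ofReal (δ (n + 1)) * μ (A (n + 1)) ≠ ⊤ :=
        ENNReal.mul_ne_top ENNReal.ofReal_ne_top hf
      have hfs := ne_top_of_le_ne_top hfR hc
      have hcr : μ.real (symmDiff (A (n + 1)) (A (n + 1 + 1))) ≤ δ (n + 1) * μ.real (A (n + 1)) := by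
        have := ENNReal.toReal_mono hfR hc
        rwa [ENNReal.toReal_mul, ENNReal.toReal_ofReal hd] at this
      have hfI : μ (⋂ i ∈ Finset.Icc 1 (n + 1 + 1), A i) ≠ ⊤ :=
        ne_top_of_le_ne_top hf1 (measure_mono
          (Set.biInter_subset_of_mem (show 1 ∈ Finset.Icc 1 (n + 1 + 1) by simp)))
      have s1 : A (n + 1 + 1) ⊆ A (n + 1) ∪ symmDiff (A (n + 1)) (A (n + 1 + 1)) := by
        intro x hx
        by_cases h : x ∈ A (n + 1)
        · exact Or.inl h
        · exact Or.inr (Or.inr ⟨hx, h⟩)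
      have s2 : (⋂ i ∈ Finset.Icc 1 (n + 1), A i) ⊆
          (⋂ i ∈ Finset.Icc 1 (n + 1 + 1), A i) ∪ symmDiff (A (n + 1)) (A (n + 1 + 1)) := by
        intro x hx
        simp only [Set.mem_iInter, Finset.mem_Icc] at hx
        by_cases h : x ∈ A (n + 1 + 1)
        · left
          simp only [Set.mem_iInter, Finset.mem_Icc]
          intro i hi
          rcases Nat.lt_or_ge i (n + 2) with h' | h'
          · exact hx i ⟨hi.1, by omega⟩
          · have : i = n + 1 + 1 := by omega
            rw [this]; exact h
        · exact Or.inr (Or.inl ⟨hx (n + 1) ⟨by omega, le_rfl⟩, h⟩)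
      have t1 := (measureReal_mono (μ := μ) s1 (measure_union_ne_top hf hfs)).trans
        (measureReal_union_le _ _)
      have t2 := (measureReal_mono (μ := μ) s2 (measure_union_ne_top hfI hfs)).trans
        (measureReal_union_le _ _)
      rw [Finset.prod_Icc_succ_top (by omega)]
      have h3 := mul_le_mul_of_nonneg_left h1 hd
      constructor <;> nlinarith
  obtain ⟨-, h⟩ := key (M + 1) le_rfl
  have hf1 : μ (A 1) ≠ ⊤ := hfin _ (Finset.mem_Icc.2 ⟨by omega, by omega⟩)
  have hfI : μ (⋂ i ∈ Finset.Icc 1 (M + 2), A i) ≠ ⊤ :=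
    ne_top_of_le_ne_top hf1 (measure_mono
      (Set.biInter_subset_of_mem (show 1 ∈ Finset.Icc 1 (M + 2) by simp)))
  rw [← ENNReal.ofReal_toReal hf1, ← ENNReal.ofReal_toReal hfI,
    ← ENNReal.ofReal_mul' ENNReal.toReal_nonneg]
  apply ENNReal.ofReal_le_ofReal
  change _ * μ.real (A 1) ≤ μ.real _
  rw [← hS] at h
  linarith
end
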